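/- arXiv:1405.5264 — 5 statements merged into one kernel-verified Lean document; each statement's English description precedes it below -/
import Mathlib

section
/- Let d ≥ 1, h > 0, let D : ℝ^d → ℝ be measurable with inf_x D(x) > 0, and let ρ_eq : ℝ^d → ℝ be a measurable probability density with ρ_eq(x) > 0 for all x; let ν be the probability measure with density ρ_eq. Let P be the Metropolis–Hastings transition kernel P(x, A) = ∫_A α_h(x,y) q_h(x,y) dy + (1 − ∫_{ℝ^d} α_h(x,y) q_h(x,y) dy) · 1_A(x), and let P^n(x,·) denote its n-step transition probability. Then for every x ∈ ℝ^d, sup { |P^n(x,A) − ν(A)| : A ⊆ ℝ^d measurable } → 0 as n → ∞. -/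
open Real MeasureTheory Filter

/-- Trial transition density
`q_h(x,y) = (4πhD(x))^{-d/2} exp(−|y−x|²/(4hD(x)))`. -/
noncomputable def qh {d : ℕ} (D : EuclideanSpace ℝ (Fin d) → ℝ) (h : ℝ)
    (x y : EuclideanSpace ℝ (Fin d)) : ℝ :=
  (4 * π * h * D x) ^ (-(d : ℝ) / 2) * Real.exp (-‖y - x‖ ^ 2 / (4 * h * D x))

/-- Metropolis–Hastings acceptance probability
`α_h(x,y) = min(1, q_h(y,x)ρ_eq(y)/(q_h(x,y)ρ_eq(x)))`. -/
noncomputable def alphah {d : ℕ} (D ρeq : EuclideanSpace ℝ (Fin d) → ℝ) (h : ℝ)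
    (x y : EuclideanSpace ℝ (Fin d)) : ℝ :=
  min 1 (qh D h y x * ρeq y / (qh D h x y * ρeq x))

/-- The `n`-step transition probability `P^n(x,A)` of the Metropolis–Hastings
kernel `P(x,A) = ∫_A α_h q_h dy + (1 − ∫ α_h q_h dy) 1_A(x)`, with
`P^0(x,A) = 1_A(x)`. -/
noncomputable def MHiter {d : ℕ} (D ρeq : EuclideanSpace ℝ (Fin d) → ℝ) (h : ℝ) :
    ℕ → EuclideanSpace ℝ (Fin d) → Set (EuclideanSpace ℝ (Fin d)) → ℝ
  | 0 => fun x A => A.indicator (fun _ => (1 : ℝ)) x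
  | n + 1 => fun x A =>
      (∫ y, MHiter D ρeq h n y A * (alphah D ρeq h x y * qh D h x y))
        + (1 - ∫ y, alphah D ρeq h x y * qh D h x y) * MHiter D ρeq h n x A

/-- A strictly positive symmetric jump density with respect to a measure `ν`, of total
mass at most one from every point. -/
structure IsJumpDensity {E : Type*} [MeasurableSpace E] (ν : Measure E) (κ : E → E → ℝ) :
    Prop where
  measurable : Measurable (Function.uncurry κ)
  pos : ∀ x y, 0 < κ x y
  symm : ∀ x y, κ x y = κ y x
  integrable : ∀ x, Integrable (κ x) ν
  integral_le_one : ∀ x, ∫ y, κ x y ∂ν ≤ 1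

/-- The Markov operator that jumps with density `κ` with respect to `ν` and stays put
with the remaining probability. -/
noncomputable def jumpOperator {E : Type*} [MeasurableSpace E] (ν : Measure E) (κ : E → E → ℝ)
    (f : E → ℝ) (x : E) : ℝ :=
  (∫ y, κ x y * f y ∂ν) + (1 - ∫ y, κ x y ∂ν) * f x

/-- Measurable functions bounded in absolute value by `C`. -/
def IsBoundedMeasurable {E : Type*} [MeasurableSpace E] (f : E → ℝ) (C : ℝ) : Prop :=
  Measurable f ∧ ∀ x, |f x| ≤ C

namespace IsBoundedMeasurable

variable {E : Type*} [MeasurableSpace E] {ν : Measure E} {f g : E → ℝ} {C C' : ℝ}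

lemma integrable [IsFiniteMeasure ν] (hf : IsBoundedMeasurable f C) : Integrable f ν :=
  Integrable.of_bound hf.1.aestronglyMeasurable C (.of_forall hf.2)

lemma mul (hf : IsBoundedMeasurable f C) (hg : IsBoundedMeasurable g C') :
    IsBoundedMeasurable (fun x => f x * g x) (C * C') :=
  ⟨hf.1.mul hg.1, fun x => by
    rw [abs_mul]
    exact mul_le_mul (hf.2 x) (hg.2 x) (abs_nonneg _) ((abs_nonneg _).trans (hf.2 x))⟩

lemma sub (hf : IsBoundedMeasurable f C) (hg : IsBoundedMeasurable g C') :
    IsBoundedMeasurable (fun x => f x - g x) (C + C') :=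
  ⟨hf.1.sub hg.1, fun x => (abs_sub _ _).trans (add_le_add (hf.2 x) (hg.2 x))⟩

lemma const (c : ℝ) : IsBoundedMeasurable (fun _ : E => c) |c| :=
  ⟨measurable_const, fun _ => le_rfl⟩

lemma sq (hf : IsBoundedMeasurable f C) : IsBoundedMeasurable (fun x => f x ^ 2) (C * C) := by
  simpa only [pow_two] using hf.mul hf

lemma integrable_mul (hf : IsBoundedMeasurable f C) (hg : Integrable g ν) :
    Integrable (fun x => g x * f x) ν :=
  hg.mul_bdd (c := C) hf.1.aestronglyMeasurable (.of_forall hf.2)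

lemma indicator_one {A : Set E} (hA : MeasurableSet A) :
    IsBoundedMeasurable (A.indicator fun _ => (1 : ℝ)) 1 :=
  ⟨measurable_const.indicator hA, fun x => by
    by_cases hx : x ∈ A <;> simp [hx]⟩

lemma comp {F : Type*} [MeasurableSpace F] (hf : IsBoundedMeasurable f C) {φ : F → E}
    (hφ : Measurable φ) : IsBoundedMeasurable (fun z => f (φ z)) C :=
  ⟨hf.1.comp hφ, fun z => hf.2 (φ z)⟩

end IsBoundedMeasurable

lemma integral_sub_const_sq {E : Type*} [MeasurableSpace E] {ν : Measure E}
    [IsProbabilityMeasure ν] {f : E → ℝ} (hf : Integrable f ν)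
    (hf2 : Integrable (fun x => f x ^ 2) ν) (c : ℝ) :
    ∫ x, (f x - c) ^ 2 ∂ν = (∫ x, f x ^ 2 ∂ν) - 2 * c * (∫ x, f x ∂ν) + c ^ 2 := by
  have e : (fun x => (f x - c) ^ 2) = fun x => f x ^ 2 - 2 * c * f x + c ^ 2 := by
    funext x; ring
  have hsub : Integrable (fun x => f x ^ 2 - 2 * c * f x) ν := hf2.sub (hf.const_mul _)
  rw [e, integral_add hsub (integrable_const _),
    integral_sub hf2 (hf.const_mul _), integral_const_mul]
  simp

/-- A uniformly bounded sequence of nonnegative functions whose integrals against a positive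
weight tend to zero has integrals tending to zero. -/
lemma tendsto_integral_of_tendsto_integral_weight {E : Type*} [MeasurableSpace E]
    {μ : Measure E} [IsProbabilityMeasure μ] {W : E → ℝ} (hWm : Measurable W)
    (hW : Integrable W μ) (hWpos : ∀ z, 0 < W z) {F : ℕ → E → ℝ} {C : ℝ}
    (hF : ∀ n, IsBoundedMeasurable (F n) C) (hF0 : ∀ n z, 0 ≤ F n z)
    (hlim : Tendsto (fun n => ∫ z, W z * F n z ∂μ) atTop (nhds 0)) :
    Tendsto (fun n => ∫ z, F n z ∂μ) atTop (nhds 0) := by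
  have hφ : ∀ k : ℕ, IsBoundedMeasurable (fun z => max 0 (1 - k * W z)) 1 := fun k =>
    ⟨measurable_const.max (measurable_const.sub (hWm.const_mul _)), fun z => by
      have : 0 ≤ (k : ℝ) * W z := mul_nonneg k.cast_nonneg (hWpos z).le
      rw [abs_of_nonneg (le_max_left _ _)]
      exact max_le zero_le_one (by linarith)⟩
  have hφlim : Tendsto (fun k : ℕ => ∫ z, max 0 (1 - k * W z) ∂μ) atTop (nhds 0) := by
    have := tendsto_integral_of_dominated_convergence (μ := μ) (f := fun _ => (0 : ℝ))
      (F := fun (k : ℕ) z => max 0 (1 - k * W z)) (fun _ => (1 : ℝ))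
      (fun k => (hφ k).1.aestronglyMeasurable) (integrable_const _)
      (fun k => .of_forall (hφ k).2) (.of_forall fun z => by
        obtain ⟨N, hN⟩ := exists_nat_gt (1 / W z)
        refine tendsto_const_nhds.congr' ?_
        filter_upwards [eventually_ge_atTop N] with k hk
        have hk' : (N : ℝ) ≤ k := by exact_mod_cast hk
        have : 1 < k * W z := (div_lt_iff₀ (hWpos z)).1 (hN.trans_le hk')
        exact (max_eq_left (by linarith)).symm)
    simpa using this
  have hbound : ∀ (k n : ℕ), ∫ z, F n z ∂μ
      ≤ C * (∫ z, max 0 (1 - k * W z) ∂μ) + k * ∫ z, W z * F n z ∂μ := fun k n => by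
    have hi := (hF n).integrable_mul hW
    rw [← integral_const_mul, ← integral_const_mul,
      ← integral_add ((hφ k).integrable.const_mul _) (hi.const_mul _)]
    refine integral_mono (hF n).integrable (((hφ k).integrable.const_mul _).add (hi.const_mul _))
      fun z => ?_
    have h1 : F n z * (1 - k * W z) ≤ F n z * max 0 (1 - k * W z) :=
      mul_le_mul_of_nonneg_left (le_max_right _ _) (hF0 n z)
    have h2 : F n z * max 0 (1 - k * W z) ≤ C * max 0 (1 - k * W z) :=
      mul_le_mul_of_nonneg_right ((le_abs_self _).trans ((hF n).2 z)) (le_max_left _ _)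
    simp only
    linarith
  rw [Metric.tendsto_atTop]
  intro ε hε
  have h1 : ∀ᶠ k : ℕ in atTop, C * (∫ z, max 0 (1 - k * W z) ∂μ) < ε / 2 :=
    (hφlim.const_mul C).eventually_lt_const (by simpa using half_pos hε)
  obtain ⟨k, hk⟩ := h1.exists
  have h2 : ∀ᶠ n in atTop, k * ∫ z, W z * F n z ∂μ < ε / 2 :=
    (hlim.const_mul (k : ℝ)).eventually_lt_const (by simpa using half_pos hε)
  obtain ⟨N, hN⟩ := eventually_atTop.1 h2
  refine ⟨N, fun n hn => ?_⟩
  rw [Real.dist_eq, sub_zero, abs_of_nonneg (integral_nonneg (hF0 n))]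
  linarith [hbound k n, hN n hn]

namespace IsJumpDensity

variable {E : Type*} [MeasurableSpace E] {ν : Measure E} {κ : E → E → ℝ} {f g : E → ℝ}
  {C C' : ℝ}

lemma holding_nonneg (hκ : IsJumpDensity ν κ) (x : E) : 0 ≤ 1 - ∫ y, κ x y ∂ν :=
  sub_nonneg.2 (hκ.integral_le_one x)

lemma measurable_integral [SFinite ν] (hκ : IsJumpDensity ν κ) :
    Measurable fun x => ∫ y, κ x y ∂ν :=
  hκ.measurable.stronglyMeasurable.integral_prod_right.measurable

lemma holding_isBoundedMeasurable [SFinite ν] (hκ : IsJumpDensity ν κ) :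
    IsBoundedMeasurable (fun x => 1 - ∫ y, κ x y ∂ν) 1 :=
  ⟨measurable_const.sub hκ.measurable_integral, fun x => by
    rw [abs_of_nonneg (hκ.holding_nonneg x)]
    have : 0 ≤ ∫ y, κ x y ∂ν := integral_nonneg fun y => (hκ.pos x y).le
    linarith⟩

lemma integrable_prod [IsProbabilityMeasure ν] (hκ : IsJumpDensity ν κ) :
    Integrable (Function.uncurry κ) (ν.prod ν) := by
  rw [integrable_prod_iff hκ.measurable.aestronglyMeasurable]
  refine ⟨.of_forall hκ.integrable, ?_⟩
  have e : ∀ x, ∫ y, ‖Function.uncurry κ (x, y)‖ ∂ν = ∫ y, κ x y ∂ν := fun x =>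
    integral_congr_ae (.of_forall fun y => abs_of_pos (hκ.pos x y))
  simp only [e]
  refine Integrable.of_bound hκ.measurable_integral.aestronglyMeasurable 1 (.of_forall fun x => ?_)
  rw [Real.norm_eq_abs, abs_of_nonneg (integral_nonneg fun y => (hκ.pos x y).le)]
  exact hκ.integral_le_one x

lemma jumpOperator_isBoundedMeasurable [SFinite ν] (hκ : IsJumpDensity ν κ)
    (hf : IsBoundedMeasurable f C) : IsBoundedMeasurable (jumpOperator ν κ f) C := by
  constructor
  · have h1 : Measurable fun x => ∫ y, κ x y * f y ∂ν :=
      (hκ.measurable.mul (hf.1.comp measurable_snd)).stronglyMeasurable.integral_prod_right.measurable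
    exact h1.add (hκ.holding_isBoundedMeasurable.1.mul hf.1)
  · intro x
    have h1 : |∫ y, κ x y * f y ∂ν| ≤ (∫ y, κ x y ∂ν) * C := by
      rw [← integral_mul_const]
      refine (abs_integral_le_integral_abs).trans (integral_mono
        (hf.integrable_mul (hκ.integrable x)).abs ((hκ.integrable x).mul_const _) fun y => ?_)
      simp only [abs_mul, abs_of_pos (hκ.pos x y)]
      exact mul_le_mul_of_nonneg_left (hf.2 y) (hκ.pos x y).le
    have h2 : |(1 - ∫ y, κ x y ∂ν) * f x| ≤ (1 - ∫ y, κ x y ∂ν) * C := by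
      rw [abs_mul, abs_of_nonneg (hκ.holding_nonneg x)]
      exact mul_le_mul_of_nonneg_left (hf.2 x) (hκ.holding_nonneg x)
    refine (abs_add_le _ _).trans ?_
    linarith

lemma iterate_isBoundedMeasurable [SFinite ν] (hκ : IsJumpDensity ν κ)
    (hf : IsBoundedMeasurable f C) (n : ℕ) :
    IsBoundedMeasurable ((jumpOperator ν κ)^[n] f) C := by
  induction n with
  | zero => exact hf
  | succ n ih =>
    rw [Function.iterate_succ_apply']
    exact hκ.jumpOperator_isBoundedMeasurable ih

lemma jumpOperator_const (c : ℝ) : jumpOperator ν κ (fun _ => c) = fun _ => c := by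
  funext x
  simp only [jumpOperator, integral_mul_const]
  ring

lemma integral_jumpOperator_mul [IsProbabilityMeasure ν] (hκ : IsJumpDensity ν κ)
    (hf : IsBoundedMeasurable f C) (hg : IsBoundedMeasurable g C') :
    ∫ x, jumpOperator ν κ f x * g x ∂ν = ∫ x, f x * jumpOperator ν κ g x ∂ν := by
  have expand : ∀ {u v : E → ℝ} {a b : ℝ}, IsBoundedMeasurable u a → IsBoundedMeasurable v b →
      Integrable (fun z : E × E => κ z.1 z.2 * (u z.2 * v z.1)) (ν.prod ν) ∧
      ∫ x, jumpOperator ν κ u x * v x ∂ν =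
        (∫ x, ∫ y, κ x y * (u y * v x) ∂ν ∂ν)
          + ∫ x, (1 - ∫ y, κ x y ∂ν) * (u x * v x) ∂ν := by
    intro u v a b hu hv
    have hi : Integrable (fun z : E × E => κ z.1 z.2 * (u z.2 * v z.1)) (ν.prod ν) :=
      ((hu.comp measurable_snd).mul (hv.comp measurable_fst)).integrable_mul hκ.integrable_prod
    refine ⟨hi, ?_⟩
    rw [← integral_add hi.integral_prod_left
      (hκ.holding_isBoundedMeasurable.mul (hu.mul hv)).integrable]
    refine integral_congr_ae (.of_forall fun x => ?_)
    simp only [jumpOperator, ← mul_assoc, integral_mul_const]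
    ring
  obtain ⟨hi, e1⟩ := expand hf hg
  obtain ⟨-, e2⟩ := expand hg hf
  have e3 : ∀ x, f x * jumpOperator ν κ g x = jumpOperator ν κ g x * f x := fun x => mul_comm _ _
  simp only [e3]
  rw [e1, e2, integral_integral_swap hi]
  congr 1
  · refine integral_congr_ae (.of_forall fun x => integral_congr_ae (.of_forall fun y => ?_))
    simp only [hκ.symm x y]
    ring
  · refine integral_congr_ae (.of_forall fun x => ?_)
    simp only
    ring

lemma integral_iterate_mul [IsProbabilityMeasure ν] (hκ : IsJumpDensity ν κ)
    (hf : IsBoundedMeasurable f C) (hg : IsBoundedMeasurable g C') (n : ℕ) :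
    ∫ x, (jumpOperator ν κ)^[n] f x * g x ∂ν = ∫ x, f x * (jumpOperator ν κ)^[n] g x ∂ν := by
  induction n generalizing f with
  | zero => rfl
  | succ n ih =>
    rw [Function.iterate_succ_apply, Function.iterate_succ_apply',
      ih (hκ.jumpOperator_isBoundedMeasurable hf),
      hκ.integral_jumpOperator_mul hf (hκ.iterate_isBoundedMeasurable hg n)]

lemma integral_jumpOperator [IsProbabilityMeasure ν] (hκ : IsJumpDensity ν κ)
    (hf : IsBoundedMeasurable f C) : ∫ x, jumpOperator ν κ f x ∂ν = ∫ x, f x ∂ν := by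
  have := hκ.integral_jumpOperator_mul hf (IsBoundedMeasurable.const 1)
  simpa [jumpOperator_const] using this

lemma integral_iterate [IsProbabilityMeasure ν] (hκ : IsJumpDensity ν κ)
    (hf : IsBoundedMeasurable f C) (n : ℕ) :
    ∫ x, (jumpOperator ν κ)^[n] f x ∂ν = ∫ x, f x ∂ν := by
  induction n with
  | zero => rfl
  | succ n ih =>
    rw [Function.iterate_succ_apply',
      hκ.integral_jumpOperator (hκ.iterate_isBoundedMeasurable hf n), ih]

lemma integral_sq_sub_le (hκ : IsJumpDensity ν κ) (hf : IsBoundedMeasurable f C) (x : E) :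
    ∫ y, κ x y * (f y - jumpOperator ν κ f x) ^ 2 ∂ν
      ≤ jumpOperator ν κ (fun y => f y ^ 2) x - jumpOperator ν κ f x ^ 2 := by
  set b := jumpOperator ν κ f x with hb
  have e : (fun y => κ x y * (f y - b) ^ 2)
      = fun y => κ x y * f y ^ 2 - 2 * b * (κ x y * f y) + b ^ 2 * κ x y := by
    funext y; ring
  have i1 := hf.integrable_mul (hκ.integrable x)
  have i2 := hf.sq.integrable_mul (hκ.integrable x)
  have i3 : Integrable (fun y => κ x y * f y ^ 2 - 2 * b * (κ x y * f y)) ν :=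
    i2.sub (i1.const_mul _)
  rw [e, integral_add i3 ((hκ.integrable x).const_mul _),
    integral_sub i2 (i1.const_mul _), integral_const_mul, integral_const_mul]
  have h0 := mul_nonneg (hκ.holding_nonneg x) (sq_nonneg (f x - b))
  have hb' : ∫ y, κ x y * f y ∂ν = b - (1 - ∫ y, κ x y ∂ν) * f x := by
    rw [hb, jumpOperator]; ring
  rw [hb', jumpOperator]
  nlinarith

lemma integral_prod_sq_sub_le [IsProbabilityMeasure ν] (hκ : IsJumpDensity ν κ)
    (hf : IsBoundedMeasurable f C) :
    ∫ z, Function.uncurry κ z * (f z.2 - jumpOperator ν κ f z.1) ^ 2 ∂(ν.prod ν)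
      ≤ (∫ x, f x ^ 2 ∂ν) - ∫ x, jumpOperator ν κ f x ^ 2 ∂ν := by
  have hPf := hκ.jumpOperator_isBoundedMeasurable hf
  have hi : Integrable (fun z : E × E =>
      Function.uncurry κ z * (f z.2 - jumpOperator ν κ f z.1) ^ 2) (ν.prod ν) :=
    ((hf.comp measurable_snd).sub (hPf.comp measurable_fst)).sq.integrable_mul hκ.integrable_prod
  have hP2 := hκ.jumpOperator_isBoundedMeasurable hf.sq
  rw [integral_prod _ hi, ← hκ.integral_jumpOperator hf.sq,
    ← integral_sub hP2.integrable hPf.sq.integrable]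
  exact integral_mono hi.integral_prod_left (hP2.integrable.sub hPf.sq.integrable)
    fun x => hκ.integral_sq_sub_le hf x

/-- Convergence of the iterates to the mean in `L²`, for bounded functions. -/
lemma tendsto_integral_sq_iterate_sub [IsProbabilityMeasure ν] (hκ : IsJumpDensity ν κ)
    (hf : IsBoundedMeasurable f C) :
    Tendsto (fun n => ∫ x, ((jumpOperator ν κ)^[n] f x - ∫ y, f y ∂ν) ^ 2 ∂ν) atTop
      (nhds 0) := by
  set F : ℕ → E → ℝ := fun n => (jumpOperator ν κ)^[n] f with hF
  have hFs : ∀ n, F (n + 1) = jumpOperator ν κ (F n) := fun n =>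
    Function.iterate_succ_apply' _ _ _
  have hFb : ∀ n, IsBoundedMeasurable (F n) C := hκ.iterate_isBoundedMeasurable hf
  set W : E × E → ℝ := Function.uncurry κ
  set G : ℕ → E × E → ℝ := fun n z => (F n z.2 - F (n + 1) z.1) ^ 2 with hG
  have hGb : ∀ n, IsBoundedMeasurable (G n) ((C + C) * (C + C)) := fun n =>
    (((hFb n).comp measurable_snd).sub ((hFb (n + 1)).comp measurable_fst)).sq
  set a : ℕ → ℝ := fun n => ∫ x, F n x ^ 2 ∂ν
  have hWG0 : ∀ n, 0 ≤ ∫ z, W z * G n z ∂(ν.prod ν) := fun n =>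
    integral_nonneg fun z => mul_nonneg (hκ.pos _ _).le (sq_nonneg _)
  have hWG : ∀ n, ∫ z, W z * G n z ∂(ν.prod ν) ≤ a n - a (n + 1) := fun n => by
    simpa only [hG, a, hFs] using hκ.integral_prod_sq_sub_le (hFb n)
  have ha : Antitone a := antitone_nat_of_succ_le fun n => by linarith [hWG0 n, hWG n]
  have hbdd : BddBelow (Set.range a) := ⟨0, by
    rintro _ ⟨n, rfl⟩
    exact integral_nonneg fun x => sq_nonneg _⟩
  have hal := tendsto_atTop_ciInf ha hbdd
  have hdiff : Tendsto (fun n => a n - a (n + 1)) atTop (nhds 0) := by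
    simpa using hal.sub ((tendsto_add_atTop_iff_nat 1).2 hal)
  have hGlim := tendsto_integral_of_tendsto_integral_weight hκ.measurable hκ.integrable_prod
    (fun z => hκ.pos z.1 z.2) hGb (fun n z => sq_nonneg _) (squeeze_zero hWG0 hWG hdiff)
  refine squeeze_zero (fun n => integral_nonneg fun x => sq_nonneg _) (fun n => ?_) hGlim
  rw [integral_prod _ (hGb n).integrable]
  have hc : ∫ x, (F n x - ∫ y, f y ∂ν) ^ 2 ∂ν
      = ∫ _ : E, (∫ x, (F n x - ∫ y, f y ∂ν) ^ 2 ∂ν) ∂ν := by simp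
  rw [hc]
  refine integral_mono (integrable_const _) (hGb n).integrable.integral_prod_left fun x => ?_
  have h1 := integral_sub_const_sq (ν := ν) (hFb n).integrable (hFb n).sq.integrable
  have h2 : ∫ y, F n y ∂ν = ∫ y, f y ∂ν := hκ.integral_iterate hf n
  change ∫ x, (F n x - ∫ y, f y ∂ν) ^ 2 ∂ν ≤ ∫ y, (F n y - F (n + 1) x) ^ 2 ∂ν
  rw [h1, h1, h2]
  nlinarith [sq_nonneg ((∫ y, f y ∂ν) - F (n + 1) x)]

/-- Convergence of the iterated indicators, tested against a bounded function, uniformly over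
the sets. -/
lemma eventually_abs_integral_bounded_mul_le [IsProbabilityMeasure ν] (hκ : IsJumpDensity ν κ)
    (hf : IsBoundedMeasurable f C) {ε : ℝ} (hε : 0 < ε) :
    ∀ᶠ n in atTop, ∀ A : Set E, MeasurableSet A →
      |∫ y, f y * ((jumpOperator ν κ)^[n] (A.indicator fun _ => 1) y - ν.real A) ∂ν| ≤ ε := by
  filter_upwards [(hκ.tendsto_integral_sq_iterate_sub hf).eventually_lt_const (pow_pos hε 2)]
    with n hn A hA
  have hA1 := IsBoundedMeasurable.indicator_one hA
  have hPn := hκ.iterate_isBoundedMeasurable hA1 n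
  set m := ∫ y, f y ∂ν with hm
  have hu := (hκ.iterate_isBoundedMeasurable hf n).sub (IsBoundedMeasurable.const m)
  have hw := hu.mul hA1
  set w : E → ℝ := fun y =>
    ((jumpOperator ν κ)^[n] f y - m) * A.indicator (fun _ => (1 : ℝ)) y with hwdef
  have e : ∫ y, f y * ((jumpOperator ν κ)^[n] (A.indicator fun _ => 1) y - ν.real A) ∂ν
      = ∫ y, w y ∂ν := by
    simp only [hwdef, mul_sub, sub_mul]
    rw [integral_sub (hf.mul hPn).integrable (hf.integrable.mul_const _),
      integral_sub ((hκ.iterate_isBoundedMeasurable hf n).mul hA1).integrable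
        (hA1.integrable.const_mul _),
      hκ.integral_iterate_mul hf hA1, integral_mul_const, integral_const_mul,
      integral_indicator_const _ hA]
    simp [hm]
  rw [e]
  refine abs_le_of_sq_le_sq ?_ hε.le
  have h1 : (∫ y, w y ∂ν) ^ 2 ≤ ∫ y, w y ^ 2 ∂ν := by
    have h := integral_sub_const_sq (ν := ν) hw.integrable hw.sq.integrable (∫ y, w y ∂ν)
    have h0 : 0 ≤ ∫ x, (w x - ∫ y, w y ∂ν) ^ 2 ∂ν := integral_nonneg fun x => sq_nonneg _
    nlinarith
  have h2 : ∫ y, w y ^ 2 ∂ν ≤ ∫ y, ((jumpOperator ν κ)^[n] f y - m) ^ 2 ∂ν := by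
    refine integral_mono hw.sq.integrable hu.sq.integrable fun y => ?_
    by_cases hy : y ∈ A <;> simp [hwdef, hy, sq_nonneg]
  linarith

lemma abs_iterate_indicator_sub_le_two [IsProbabilityMeasure ν] (hκ : IsJumpDensity ν κ)
    {A : Set E} (hA : MeasurableSet A) (n : ℕ) (x : E) :
    |(jumpOperator ν κ)^[n] (A.indicator fun _ => 1) x - ν.real A| ≤ 2 := by
  have h1 := (hκ.iterate_isBoundedMeasurable (IsBoundedMeasurable.indicator_one hA) n).2 x
  have h2 : |ν.real A| ≤ 1 := by
    rw [abs_of_nonneg measureReal_nonneg]; exact measureReal_le_one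
  linarith [abs_sub ((jumpOperator ν κ)^[n] (A.indicator fun _ => 1) x) (ν.real A)]

/-- Convergence of the iterated indicators, tested against a nonnegative integrable function,
uniformly over the sets. -/
lemma eventually_abs_integral_mul_le [IsProbabilityMeasure ν] (hκ : IsJumpDensity ν κ)
    (hfm : Measurable f) (hf0 : ∀ y, 0 ≤ f y) (hf : Integrable f ν) {ε : ℝ} (hε : 0 < ε) :
    ∀ᶠ n in atTop, ∀ A : Set E, MeasurableSet A →
      |∫ y, f y * ((jumpOperator ν κ)^[n] (A.indicator fun _ => 1) y - ν.real A) ∂ν| ≤ ε := by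
  have htm : ∀ k : ℕ, IsBoundedMeasurable (fun y => min (f y) k) k := fun k =>
    ⟨hfm.min measurable_const, fun y => by
      rw [abs_of_nonneg (le_min (hf0 y) k.cast_nonneg)]; exact min_le_right _ _⟩
  have htrunc : Tendsto (fun k : ℕ => ∫ y, (f y - min (f y) k) ∂ν) atTop (nhds 0) := by
    have := tendsto_integral_of_dominated_convergence (μ := ν) (f := fun _ => (0 : ℝ))
      (F := fun (k : ℕ) y => f y - min (f y) k) f
      (fun k => (hfm.sub (htm k).1).aestronglyMeasurable) hf
      (fun k => .of_forall fun y => by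
        rw [Real.norm_eq_abs, abs_of_nonneg (sub_nonneg.2 (min_le_left _ _))]
        linarith [le_min (hf0 y) (k.cast_nonneg (α := ℝ))])
      (.of_forall fun y => by
        obtain ⟨N, hN⟩ := exists_nat_gt (f y)
        refine tendsto_const_nhds.congr' ?_
        filter_upwards [eventually_ge_atTop N] with k hk
        have hk' : (N : ℝ) ≤ k := by exact_mod_cast hk
        rw [min_eq_left (hN.le.trans hk'), sub_self])
    simpa using this
  obtain ⟨k, hk⟩ := (htrunc.eventually_lt_const (show 0 < ε / 4 by positivity)).exists
  filter_upwards [hκ.eventually_abs_integral_bounded_mul_le (htm k) (half_pos hε)] with n hn A hA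
  have hg : IsBoundedMeasurable
      (fun y => (jumpOperator ν κ)^[n] (A.indicator fun _ => 1) y - ν.real A) 2 :=
    ⟨((hκ.iterate_isBoundedMeasurable (IsBoundedMeasurable.indicator_one hA) n).sub
      (IsBoundedMeasurable.const (ν.real A))).1, hκ.abs_iterate_indicator_sub_le_two hA n⟩
  set g : E → ℝ := fun y => (jumpOperator ν κ)^[n] (A.indicator fun _ => 1) y - ν.real A
  have hr : Integrable (fun y => f y - min (f y) k) ν := hf.sub (htm k).integrable
  have hsplit : ∫ y, f y * g y ∂ν
      = (∫ y, (f y - min (f y) k) * g y ∂ν) + ∫ y, min (f y) k * g y ∂ν := by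
    rw [← integral_add (hg.integrable_mul hr) ((htm k).mul hg).integrable]
    refine integral_congr_ae (.of_forall fun y => ?_)
    simp only
    ring
  have hrest : |∫ y, (f y - min (f y) k) * g y ∂ν| ≤ (∫ y, (f y - min (f y) k) ∂ν) * 2 := by
    rw [← integral_mul_const]
    refine (abs_integral_le_integral_abs).trans
      (integral_mono (hg.integrable_mul hr).abs (hr.mul_const _) fun y => ?_)
    have h0 : 0 ≤ f y - min (f y) k := sub_nonneg.2 (min_le_left _ _)
    simp only [abs_mul, abs_of_nonneg h0]
    exact mul_le_mul_of_nonneg_left (hg.2 y) h0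
  rw [hsplit]
  linarith [abs_add_le (∫ y, (f y - min (f y) k) * g y ∂ν) (∫ y, min (f y) k * g y ∂ν), hn A hA]

/-- Pointwise convergence of the iterated indicators, uniformly over the sets. -/
lemma eventually_abs_iterate_sub_le [IsProbabilityMeasure ν] (hκ : IsJumpDensity ν κ) (x : E)
    {ε : ℝ} (hε : 0 < ε) :
    ∀ᶠ n in atTop, ∀ A : Set E, MeasurableSet A →
      |(jumpOperator ν κ)^[n] (A.indicator fun _ => 1) x - ν.real A| ≤ ε := by
  have hmass : 0 < ∫ y, κ x y ∂ν := by
    rw [integral_pos_iff_support_of_nonneg (fun y => (hκ.pos x y).le) (hκ.integrable x)]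
    have : Function.support (κ x) = Set.univ :=
      Set.eq_univ_of_forall fun y => (hκ.pos x y).ne'
    simp [this]
  have hr0 := hκ.holding_nonneg x
  set c := ∫ y, κ x y ∂ν with hc
  obtain ⟨N, hN⟩ := eventually_atTop.1 (hκ.eventually_abs_integral_mul_le
    (hκ.measurable.comp measurable_prodMk_left) (fun y => (hκ.pos x y).le) (hκ.integrable x)
    (show 0 < ε / 2 * c by positivity))
  have step : ∀ k : ℕ, ∀ A : Set E, MeasurableSet A →
      |(jumpOperator ν κ)^[N + k] (A.indicator fun _ => 1) x - ν.real A|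
        ≤ ε / 2 + 2 * (1 - c) ^ k := by
    intro k A hA
    induction k with
    | zero =>
      have := hκ.abs_iterate_indicator_sub_le_two hA N x
      simp only [add_zero, pow_zero]
      linarith
    | succ k ih =>
      have hb := hκ.iterate_isBoundedMeasurable (IsBoundedMeasurable.indicator_one hA) (N + k)
      have h1 := hN (N + k) (Nat.le_add_right _ _) A hA
      rw [← add_assoc, Function.iterate_succ_apply']
      set u := (jumpOperator ν κ)^[N + k] (A.indicator fun _ => 1)
      have e : jumpOperator ν κ u x - ν.real A
          = (∫ y, κ x y * (u y - ν.real A) ∂ν) + (1 - c) * (u x - ν.real A) := by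
        simp only [mul_sub, jumpOperator]
        rw [integral_sub (hb.integrable_mul (hκ.integrable x))
          ((hκ.integrable x).mul_const _), integral_mul_const]
        ring
      have h2 : |(1 - c) * (u x - ν.real A)| ≤ (1 - c) * (ε / 2 + 2 * (1 - c) ^ k) := by
        rw [abs_mul, abs_of_nonneg hr0]
        exact mul_le_mul_of_nonneg_left ih hr0
      rw [e]
      refine (abs_add_le _ _).trans ((add_le_add h1 h2).trans (le_of_eq ?_))
      ring
  have hpow : Tendsto (fun k : ℕ => 2 * (1 - c) ^ k) atTop (nhds 0) := by
    simpa using (tendsto_pow_atTop_nhds_zero_of_lt_one hr0 (by linarith)).const_mul 2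
  obtain ⟨K, hK⟩ := eventually_atTop.1 (hpow.eventually_lt_const (half_pos hε))
  filter_upwards [eventually_ge_atTop (N + K)] with n hn A hA
  obtain ⟨k, rfl⟩ := Nat.exists_eq_add_of_le ((Nat.le_add_right N K).trans hn)
  linarith [step k A hA, hK k (by omega)]

end IsJumpDensity

section MetropolisHastings

variable {d : ℕ} {D ρeq : EuclideanSpace ℝ (Fin d) → ℝ} {h : ℝ}

lemma qh_pos (hh : 0 < h) (hD : ∀ x, 0 < D x) (x y : EuclideanSpace ℝ (Fin d)) :
    0 < qh D h x y := by
  have := hD x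
  unfold qh
  positivity

lemma integral_qh (hh : 0 < h) (hD : ∀ x, 0 < D x) (x : EuclideanSpace ℝ (Fin d)) :
    ∫ y, qh D h x y = 1 := by
  have hDx := hD x
  have e : ∀ y, qh D h x y = (4 * π * h * D x) ^ (-(d : ℝ) / 2) *
      Real.exp (-(1 / (4 * h * D x)) * ‖y - x‖ ^ 2) := fun y => by
    unfold qh
    congr 2
    ring
  simp only [e]
  rw [integral_const_mul,
    integral_sub_right_eq_self (fun y => Real.exp (-(1 / (4 * h * D x)) * ‖y‖ ^ 2)) x,
    GaussianFourier.integral_rexp_neg_mul_sq_norm (by positivity)]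
  have e2 : π / (1 / (4 * h * D x)) = 4 * π * h * D x := by field_simp
  rw [e2, finrank_euclideanSpace_fin, ← Real.rpow_add (by positivity), neg_div,
    neg_add_cancel, Real.rpow_zero]

lemma measurable_qh (hDmeas : Measurable D) : Measurable (Function.uncurry (qh D h)) := by
  unfold qh Function.uncurry
  fun_prop

lemma alphah_mul_qh (hh : 0 < h) (hD : ∀ x, 0 < D x) (x y : EuclideanSpace ℝ (Fin d)) :
    alphah D ρeq h x y * qh D h x y = min (qh D h x y) (qh D h y x * ρeq y / ρeq x) := by
  have hq := qh_pos hh hD x y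
  rw [alphah, min_mul_of_nonneg _ _ hq.le, one_mul]
  congr 1
  field_simp

/-- The jump density of the Metropolis–Hastings chain with respect to the equilibrium
measure. -/
noncomputable def metropolisDensity (D ρeq : EuclideanSpace ℝ (Fin d) → ℝ) (h : ℝ)
    (x y : EuclideanSpace ℝ (Fin d)) : ℝ :=
  min (qh D h x y / ρeq y) (qh D h y x / ρeq x)

lemma mul_metropolisDensity (hh : 0 < h) (hD : ∀ x, 0 < D x) (hρ : ∀ x, 0 < ρeq x)
    (x y : EuclideanSpace ℝ (Fin d)) :
    ρeq y * metropolisDensity D ρeq h x y = alphah D ρeq h x y * qh D h x y := by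
  have hx := (hρ x).ne'
  have hy := (hρ y).ne'
  rw [alphah_mul_qh hh hD, metropolisDensity, mul_min_of_nonneg _ _ (hρ y).le]
  congr 1 <;> field_simp

/-- The equilibrium measure. -/
noncomputable def equilibriumMeasure (ρeq : EuclideanSpace ℝ (Fin d) → ℝ) :
    Measure (EuclideanSpace ℝ (Fin d)) :=
  volume.withDensity fun x => ((ρeq x).toNNReal : ENNReal)

lemma integral_equilibriumMeasure (hm : Measurable ρeq) (hρ : ∀ x, 0 < ρeq x)
    (g : EuclideanSpace ℝ (Fin d) → ℝ) :
    ∫ x, g x ∂(equilibriumMeasure ρeq) = ∫ x, ρeq x * g x := by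
  rw [equilibriumMeasure, integral_withDensity_eq_integral_smul hm.real_toNNReal]
  simp [NNReal.smul_def, (hρ _).le]

lemma integrable_equilibriumMeasure_iff (hm : Measurable ρeq) (hρ : ∀ x, 0 < ρeq x)
    (g : EuclideanSpace ℝ (Fin d) → ℝ) :
    Integrable g (equilibriumMeasure ρeq) ↔ Integrable fun x => ρeq x * g x := by
  rw [equilibriumMeasure, integrable_withDensity_iff_integrable_smul hm.real_toNNReal]
  simp [NNReal.smul_def, (hρ _).le]

lemma equilibriumMeasure_apply {A : Set (EuclideanSpace ℝ (Fin d))} (hA : MeasurableSet A)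
    (hρ : ∀ x, 0 < ρeq x) (hi : Integrable ρeq) :
    equilibriumMeasure ρeq A = ENNReal.ofReal (∫ y in A, ρeq y) := by
  rw [equilibriumMeasure, withDensity_apply _ hA,
    ofReal_integral_eq_lintegral_ofReal hi.integrableOn (.of_forall fun x => (hρ x).le)]
  rfl

lemma isJumpDensity_metropolisDensity (hh : 0 < h) (hDmeas : Measurable D) (hD : ∀ x, 0 < D x)
    (hm : Measurable ρeq) (hρ : ∀ x, 0 < ρeq x) :
    IsJumpDensity (equilibriumMeasure ρeq) (metropolisDensity D ρeq h) := by
  have hmeas : Measurable (Function.uncurry (metropolisDensity D ρeq h)) := by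
    have hq := measurable_qh (h := h) hDmeas
    exact (hq.div (hm.comp measurable_snd)).min
      ((hq.comp measurable_swap).div (hm.comp measurable_fst))
  have hpos : ∀ x y, 0 < metropolisDensity D ρeq h x y := fun x y =>
    lt_min (div_pos (qh_pos hh hD x y) (hρ y)) (div_pos (qh_pos hh hD y x) (hρ x))
  have hqi : ∀ x, Integrable (qh D h x) := fun x =>
    Integrable.of_integral_ne_zero (by rw [integral_qh hh hD]; exact one_ne_zero)
  have hle : ∀ x y, ρeq y * metropolisDensity D ρeq h x y ≤ qh D h x y := fun x y => by
    rw [mul_metropolisDensity hh hD hρ, alphah_mul_qh hh hD]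
    exact min_le_left _ _
  have hi : ∀ x, Integrable fun y => ρeq y * metropolisDensity D ρeq h x y := fun x =>
    (hqi x).mono' (hm.mul (hmeas.comp measurable_prodMk_left)).aestronglyMeasurable
      (.of_forall fun y => by
        rw [Real.norm_eq_abs, abs_of_pos (mul_pos (hρ y) (hpos x y))]
        exact hle x y)
  refine ⟨hmeas, hpos, fun x y => min_comm _ _,
    fun x => (integrable_equilibriumMeasure_iff hm hρ _).2 (hi x), fun x => ?_⟩
  rw [integral_equilibriumMeasure hm hρ, ← integral_qh hh hD x]
  exact integral_mono (hi x) (hqi x) (hle x)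

lemma MHiter_eq_iterate (hh : 0 < h) (hD : ∀ x, 0 < D x) (hm : Measurable ρeq)
    (hρ : ∀ x, 0 < ρeq x) (n : ℕ) (A : Set (EuclideanSpace ℝ (Fin d))) :
    (fun x => MHiter D ρeq h n x A) =
      (jumpOperator (equilibriumMeasure ρeq) (metropolisDensity D ρeq h))^[n]
        (A.indicator fun _ => 1) := by
  induction n with
  | zero => rfl
  | succ n ih =>
    rw [Function.iterate_succ_apply', ← ih]
    funext x
    simp only [jumpOperator, integral_equilibriumMeasure hm hρ, ← mul_assoc,
      mul_metropolisDensity hh hD hρ]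
    simp only [MHiter, mul_comm]

end MetropolisHastings

/-- ergodicity of the Metropolized chain: for every starting point
`x`, the total variation distance
`sup { |P^n(x,A) − ν(A)| : A measurable }` tends to `0` as `n → ∞`, where `ν`
is the probability measure with density `ρ_eq`. -/
theorem metropolis_chain_ergodic {d : ℕ} (hd : 1 ≤ d) (h : ℝ) (hh : 0 < h)
    (D ρeq : EuclideanSpace ℝ (Fin d) → ℝ)
    (hDmeas : Measurable D)
    (hDinf : ∃ c : ℝ, 0 < c ∧ ∀ x, c ≤ D x)
    (hρeqmeas : Measurable ρeq) (hρeqpos : ∀ x, 0 < ρeq x)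
    (hρeqdens : ∫ x, ρeq x = 1) :
    ∀ x, Tendsto (fun n =>
        ⨆ A : {A : Set (EuclideanSpace ℝ (Fin d)) // MeasurableSet A},
          |MHiter D ρeq h n x A.1 - ∫ y in A.1, ρeq y|)
      atTop (nhds 0) := by
  obtain ⟨c, hc, hcD⟩ := hDinf
  have hD : ∀ x, 0 < D x := fun x => hc.trans_le (hcD x)
  have hi : Integrable ρeq :=
    Integrable.of_integral_ne_zero (by rw [hρeqdens]; exact one_ne_zero)
  have hreal : ∀ A, MeasurableSet A → (equilibriumMeasure ρeq).real A = ∫ y in A, ρeq y :=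
    fun A hA => by
      rw [Measure.real, equilibriumMeasure_apply hA hρeqpos hi,
        ENNReal.toReal_ofReal (integral_nonneg fun y => (hρeqpos y).le)]
  have : IsProbabilityMeasure (equilibriumMeasure ρeq) := ⟨by
    rw [equilibriumMeasure_apply .univ hρeqpos hi, Measure.restrict_univ, hρeqdens,
      ENNReal.ofReal_one]⟩
  have hκ := isJumpDensity_metropolisDensity hh hDmeas hD hρeqmeas hρeqpos
  intro x
  rw [Metric.tendsto_nhds]
  intro ε hε
  filter_upwards [hκ.eventually_abs_iterate_sub_le x (half_pos hε)] with n hn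
  rw [Real.dist_eq, sub_zero, abs_of_nonneg (Real.iSup_nonneg fun A => abs_nonneg _)]
  refine (Real.iSup_le (fun A => ?_) (half_pos hε).le).trans_lt (half_lt_self hε)
  have := hn A.1 A.2
  rwa [← MHiter_eq_iterate hh hD hρeqmeas hρeqpos, hreal A.1 A.2] at this
end

section
/- Let d ≥ 1 and suppose D : ℝ^d → ℝ and ln ρ_eq : ℝ^d → ℝ have bounded derivatives up to order 4, ρ_eq > 0, and inf_x D(x) > 0. Set a(x) = ∇D(x) + D(x)∇ln ρ_eq(x). Then there exists a function K : ℝ^d → ℝ of polynomial growth such that for all x ∈ ℝ^d and all h ∈ (0,1], | ∫_{ℝ^d} (y − x) α_h(x,y) q_h(x,y) dy − a(x) h | ≤ K(x) h^{3/2}, where the left-hand side is the Euclidean norm of a vector in ℝ^d. -/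
open Real MeasureTheory

lemma norm_pow_le_one_add_norm_pow {E : Type*} [SeminormedAddCommGroup E] (w : E) {j k : ℕ}
    (hjk : j ≤ k) :
    ‖w‖ ^ j ≤ (1 + ‖w‖) ^ k :=
  (pow_le_pow_left₀ (norm_nonneg w) (by linarith) j).trans
    (pow_le_pow_right₀ (by linarith [norm_nonneg w]) hjk)

section Gaussian

variable {E : Type*} [NormedAddCommGroup E] [InnerProductSpace ℝ E] [FiniteDimensional ℝ E]
  [MeasurableSpace E] [BorelSpace E]

/-- A continuous function of polynomial growth is integrable against the Gaussian weight. -/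
lemma integrable_exp_neg_sq_norm_smul {F : Type*} [NormedAddCommGroup F] [NormedSpace ℝ F]
    {f : E → F} (hf : Continuous f) {C : ℝ} {k : ℕ}
    (hbd : ∀ w, ‖f w‖ ≤ C * (1 + ‖w‖) ^ k) :
    Integrable (fun w : E => rexp (-‖w‖ ^ 2) • f w) := by
  have hg : Integrable (fun w : E => rexp (-(1 / 2 : ℝ) * ‖w‖ ^ 2)) := by
    by_contra hcon
    have h1 := GaussianFourier.integral_rexp_neg_mul_sq_norm (V := E) (b := 1 / 2) (by norm_num)
    rw [integral_undef hcon] at h1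
    have : 0 < (π / (1 / 2)) ^ (Module.finrank ℝ E / 2 : ℝ) := by positivity
    exact this.ne h1
  have hC : 0 ≤ C := by simpa using (norm_nonneg _).trans (hbd 0)
  refine (hg.const_mul (C * (k.factorial * rexp 2))).mono' ?_ (.of_forall fun w => ?_)
  · exact Continuous.aestronglyMeasurable (by fun_prop)
  have hw := norm_nonneg w
  have hpow : (1 + ‖w‖) ^ k ≤ k.factorial * rexp (1 + ‖w‖) := by
    have := Real.pow_div_factorial_le_exp (1 + ‖w‖) (by positivity) k
    rwa [div_le_iff₀' (by positivity)] at this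
  have hexp : rexp (1 + ‖w‖) * rexp (-‖w‖ ^ 2) ≤ rexp 2 * rexp (-(1 / 2 : ℝ) * ‖w‖ ^ 2) := by
    rw [← Real.exp_add, ← Real.exp_add, Real.exp_le_exp]
    nlinarith [sq_nonneg (‖w‖ - 1)]
  rw [norm_smul, Real.norm_of_nonneg (Real.exp_pos _).le]
  calc rexp (-‖w‖ ^ 2) * ‖f w‖ ≤ rexp (-‖w‖ ^ 2) * (C * (k.factorial * rexp (1 + ‖w‖))) := by
        gcongr
        exact (hbd w).trans (by gcongr)
    _ = C * k.factorial * (rexp (1 + ‖w‖) * rexp (-‖w‖ ^ 2)) := by ring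
    _ ≤ C * k.factorial * (rexp 2 * rexp (-(1 / 2 : ℝ) * ‖w‖ ^ 2)) := by gcongr
    _ = _ := by ring

/-- Gaussian integration by parts in the direction `v`. -/
lemma integral_exp_neg_sq_norm_mul_inner {f : E → ℝ} (hf : Differentiable ℝ f) (v : E)
    (hf' : Continuous fun w => fderiv ℝ f w v) {C : ℝ} {k : ℕ}
    (hbd : ∀ w, ‖f w‖ ≤ C * (1 + ‖w‖) ^ k)
    (hbd' : ∀ w, ‖fderiv ℝ f w v‖ ≤ C * (1 + ‖w‖) ^ k) :
    ∫ w : E, rexp (-‖w‖ ^ 2) * (f w * inner ℝ w v)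
      = (1 / 2) * ∫ w : E, rexp (-‖w‖ ^ 2) * fderiv ℝ f w v := by
  have hfc := hf.continuous
  have hC : 0 ≤ C := by simpa using (norm_nonneg _).trans (hbd 0)
  have hder : ∀ w : E, HasFDerivAt (fun w : E => rexp (-‖w‖ ^ 2))
      (rexp (-‖w‖ ^ 2) • (-(2 • innerSL ℝ w) : E →L[ℝ] ℝ)) w := fun w =>
    ((hasStrictFDerivAt_norm_sq w).hasFDerivAt.neg).exp
  have hder' : ∀ w : E, fderiv ℝ (fun w : E => rexp (-‖w‖ ^ 2)) w v
      = rexp (-‖w‖ ^ 2) * (-2 * inner ℝ w v) := fun w => by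
    rw [(hder w).fderiv]; simp
  have h1 := integrable_exp_neg_sq_norm_smul hf' hbd'
  have h2 := integrable_exp_neg_sq_norm_smul hfc hbd
  have h3 : Integrable (fun w : E => rexp (-‖w‖ ^ 2) • (f w * inner ℝ w v)) := by
    refine integrable_exp_neg_sq_norm_smul (by fun_prop) (C := C * ‖v‖) (k := k + 1) fun w => ?_
    rw [norm_mul]
    calc ‖f w‖ * ‖inner ℝ w v‖ ≤ (C * (1 + ‖w‖) ^ k) * ((1 + ‖w‖) * ‖v‖) := by
          gcongr
          · exact hbd w
          · exact (norm_inner_le_norm w v).trans (by gcongr; linarith)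
      _ = _ := by ring
  simp only [smul_eq_mul] at h1 h2 h3
  have key := integral_mul_fderiv_eq_neg_fderiv_mul_of_integrable (μ := volume) (f := f)
    (g := fun w : E => rexp (-‖w‖ ^ 2)) (v := v)
    (by simpa only [mul_comm] using h1)
    (by
      simp only [hder']
      refine (h3.const_mul (-2)).congr (.of_forall fun w => ?_)
      ring)
    (by simpa only [mul_comm] using h2)
    (fun w _ => hf w) (fun w _ => (hder w).differentiableAt)
  simp only [hder'] at key
  have e1 : ∫ w : E, f w * (rexp (-‖w‖ ^ 2) * (-2 * inner ℝ w v))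
      = -2 * ∫ w : E, rexp (-‖w‖ ^ 2) * (f w * inner ℝ w v) := by
    rw [← integral_const_mul]; congr 1; ext w; ring
  have e2 : ∫ w : E, fderiv ℝ f w v * rexp (-‖w‖ ^ 2)
      = ∫ w : E, rexp (-‖w‖ ^ 2) * fderiv ℝ f w v := by
    congr 1; ext w; ring
  rw [e1, e2] at key
  linarith

lemma integral_exp_neg_sq_norm :
    ∫ w : E, rexp (-‖w‖ ^ 2) = π ^ (Module.finrank ℝ E / 2 : ℝ) := by
  simpa using GaussianFourier.integral_rexp_neg_mul_sq_norm (V := E) (b := 1) one_pos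

/-- Second moments of the Gaussian weight. -/
lemma integral_exp_neg_sq_norm_mul_inner_mul_inner (u v : E) :
    ∫ w : E, rexp (-‖w‖ ^ 2) * (inner ℝ u w * inner ℝ w v)
      = inner ℝ u v / 2 * ∫ w : E, rexp (-‖w‖ ^ 2) := by
  have hd : ∀ w : E, HasFDerivAt (fun w : E => inner ℝ u w) (innerSL ℝ u) w :=
    fun w => (innerSL ℝ u).hasFDerivAt
  have hd' : ∀ w : E, fderiv ℝ (fun w : E => inner ℝ u w) w v = inner ℝ u v := fun w => by
    rw [(hd w).fderiv]; simp
  rw [integral_exp_neg_sq_norm_mul_inner (f := fun w : E => inner ℝ u w)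
    (fun w => (hd w).differentiableAt) v (by simp only [hd']; fun_prop)
    (C := ‖u‖ * (1 + ‖v‖)) (k := 1)]
  · simp only [hd']
    rw [integral_mul_const]; ring
  · intro w
    refine (norm_inner_le_norm u w).trans ?_
    have := norm_nonneg u; have := norm_nonneg v; have := norm_nonneg w
    rw [pow_one, mul_assoc]; gcongr; nlinarith
  · intro w
    rw [hd']
    refine (norm_inner_le_norm u v).trans ?_
    have := norm_nonneg u; have := norm_nonneg v; have := norm_nonneg w
    rw [pow_one, mul_assoc]; gcongr; nlinarith

lemma integral_exp_neg_sq_norm_mul_sq_norm :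
    ∫ w : E, rexp (-‖w‖ ^ 2) * ‖w‖ ^ 2
      = (Module.finrank ℝ E : ℝ) / 2 * ∫ w : E, rexp (-‖w‖ ^ 2) := by
  let b := stdOrthonormalBasis ℝ E
  have hsum : ∀ w : E, rexp (-‖w‖ ^ 2) * ‖w‖ ^ 2
      = ∑ i, rexp (-‖w‖ ^ 2) * (inner ℝ (b i) w * inner ℝ w (b i)) := fun w => by
    rw [← Finset.mul_sum, ← b.sum_sq_norm_inner_left w]
    simp only [real_inner_comm, Real.norm_eq_abs, abs_mul_abs_self, sq]
  simp only [hsum]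
  rw [integral_finsetSum]
  · simp only [integral_exp_neg_sq_norm_mul_inner_mul_inner, inner_self_eq_norm_sq_to_K,
      b.norm_eq_one]
    simp
    ring
  · intro i _
    refine integrable_exp_neg_sq_norm_smul (f := fun w : E => inner ℝ (b i) w * inner ℝ w (b i))
      (by fun_prop) (C := 1) (k := 2) fun w => ?_
    have h1 := norm_inner_le_norm (𝕜 := ℝ) (b i) w
    have h2 := norm_inner_le_norm (𝕜 := ℝ) w (b i)
    rw [b.norm_eq_one] at h1 h2
    rw [norm_mul, one_mul, sq]
    have := norm_nonneg w
    gcongr <;> linarith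

/-- Fourth moments of the Gaussian weight. -/
lemma integral_exp_neg_sq_norm_mul_sq_norm_mul_inner_mul_inner (u v : E) :
    ∫ w : E, rexp (-‖w‖ ^ 2) * ((‖w‖ ^ 2 * inner ℝ u w) * inner ℝ w v)
      = ((Module.finrank ℝ E : ℝ) + 2) / 4 * inner ℝ u v * ∫ w : E, rexp (-‖w‖ ^ 2) := by
  have hd : ∀ w : E, HasFDerivAt (fun w : E => ‖w‖ ^ 2 * inner ℝ u w)
      (‖w‖ ^ 2 • innerSL ℝ u + inner ℝ u w • (2 • innerSL ℝ w)) w := fun w =>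
    (hasStrictFDerivAt_norm_sq w).hasFDerivAt.mul (innerSL ℝ u).hasFDerivAt
  have hd' : ∀ w : E, fderiv ℝ (fun w : E => ‖w‖ ^ 2 * inner ℝ u w) w v
      = ‖w‖ ^ 2 * inner ℝ u v + 2 * (inner ℝ u w * inner ℝ w v) := fun w => by
    rw [(hd w).fderiv]; simp; ring
  have hu := norm_nonneg u
  have hv := norm_nonneg v
  rw [integral_exp_neg_sq_norm_mul_inner (f := fun w : E => ‖w‖ ^ 2 * inner ℝ u w)
    (fun w => (hd w).differentiableAt) v (by simp only [hd']; fun_prop)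
    (C := 3 * ‖u‖ * (1 + ‖v‖)) (k := 3)]
  · simp only [hd', mul_add]
    rw [integral_add]
    · simp only [← mul_assoc]
      simp only [mul_comm _ (2 : ℝ), mul_assoc]
      rw [integral_const_mul, integral_exp_neg_sq_norm_mul_inner_mul_inner]
      simp only [← mul_assoc]
      rw [integral_mul_const, integral_exp_neg_sq_norm_mul_sq_norm]
      ring
    · simp only [← mul_assoc]
      refine Integrable.mul_const ?_ _
      refine integrable_exp_neg_sq_norm_smul (f := fun w : E => ‖w‖ ^ 2)
        (by fun_prop) (C := 1) (k := 2) fun w => ?_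
      simpa using norm_pow_le_one_add_norm_pow w le_rfl
    · refine integrable_exp_neg_sq_norm_smul
        (f := fun w : E => 2 * (inner ℝ u w * inner ℝ w v))
        (by fun_prop) (C := 2 * ‖u‖ * ‖v‖) (k := 2) fun w => ?_
      have h1 := norm_inner_le_norm (𝕜 := ℝ) u w
      have h2 := norm_inner_le_norm (𝕜 := ℝ) w v
      rw [norm_mul, norm_mul]
      calc ‖(2 : ℝ)‖ * (‖inner ℝ u w‖ * ‖inner ℝ w v‖)
          ≤ 2 * ((‖u‖ * ‖w‖) * (‖w‖ * ‖v‖)) := by rw [Real.norm_ofNat]; gcongr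
        _ = 2 * ‖u‖ * ‖v‖ * ‖w‖ ^ 2 := by ring
        _ ≤ _ := by gcongr; linarith
  · intro w
    have h1 := norm_inner_le_norm (𝕜 := ℝ) u w
    rw [norm_mul, norm_pow, norm_norm]
    calc ‖w‖ ^ 2 * ‖inner ℝ u w‖ ≤ ‖w‖ ^ 2 * (‖u‖ * ‖w‖) := by gcongr
      _ = ‖u‖ * ‖w‖ ^ 3 := by ring
      _ ≤ (3 * ‖u‖ * (1 + ‖v‖)) * (1 + ‖w‖) ^ 3 := by
        gcongr
        · nlinarith [mul_nonneg hu hv]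
        · linarith
  · intro w
    rw [hd']
    have h1 := norm_inner_le_norm (𝕜 := ℝ) u w
    have h2 := norm_inner_le_norm (𝕜 := ℝ) w v
    have h3 := norm_inner_le_norm (𝕜 := ℝ) u v
    calc ‖‖w‖ ^ 2 * inner ℝ u v + 2 * (inner ℝ u w * inner ℝ w v)‖
        ≤ ‖w‖ ^ 2 * ‖inner ℝ u v‖ + 2 * (‖inner ℝ u w‖ * ‖inner ℝ w v‖) := by
          refine (norm_add_le _ _).trans ?_
          simp [norm_mul]
      _ ≤ ‖w‖ ^ 2 * (‖u‖ * ‖v‖) + 2 * ((‖u‖ * ‖w‖) * (‖w‖ * ‖v‖)) := by gcongr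
      _ = 3 * ‖u‖ * ‖v‖ * ‖w‖ ^ 2 := by ring
      _ ≤ (3 * ‖u‖ * (1 + ‖v‖)) * (1 + ‖w‖) ^ 3 := by
        gcongr
        · linarith
        · exact norm_pow_le_one_add_norm_pow w (by norm_num)

end Gaussian

section Expansion

variable {E : Type*} [NormedAddCommGroup E] [InnerProductSpace ℝ E]

/-- First order bound and second order Taylor bound for a function with bounded first and
second derivatives. -/
lemma exists_taylor_bounds {f : E → ℝ} (hf : ContDiff ℝ 4 f)
    (hbd : ∀ i : ℕ, 1 ≤ i → i ≤ 4 → ∃ C : ℝ, ∀ x, ‖iteratedFDeriv ℝ i f x‖ ≤ C) [CompleteSpace E] :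
    ∃ M : ℝ, 0 ≤ M ∧ (∀ x, ‖gradient f x‖ ≤ M) ∧ (∀ x y, |f y - f x| ≤ M * ‖y - x‖) ∧
      ∀ x y, |f y - f x - inner ℝ (gradient f x) (y - x)| ≤ M * ‖y - x‖ ^ 2 := by
  obtain ⟨C₁, h₁⟩ := hbd 1 le_rfl (by norm_num)
  obtain ⟨C₂, h₂⟩ := hbd 2 (by norm_num) (by norm_num)
  have hdf : Differentiable ℝ f := hf.differentiable (by norm_num)
  have hdf' : Differentiable ℝ (fderiv ℝ f) :=
    (hf.fderiv_right (m := 1) (by norm_num)).differentiable (by norm_num)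
  have b₁ : ∀ x, ‖fderiv ℝ f x‖ ≤ max C₁ C₂ := fun x => by
    rw [← norm_iteratedFDeriv_one]; exact (h₁ x).trans (le_max_left _ _)
  have b₂ : ∀ x, ‖fderiv ℝ (fderiv ℝ f) x‖ ≤ max C₁ C₂ := fun x => by
    rw [← norm_iteratedFDeriv_one, norm_iteratedFDeriv_fderiv]
    exact (h₂ x).trans (le_max_right _ _)
  have hgrad : ∀ x v, inner ℝ (gradient f x) v = fderiv ℝ f x v := fun x v => by
    simp [gradient]
  refine ⟨max C₁ C₂, (norm_nonneg _).trans (b₁ 0), fun x => ?_, fun x y => ?_, fun x y => ?_⟩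
  · simpa [gradient] using b₁ x
  · exact convex_univ.norm_image_sub_le_of_norm_fderiv_le (𝕜 := ℝ)
      (fun z _ => hdf z) (fun z _ => b₁ z) (Set.mem_univ x) (Set.mem_univ y)
  · rw [hgrad, ← Real.norm_eq_abs]
    have key := (convex_segment (𝕜 := ℝ) x y).norm_image_sub_le_of_norm_fderiv_le' (𝕜 := ℝ)
      (f := f) (φ := fderiv ℝ f x) (C := max C₁ C₂ * ‖y - x‖)
      (fun z _ => hdf z) (fun z hz => ?_) (left_mem_segment ℝ x y) (right_mem_segment ℝ x y)
    · exact key.trans_eq (by ring)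
    · refine (convex_univ.norm_image_sub_le_of_norm_fderiv_le (𝕜 := ℝ) (f := fderiv ℝ f)
        (fun z _ => hdf' z) (fun z _ => b₂ z) (Set.mem_univ x) (Set.mem_univ z)).trans ?_
      gcongr
      · exact (norm_nonneg _).trans (b₁ 0)
      · obtain ⟨t, ht, rfl⟩ := (segment_eq_image' ℝ x y) ▸ hz
        rw [add_sub_cancel_left, norm_smul, Real.norm_of_nonneg ht.1]
        exact mul_le_of_le_one_left (norm_nonneg _) ht.2

lemma abs_log_sub_log_sub_le {c a b : ℝ} (hc : 0 < c) (ha : c ≤ a) (hb : c ≤ b) :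
    |Real.log b - Real.log a - (b - a) / a| ≤ (b - a) ^ 2 / c ^ 2 := by
  have ha' : 0 < a := hc.trans_le ha
  have hb' : 0 < b := hc.trans_le hb
  rw [← Real.log_div hb'.ne' ha'.ne']
  have h1 := Real.log_le_sub_one_of_pos (div_pos hb' ha')
  have h2 := Real.one_sub_inv_le_log_of_pos (div_pos hb' ha')
  have e1 : b / a - 1 = (b - a) / a := by field_simp
  have e2 : 1 - (b / a)⁻¹ = (b - a) / a - (b - a) ^ 2 / (a * b) := by field_simp; ring
  have h3 : (b - a) ^ 2 / (a * b) ≤ (b - a) ^ 2 / c ^ 2 := by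
    gcongr; nlinarith
  have h4 : 0 ≤ (b - a) ^ 2 / c ^ 2 := by positivity
  rw [abs_le]; constructor <;> linarith

lemma abs_inv_sub_inv_add_le {c a b : ℝ} (hc : 0 < c) (ha : c ≤ a) (hb : c ≤ b) :
    |b⁻¹ - a⁻¹ + (b - a) / a ^ 2| ≤ (b - a) ^ 2 / c ^ 3 := by
  have ha' : 0 < a := hc.trans_le ha
  have hb' : 0 < b := hc.trans_le hb
  have e : b⁻¹ - a⁻¹ + (b - a) / a ^ 2 = (b - a) ^ 2 / (a ^ 2 * b) := by field_simp; ring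
  rw [e, abs_of_nonneg (by positivity)]
  gcongr
  calc c ^ 3 = c ^ 2 * c := by ring
    _ ≤ a ^ 2 * b := by gcongr

lemma abs_min_one_exp_sub_le (r s : ℝ) :
    |min 1 (rexp r) - 1 - min 0 s| ≤ r ^ 2 + |r - s| := by
  have h1 : |min 1 (rexp r) - 1 - min 0 r| ≤ r ^ 2 := by
    rcases le_total 0 r with h | h
    · rw [min_eq_left (Real.one_le_exp h), min_eq_left h]; simp; positivity
    · rw [min_eq_right (Real.exp_le_one_iff.2 h), min_eq_right h]
      rcases le_total (-1) r with h' | h'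
      · exact Real.abs_exp_sub_one_sub_id_le (abs_le.2 ⟨h', by linarith⟩)
      · have := Real.exp_pos r
        have := Real.add_one_le_exp r
        have := Real.exp_le_one_iff.2 h
        rw [abs_of_nonneg (by linarith)]; nlinarith
  have h2 : |min 0 r - min 0 s| ≤ |r - s| := by
    simpa using abs_min_sub_min_le_max 0 r 0 s
  calc |min 1 (rexp r) - 1 - min 0 s|
      = |(min 1 (rexp r) - 1 - min 0 r) + (min 0 r - min 0 s)| := by congr 1; ring
    _ ≤ _ := (abs_add_le _ _).trans (add_le_add h1 h2)

variable [FiniteDimensional ℝ E] [MeasurableSpace E] [BorelSpace E]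

/-- The vector-valued Gaussian moment of an odd cubic. -/
lemma integral_exp_neg_sq_norm_smul_cubic (u v : E) :
    ∫ w : E, (rexp (-‖w‖ ^ 2) * (inner ℝ u w + ‖w‖ ^ 2 * inner ℝ v w)) • w
      = (∫ w : E, rexp (-‖w‖ ^ 2)) •
        ((1 / 2 : ℝ) • u + (((Module.finrank ℝ E : ℝ) + 2) / 4) • v) := by
  have hint₁ : ∀ z : E, Integrable fun w : E =>
      rexp (-‖w‖ ^ 2) • (inner ℝ u w * inner ℝ w z) := fun z => by
    refine integrable_exp_neg_sq_norm_smul (by fun_prop) (C := ‖u‖ * ‖z‖) (k := 2) fun w => ?_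
    rw [norm_mul]
    calc ‖inner ℝ u w‖ * ‖inner ℝ w z‖ ≤ (‖u‖ * ‖w‖) * (‖w‖ * ‖z‖) := by
          gcongr <;> exact norm_inner_le_norm _ _
      _ = ‖u‖ * ‖z‖ * ‖w‖ ^ 2 := by ring
      _ ≤ _ := by gcongr; exact le_add_of_nonneg_left zero_le_one
  have hint₂ : ∀ z : E, Integrable fun w : E =>
      rexp (-‖w‖ ^ 2) • ((‖w‖ ^ 2 * inner ℝ v w) * inner ℝ w z) := fun z => by
    refine integrable_exp_neg_sq_norm_smul (by fun_prop) (C := ‖v‖ * ‖z‖) (k := 4) fun w => ?_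
    rw [norm_mul, norm_mul, norm_pow, norm_norm]
    calc ‖w‖ ^ 2 * ‖inner ℝ v w‖ * ‖inner ℝ w z‖ ≤ ‖w‖ ^ 2 * (‖v‖ * ‖w‖) * (‖w‖ * ‖z‖) := by
          gcongr <;> exact norm_inner_le_norm _ _
      _ = ‖v‖ * ‖z‖ * ‖w‖ ^ 4 := by ring
      _ ≤ _ := by gcongr; exact le_add_of_nonneg_left zero_le_one
  have hint : Integrable fun w : E =>
      rexp (-‖w‖ ^ 2) • ((inner ℝ u w + ‖w‖ ^ 2 * inner ℝ v w) • w) := by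
    refine integrable_exp_neg_sq_norm_smul (by fun_prop) (C := ‖u‖ + ‖v‖) (k := 4) fun w => ?_
    rw [norm_smul]
    calc ‖inner ℝ u w + ‖w‖ ^ 2 * inner ℝ v w‖ * ‖w‖
        ≤ (‖u‖ * ‖w‖ + ‖w‖ ^ 2 * (‖v‖ * ‖w‖)) * ‖w‖ := by
          gcongr
          refine (norm_add_le _ _).trans ?_
          rw [norm_mul, norm_pow, norm_norm]
          gcongr <;> exact norm_inner_le_norm _ _
      _ = ‖u‖ * ‖w‖ ^ 2 + ‖v‖ * ‖w‖ ^ 4 := by ring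
      _ ≤ ‖u‖ * (1 + ‖w‖) ^ 4 + ‖v‖ * (1 + ‖w‖) ^ 4 := by
          gcongr ?_ * ?_ + ?_ * ?_
          · exact norm_pow_le_one_add_norm_pow w (by norm_num)
          · exact norm_pow_le_one_add_norm_pow w le_rfl
      _ = _ := by ring
  refine ext_inner_right ℝ fun z => ?_
  simp only [mul_smul]
  rw [real_inner_comm, ← integral_inner hint]
  have e : ∀ w : E, inner ℝ z (rexp (-‖w‖ ^ 2) • ((inner ℝ u w + ‖w‖ ^ 2 * inner ℝ v w) • w))
      = rexp (-‖w‖ ^ 2) * (inner ℝ u w * inner ℝ w z)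
        + rexp (-‖w‖ ^ 2) * ((‖w‖ ^ 2 * inner ℝ v w) * inner ℝ w z) := fun w => by
    rw [inner_smul_right, inner_smul_right, real_inner_comm z w]; ring
  simp only [smul_eq_mul] at hint₁ hint₂
  simp only [e]
  rw [integral_add (hint₁ z) (hint₂ z), integral_exp_neg_sq_norm_mul_inner_mul_inner,
    integral_exp_neg_sq_norm_mul_sq_norm_mul_inner_mul_inner]
  simp only [inner_smul_left, inner_add_left, RCLike.conj_to_real]
  ring

/-- If `A` is close to `1 + min 0 r` for an odd cubic `r`, then the Gaussian first moment of `A`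
is close to half the Gaussian first moment of `r`. -/
lemma norm_integral_exp_neg_sq_norm_smul_sub_le (u v : E) {A : E → ℝ} (hA : Continuous A)
    {B : ℝ} (hAB : ∀ w, |A w - 1 - min 0 (inner ℝ u w + ‖w‖ ^ 2 * inner ℝ v w)|
      ≤ B * (1 + ‖w‖) ^ 8) :
    ‖(∫ w : E, (rexp (-‖w‖ ^ 2) * A w) • w) - ((∫ w : E, rexp (-‖w‖ ^ 2)) / 2) •
        ((1 / 2 : ℝ) • u + (((Module.finrank ℝ E : ℝ) + 2) / 4) • v)‖
      ≤ B * ∫ w : E, rexp (-‖w‖ ^ 2) * (1 + ‖w‖) ^ 9 := by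
  have hB : 0 ≤ B := by simpa using (abs_nonneg _).trans (hAB 0)
  set r : E → ℝ := fun w => inner ℝ u w + ‖w‖ ^ 2 * inner ℝ v w with hr
  have hrc : Continuous r := by fun_prop
  have hrb : ∀ w, |r w| ≤ (‖u‖ + ‖v‖) * (1 + ‖w‖) ^ 3 := fun w => by
    calc |r w| ≤ ‖u‖ * ‖w‖ + ‖w‖ ^ 2 * (‖v‖ * ‖w‖) := by
          refine (abs_add_le _ _).trans ?_
          rw [abs_mul, abs_of_nonneg (by positivity : (0 : ℝ) ≤ ‖w‖ ^ 2)]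
          gcongr <;> exact abs_real_inner_le_norm _ _
      _ = ‖u‖ * ‖w‖ ^ 1 + ‖v‖ * ‖w‖ ^ 3 := by ring
      _ ≤ ‖u‖ * (1 + ‖w‖) ^ 3 + ‖v‖ * (1 + ‖w‖) ^ 3 := by
          gcongr ?_ * ?_ + ?_ * ?_
          · exact norm_pow_le_one_add_norm_pow w (by norm_num)
          · exact norm_pow_le_one_add_norm_pow w le_rfl
      _ = _ := by ring
  have hrneg : ∀ w, r (-w) = -r w := fun w => by simp [hr]; ring
  have hW : Integrable fun w : E => rexp (-‖w‖ ^ 2) • ((1 + ‖w‖) ^ 9) :=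
    integrable_exp_neg_sq_norm_smul (by fun_prop) (C := 1) (k := 9) fun w => by
      rw [Real.norm_of_nonneg (by positivity), one_mul]
  have hE : Integrable fun w : E => rexp (-‖w‖ ^ 2) • ((A w - 1 - min 0 (r w)) • w) :=
    integrable_exp_neg_sq_norm_smul (by fun_prop) (C := B) (k := 9) fun w => by
      rw [norm_smul, pow_succ, ← mul_assoc]
      exact mul_le_mul (hAB w) (by linarith) (norm_nonneg _) (by positivity)
  have hR : Integrable fun w : E => rexp (-‖w‖ ^ 2) • (r w • w) :=
    integrable_exp_neg_sq_norm_smul (by fun_prop) (C := ‖u‖ + ‖v‖) (k := 4) fun w => by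
      rw [norm_smul, pow_succ, ← mul_assoc]
      exact mul_le_mul (hrb w) (by linarith) (norm_nonneg _) (by positivity)
  have hO : Integrable fun w : E => rexp (-‖w‖ ^ 2) • ((1 - |r w| / 2) • w) :=
    integrable_exp_neg_sq_norm_smul (by fun_prop) (C := 1 + (‖u‖ + ‖v‖)) (k := 4) fun w => by
      rw [norm_smul, pow_succ, ← mul_assoc]
      refine mul_le_mul ?_ (by linarith) (norm_nonneg _) (by positivity)
      have h1 := hrb w
      have h2 : 1 ≤ (1 + ‖w‖) ^ 3 := one_le_pow₀ (by linarith [norm_nonneg w])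
      have h3 := abs_nonneg (r w)
      rw [Real.norm_eq_abs, abs_le]
      constructor <;> nlinarith
  have hO0 : ∫ w : E, rexp (-‖w‖ ^ 2) • ((1 - |r w| / 2) • w) = 0 := by
    have : IsAddTorsionFree E := .of_isTorsionFree ℝ E
    have h := integral_neg_eq_self (fun w : E => rexp (-‖w‖ ^ 2) • ((1 - |r w| / 2) • w)) volume
    simp only [norm_neg, hrneg, abs_neg, smul_neg, integral_neg] at h
    exact self_eq_neg.1 h.symm
  have hsplit : ∀ w : E, (rexp (-‖w‖ ^ 2) * A w) • w
      = rexp (-‖w‖ ^ 2) • ((A w - 1 - min 0 (r w)) • w)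
        + (rexp (-‖w‖ ^ 2) • ((1 - |r w| / 2) • w)
          + (1 / 2 : ℝ) • (rexp (-‖w‖ ^ 2) • (r w • w))) := fun w => by
    have : min 0 (r w) = (r w - |r w|) / 2 := by
      rcases le_total 0 (r w) with h | h
      · rw [min_eq_left h, abs_of_nonneg h]; ring
      · rw [min_eq_right h, abs_of_nonpos h]; ring
    rw [this]; module
  have hcub := integral_exp_neg_sq_norm_smul_cubic u v
  simp only [mul_smul] at hcub
  have hR' : Integrable fun w : E => (1 / 2 : ℝ) • (rexp (-‖w‖ ^ 2) • (r w • w)) := hR.smul _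
  have hOR : Integrable fun w : E => rexp (-‖w‖ ^ 2) • ((1 - |r w| / 2) • w)
      + (1 / 2 : ℝ) • (rexp (-‖w‖ ^ 2) • (r w • w)) := hO.add hR'
  simp only [hsplit]
  rw [integral_add hE hOR, integral_add hO hR', hO0,
    integral_smul, hcub, zero_add, smul_smul, one_div_mul_eq_div, add_sub_cancel_right,
    ← integral_const_mul]
  refine norm_integral_le_of_norm_le (hW.const_mul B) (.of_forall fun w => ?_)
  rw [norm_smul, Real.norm_of_nonneg (Real.exp_pos _).le, norm_smul]
  calc rexp (-‖w‖ ^ 2) * (‖A w - 1 - min 0 (r w)‖ * ‖w‖)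
      ≤ rexp (-‖w‖ ^ 2) * ((B * (1 + ‖w‖) ^ 8) * (1 + ‖w‖)) := by
        gcongr
        · exact hAB w
        · linarith
    _ = B * (rexp (-‖w‖ ^ 2) • (1 + ‖w‖) ^ 9) := by rw [smul_eq_mul]; ring

end Expansion

section Metropolis

variable {d : ℕ} {D ρeq : EuclideanSpace ℝ (Fin d) → ℝ} {h : ℝ}

/-- Exponential form of the acceptance probability. -/
lemma alphah_eq_min_one_exp (hD : ∀ x, 0 < D x) (hρ : ∀ x, 0 < ρeq x) (hh : 0 < h)
    (x y : EuclideanSpace ℝ (Fin d)) :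
    alphah D ρeq h x y = min 1 (rexp (-((d : ℝ) / 2) * (Real.log (D y) - Real.log (D x))
      - ‖y - x‖ ^ 2 / (4 * h) * ((D y)⁻¹ - (D x)⁻¹)
      + (Real.log (ρeq y) - Real.log (ρeq x)))) := by
  have hq : ∀ x y, qh D h x y = rexp (Real.log (4 * π * h) * (-(d : ℝ) / 2)
      + Real.log (D x) * (-(d : ℝ) / 2) + -‖y - x‖ ^ 2 / (4 * h * D x)) := fun x y => by
    have hx := hD x
    rw [qh, Real.rpow_def_of_pos (by positivity), ← Real.exp_add,
      Real.log_mul (by positivity) hx.ne', add_mul]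
  rw [alphah, hq, hq]
  conv_lhs => rw [← Real.exp_log (hρ y), ← Real.exp_log (hρ x)]
  rw [← Real.exp_add, ← Real.exp_add, ← Real.exp_sub]
  congr 2
  have hx := (hD x).ne'
  have hy := (hD y).ne'
  rw [norm_sub_rev x y]
  field_simp
  ring

/-- The increment integral after the substitution `y = x + σ w`. -/
lemma integral_mul_qh_smul_sub (x : EuclideanSpace ℝ (Fin d))
    (A : EuclideanSpace ℝ (Fin d) → ℝ) {σ : ℝ} (hσ : 0 < σ) (hσ2 : σ ^ 2 = 4 * h * D x) :
    ∫ y, (A y * qh D h x y) • (y - x)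
      = (σ / π ^ ((d : ℝ) / 2)) •
        ∫ w : EuclideanSpace ℝ (Fin d), (rexp (-‖w‖ ^ 2) * A (x + σ • w)) • w := by
  have hsub := Measure.integral_comp_smul_of_nonneg (volume : Measure (EuclideanSpace ℝ (Fin d)))
    (fun z => (A (x + z) * qh D h x (x + z)) • z) σ (hR := hσ.le)
  have htrans := integral_add_left_eq_self (μ := (volume : Measure (EuclideanSpace ℝ (Fin d))))
    (fun y => (A y * qh D h x y) • (y - x)) x
  simp only [add_sub_cancel_left] at htrans
  rw [finrank_euclideanSpace_fin, eq_inv_smul_iff₀ (by positivity)] at hsub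
  rw [← htrans, ← hsub, ← integral_smul, ← integral_smul]
  congr 1
  ext1 w
  have hq : qh D h x (x + σ • w) = (π ^ ((d : ℝ) / 2))⁻¹ * (σ ^ d)⁻¹ * rexp (-‖w‖ ^ 2) := by
    have e1 : 4 * π * h * D x = π * σ ^ 2 := by rw [hσ2]; ring
    have e2 : -‖σ • w‖ ^ 2 / (4 * h * D x) = -‖w‖ ^ 2 := by
      rw [norm_smul, Real.norm_of_nonneg hσ.le, ← hσ2]; field_simp
    have e3 : (σ ^ 2) ^ (-(d : ℝ) / 2) = (σ ^ d)⁻¹ := by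
      rw [← Real.rpow_natCast σ 2, ← Real.rpow_mul hσ.le, ← Real.rpow_natCast σ d,
        ← Real.rpow_neg hσ.le]
      congr 1; push_cast; ring
    rw [qh, add_sub_cancel_left, e1, e2, Real.mul_rpow pi_pos.le (by positivity), e3, neg_div,
      Real.rpow_neg pi_pos.le]
  rw [hq, smul_smul, smul_smul, smul_smul]
  congr 1
  field_simp

/-- Linearization of the logarithmic acceptance ratio. -/
lemma abs_log_ratio_sub_linear_le {c M δ a b l g gl n h : ℝ} (hc : 0 < c) (hM : 0 ≤ M)
    (hδ : 0 ≤ δ) (ha : c ≤ a) (hb : c ≤ b) (hh : 0 < h)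
    (hab : |b - a| ≤ M * n) (hg : |b - a - g| ≤ M * n ^ 2) (hgl : |l - gl| ≤ M * n ^ 2) :
    |(-(δ / 2) * (Real.log b - Real.log a) - n ^ 2 / (4 * h) * (b⁻¹ - a⁻¹) + l)
        - (gl - δ / 2 * (g / a) + n ^ 2 / (4 * h) * (g / a ^ 2))|
      ≤ (δ * (M ^ 2 / c ^ 2 + M / c) + (M ^ 2 / c ^ 3 + M / c ^ 2) + M) * (n ^ 2 + n ^ 4 / h) := by
  have ha' : 0 < a := hc.trans_le ha
  have hsq : (b - a) ^ 2 ≤ M ^ 2 * n ^ 2 := by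
    rw [← sq_abs, ← mul_pow]; gcongr
  have h1 := (abs_log_sub_log_sub_le hc ha hb).trans
    (div_le_div_of_nonneg_right hsq (by positivity))
  have h2 := (abs_inv_sub_inv_add_le hc ha hb).trans
    (div_le_div_of_nonneg_right hsq (by positivity))
  have h3 : |(b - a - g) / a| ≤ M * n ^ 2 / c := by
    rw [abs_div, abs_of_pos ha']; gcongr
  have h4 : |(b - a - g) / a ^ 2| ≤ M * n ^ 2 / c ^ 2 := by
    rw [abs_div, abs_of_pos (by positivity : 0 < a ^ 2)]; gcongr
  have e : (-(δ / 2) * (Real.log b - Real.log a) - n ^ 2 / (4 * h) * (b⁻¹ - a⁻¹) + l)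
        - (gl - δ / 2 * (g / a) + n ^ 2 / (4 * h) * (g / a ^ 2))
      = -(δ / 2) * (Real.log b - Real.log a - (b - a) / a) - δ / 2 * ((b - a - g) / a)
        - n ^ 2 / (4 * h) * (b⁻¹ - a⁻¹ + (b - a) / a ^ 2)
        + n ^ 2 / (4 * h) * ((b - a - g) / a ^ 2) + (l - gl) := by ring
  have hn : 0 ≤ n ^ 2 / (4 * h) := by positivity
  have t1 : |-(δ / 2) * (Real.log b - Real.log a - (b - a) / a)|
      ≤ δ / 2 * (M ^ 2 * n ^ 2 / c ^ 2) := by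
    rw [abs_mul, abs_neg, abs_of_nonneg (by positivity : 0 ≤ δ / 2)]; gcongr
  have t2 : |δ / 2 * ((b - a - g) / a)| ≤ δ / 2 * (M * n ^ 2 / c) := by
    rw [abs_mul, abs_of_nonneg (by positivity : 0 ≤ δ / 2)]; gcongr
  have t3 : |n ^ 2 / (4 * h) * (b⁻¹ - a⁻¹ + (b - a) / a ^ 2)|
      ≤ n ^ 2 / (4 * h) * (M ^ 2 * n ^ 2 / c ^ 3) := by
    rw [abs_mul, abs_of_nonneg hn]; gcongr
  have t4 : |n ^ 2 / (4 * h) * ((b - a - g) / a ^ 2)|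
      ≤ n ^ 2 / (4 * h) * (M * n ^ 2 / c ^ 2) := by
    rw [abs_mul, abs_of_nonneg hn]; gcongr
  rw [e]
  calc _ ≤ δ / 2 * (M ^ 2 * n ^ 2 / c ^ 2) + δ / 2 * (M * n ^ 2 / c)
        + n ^ 2 / (4 * h) * (M ^ 2 * n ^ 2 / c ^ 3) + n ^ 2 / (4 * h) * (M * n ^ 2 / c ^ 2)
        + M * n ^ 2 := by
        refine (abs_add_le _ _).trans (add_le_add ?_ hgl)
        refine (abs_add_le _ _).trans (add_le_add ?_ t4)
        refine (abs_sub _ _).trans (add_le_add ?_ t3)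
        exact (abs_sub _ _).trans (add_le_add t1 t2)
    _ = (δ * (M ^ 2 / c ^ 2 + M / c) / 2 + M) * n ^ 2
        + ((M ^ 2 / c ^ 3 + M / c ^ 2) / 4) * (n ^ 4 / h) := by field_simp; ring
    _ ≤ (δ * (M ^ 2 / c ^ 2 + M / c) + (M ^ 2 / c ^ 3 + M / c ^ 2) + M) * n ^ 2
        + (δ * (M ^ 2 / c ^ 2 + M / c) + (M ^ 2 / c ^ 3 + M / c ^ 2) + M) * (n ^ 4 / h) := by
        have p1 : 0 ≤ δ * (M ^ 2 / c ^ 2 + M / c) := by positivity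
        have p2 : 0 ≤ M ^ 2 / c ^ 3 + M / c ^ 2 := by positivity
        gcongr <;> linarith
    _ = _ := by ring

lemma abs_linear_le {c M δ a g gl n h : ℝ} (hc : 0 < c) (hM : 0 ≤ M)
    (hδ : 0 ≤ δ) (ha : c ≤ a) (hh : 0 < h) (hn : 0 ≤ n)
    (hg : |g| ≤ M * n) (hgl : |gl| ≤ M * n) :
    |gl - δ / 2 * (g / a) + n ^ 2 / (4 * h) * (g / a ^ 2)|
      ≤ (δ * (M ^ 2 / c ^ 2 + M / c) + (M ^ 2 / c ^ 3 + M / c ^ 2) + M) * (n + n ^ 3 / h) := by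
  have ha' : 0 < a := hc.trans_le ha
  have t1 : |δ / 2 * (g / a)| ≤ δ / 2 * (M * n / c) := by
    rw [abs_mul, abs_div g, abs_of_pos ha', abs_of_nonneg (by positivity : 0 ≤ δ / 2)]; gcongr
  have t2 : |n ^ 2 / (4 * h) * (g / a ^ 2)| ≤ n ^ 2 / (4 * h) * (M * n / c ^ 2) := by
    rw [abs_mul, abs_div g, abs_of_pos (by positivity : 0 < a ^ 2),
      abs_of_nonneg (by positivity : 0 ≤ n ^ 2 / (4 * h))]
    gcongr
  calc _ ≤ M * n + δ / 2 * (M * n / c) + n ^ 2 / (4 * h) * (M * n / c ^ 2) := by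
        refine (abs_add_le _ _).trans (add_le_add ?_ t2)
        exact (abs_sub _ _).trans (add_le_add hgl t1)
    _ = (δ * (M / c) / 2 + M) * n + (M / c ^ 2 / 4) * (n ^ 3 / h) := by field_simp; ring
    _ ≤ (δ * (M ^ 2 / c ^ 2 + M / c) + (M ^ 2 / c ^ 3 + M / c ^ 2) + M) * n
        + (δ * (M ^ 2 / c ^ 2 + M / c) + (M ^ 2 / c ^ 3 + M / c ^ 2) + M) * (n ^ 3 / h) := by
        rw [mul_add δ]
        have p1 : 0 ≤ δ * (M ^ 2 / c ^ 2) := by positivity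
        have p2 : 0 ≤ δ * (M / c) := by positivity
        have p3 : 0 ≤ M ^ 2 / c ^ 3 := by positivity
        have p4 : 0 ≤ M / c ^ 2 := by positivity
        gcongr ?_ * _ + ?_ * _ <;> linarith
    _ = _ := by ring

/-- Converts bounds at the scale `n = σ p`, `σ² = 4ha`, into a bound of order `h`. -/
lemma sq_add_abs_sub_le {C a h p σ R r : ℝ} (hC : 0 ≤ C) (ha : 0 < a) (hh : 0 < h) (hh1 : h ≤ 1)
    (hp : 0 ≤ p) (hσ2 : σ ^ 2 = 4 * h * a)
    (hRr : |R - r| ≤ C * ((σ * p) ^ 2 + (σ * p) ^ 4 / h))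
    (hr : |r| ≤ C * (σ * p + (σ * p) ^ 3 / h)) :
    R ^ 2 + |R - r| ≤ h * (1000 * C ^ 2 + 20 * C) * (1 + a) ^ 4 * (1 + p) ^ 8 := by
  set q := a * p ^ 2 with hq
  set Q := (1 + a) * (1 + p) ^ 2 with hQ
  have hq0 : 0 ≤ q := by positivity
  have hqQ : q ≤ Q := by rw [hq, hQ]; gcongr <;> linarith
  have hQ1 : 1 ≤ Q := one_le_mul_of_one_le_of_one_le (by linarith) (one_le_pow₀ (by linarith))
  have e2 : (σ * p) ^ 2 = 4 * h * q := by rw [mul_pow, hσ2, hq]; ring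
  have e4 : (σ * p) ^ 4 / h = 16 * h * q ^ 2 := by
    rw [show (σ * p) ^ 4 = ((σ * p) ^ 2) ^ 2 by ring, e2]; field_simp; ring
  have e3 : (σ * p + (σ * p) ^ 3 / h) ^ 2 = 4 * h * (q * (1 + 4 * q) ^ 2) := by
    have : σ * p + (σ * p) ^ 3 / h = (σ * p) * (1 + 4 * q) := by
      rw [show (σ * p) ^ 3 = (σ * p) * (σ * p) ^ 2 by ring, e2]; field_simp
    rw [this, mul_pow, e2]; ring
  have b1 : |R - r| ≤ 20 * C * h * Q ^ 2 := by
    rw [e2, e4] at hRr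
    calc |R - r| ≤ C * (4 * h * q + 16 * h * q ^ 2) := hRr
      _ ≤ C * (4 * h * Q ^ 2 + 16 * h * Q ^ 2) := by
          gcongr; nlinarith
      _ = _ := by ring
  have b2 : r ^ 2 ≤ 100 * C ^ 2 * h * Q ^ 3 := by
    calc r ^ 2 = |r| ^ 2 := (sq_abs r).symm
      _ ≤ (C * (σ * p + (σ * p) ^ 3 / h)) ^ 2 := by gcongr
      _ = C ^ 2 * (4 * h * (q * (1 + 4 * q) ^ 2)) := by rw [mul_pow, e3]
      _ ≤ C ^ 2 * (4 * h * (Q * (5 * Q) ^ 2)) := by gcongr; linarith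
      _ = _ := by ring
  have b3 : (R - r) ^ 2 ≤ 400 * C ^ 2 * h * Q ^ 4 := by
    calc (R - r) ^ 2 = |R - r| ^ 2 := (sq_abs _).symm
      _ ≤ (20 * C * h * Q ^ 2) ^ 2 := by gcongr
      _ = 400 * C ^ 2 * h * Q ^ 4 * h := by ring
      _ ≤ 400 * C ^ 2 * h * Q ^ 4 * 1 := by gcongr
      _ = _ := by ring
  have m2 : Q ^ 2 ≤ Q ^ 4 := pow_le_pow_right₀ hQ1 (by norm_num)
  have m3 : Q ^ 3 ≤ Q ^ 4 := pow_le_pow_right₀ hQ1 (by norm_num)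
  calc R ^ 2 + |R - r| ≤ 2 * r ^ 2 + 2 * (R - r) ^ 2 + |R - r| := by
        nlinarith [sq_nonneg (R - 2 * r)]
    _ ≤ 2 * (100 * C ^ 2 * h * Q ^ 4) + 2 * (400 * C ^ 2 * h * Q ^ 4) + 20 * C * h * Q ^ 4 := by
        gcongr
        · exact b2.trans (by gcongr)
        · exact b1.trans (by gcongr)
    _ = h * (1000 * C ^ 2 + 20 * C) * Q ^ 4 := by ring
    _ = _ := by rw [hQ]; ring

/-- The drift as the rescaled Gaussian moment of the linearized acceptance ratio. -/
lemma smul_drift_eq {E : Type*} [AddCommGroup E] [Module ℝ E] {h D₀ σ Z δ : ℝ} (hh : 0 < h)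
    (hD₀ : 0 < D₀) (hZ : 0 < Z) (hσ2 : σ ^ 2 = 4 * h * D₀) (gD gL : E) :
    (σ / Z) • ((Z / 2) • ((1 / 2 : ℝ) • (σ • (gL - (δ / 2 / D₀) • gD))
        + ((δ + 2) / 4) • ((σ ^ 3 / (4 * h * D₀ ^ 2)) • gD))) = h • (gD + D₀ • gL) := by
  have e1 : σ / Z * (Z / 2) * (1 / 2) * σ = h * D₀ := by
    field_simp; rw [hσ2]; ring
  have e2 : σ / Z * (Z / 2) * ((δ + 2) / 4) * (σ ^ 3 / (4 * h * D₀ ^ 2)) = h * (δ + 2) / 2 := by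
    have : σ ^ 4 = (4 * h * D₀) ^ 2 := by rw [← hσ2]; ring
    field_simp; rw [this]; ring
  have e3 : h * D₀ * (δ / 2 / D₀) = h * δ / 2 := by field_simp
  rw [smul_smul, smul_add, smul_smul, smul_smul, smul_smul, smul_smul, e1, e2, smul_sub,
    smul_smul, e3]
  module

/-- Continuity of the acceptance probability in the proposal. -/
lemma continuous_alphah (hD : ∀ x, 0 < D x) (hρ : ∀ x, 0 < ρeq x) (hh : 0 < h)
    (hDc : Continuous D) (hLc : Continuous fun x => Real.log (ρeq x))
    (x : EuclideanSpace ℝ (Fin d)) : Continuous fun y => alphah D ρeq h x y := by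
  have hlog : Continuous fun y => Real.log (D y) := hDc.log fun y => (hD y).ne'
  have hinv : Continuous fun y => (D y)⁻¹ := hDc.inv₀ fun y => (hD y).ne'
  simp only [alphah_eq_min_one_exp hD hρ hh]
  fun_prop

/-- The acceptance probability is `1 + min 0 r` up to order `h`, for an odd cubic `r`. -/
lemma abs_alphah_sub_le {c M : ℝ} (hρ : ∀ x, 0 < ρeq x) (hc : 0 < c) (hcD : ∀ x, c ≤ D x)
    (hM : 0 ≤ M) (hh : 0 < h) (hh1 : h ≤ 1) {x gD gL : EuclideanSpace ℝ (Fin d)}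
    (hgD : ‖gD‖ ≤ M) (hgL : ‖gL‖ ≤ M)
    (hD1 : ∀ y, |D y - D x| ≤ M * ‖y - x‖)
    (hD2 : ∀ y, |D y - D x - inner ℝ gD (y - x)| ≤ M * ‖y - x‖ ^ 2)
    (hL2 : ∀ y, |Real.log (ρeq y) - Real.log (ρeq x) - inner ℝ gL (y - x)| ≤ M * ‖y - x‖ ^ 2)
    {σ C : ℝ} (hσ : 0 < σ) (hσ2 : σ ^ 2 = 4 * h * D x)
    (hC : C = d * (M ^ 2 / c ^ 2 + M / c) + (M ^ 2 / c ^ 3 + M / c ^ 2) + M)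
    (w : EuclideanSpace ℝ (Fin d)) :
    |alphah D ρeq h x (x + σ • w) - 1
      - min 0 (inner ℝ (σ • (gL - ((d : ℝ) / 2 / D x) • gD)) w
        + ‖w‖ ^ 2 * inner ℝ ((σ ^ 3 / (4 * h * D x ^ 2)) • gD) w)|
      ≤ (h * (1000 * C ^ 2 + 20 * C) * (1 + D x) ^ 4) * (1 + ‖w‖) ^ 8 := by
  have hx : 0 < D x := hc.trans_le (hcD x)
  rw [alphah_eq_min_one_exp (fun x => hc.trans_le (hcD x)) hρ hh]
  refine (abs_min_one_exp_sub_le _ _).trans ?_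
  have hn : ‖x + σ • w - x‖ = σ * ‖w‖ := by
    rw [add_sub_cancel_left, norm_smul, Real.norm_of_nonneg hσ.le]
  have hlin : inner ℝ (σ • (gL - ((d : ℝ) / 2 / D x) • gD)) w
        + ‖w‖ ^ 2 * inner ℝ ((σ ^ 3 / (4 * h * D x ^ 2)) • gD) w
      = inner ℝ gL (σ • w) - (d : ℝ) / 2 * (inner ℝ gD (σ • w) / D x)
        + (σ * ‖w‖) ^ 2 / (4 * h) * (inner ℝ gD (σ • w) / D x ^ 2) := by
    simp only [inner_smul_left, inner_smul_right, inner_sub_left, RCLike.conj_to_real]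
    field_simp
  have hinner : ∀ z : EuclideanSpace ℝ (Fin d), ‖z‖ ≤ M →
      |inner ℝ z (σ • w)| ≤ M * (σ * ‖w‖) := fun z hz => by
    refine (abs_real_inner_le_norm _ _).trans ?_
    rw [norm_smul, Real.norm_of_nonneg hσ.le]
    gcongr
  have tD1 := hD1 (x + σ • w)
  have tD2 := hD2 (x + σ • w)
  have tL2 := hL2 (x + σ • w)
  rw [hn] at tD1 tD2 tL2 ⊢
  rw [add_sub_cancel_left] at tD2 tL2
  rw [hlin]
  have hC0 : 0 ≤ C := by rw [hC]; positivity
  refine sq_add_abs_sub_le hC0 hx hh hh1 (norm_nonneg w) hσ2 ?_ ?_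
  · rw [hC]
    exact abs_log_ratio_sub_linear_le hc hM (Nat.cast_nonneg d) (hcD x) (hcD _) hh tD1 tD2 tL2
  · rw [hC]
    exact abs_linear_le hc hM (Nat.cast_nonneg d) (hcD x) hh (by positivity)
      (hinner _ hgD) (hinner _ hgL)

end Metropolis

/-- the expected one-step increment of the Metropolized scheme
matches the drift `a(x) = ∇D(x) + D(x)∇ln ρ_eq(x)` to order `h^{3/2}`,
with a constant of polynomial growth in `x`. -/
theorem expected_increment_drift {d : ℕ} (hd : 1 ≤ d)
    (D ρeq : EuclideanSpace ℝ (Fin d) → ℝ)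
    (hρeqpos : ∀ x, 0 < ρeq x)
    (hDsmooth : ContDiff ℝ 4 D)
    (hLsmooth : ContDiff ℝ 4 (fun x => Real.log (ρeq x)))
    (hDbd : ∀ i : ℕ, 1 ≤ i → i ≤ 4 → ∃ C : ℝ, ∀ x, ‖iteratedFDeriv ℝ i D x‖ ≤ C)
    (hLbd : ∀ i : ℕ, 1 ≤ i → i ≤ 4 →
      ∃ C : ℝ, ∀ x, ‖iteratedFDeriv ℝ i (fun y => Real.log (ρeq y)) x‖ ≤ C)
    (hDinf : ∃ c : ℝ, 0 < c ∧ ∀ x, c ≤ D x)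
    (a : EuclideanSpace ℝ (Fin d) → EuclideanSpace ℝ (Fin d))
    (ha : ∀ x, a x = gradient D x + D x • gradient (fun y => Real.log (ρeq y)) x) :
    ∃ (K : EuclideanSpace ℝ (Fin d) → ℝ) (C : ℝ) (m : ℕ),
      (∀ x, |K x| ≤ C * (1 + ‖x‖ ^ m)) ∧
      ∀ x, ∀ h ∈ Set.Ioc (0 : ℝ) 1,
        ‖(∫ y, (alphah D ρeq h x y * qh D h x y) • (y - x)) - h • a x‖
          ≤ K x * h ^ ((3 : ℝ) / 2) := by
  obtain ⟨c, hc, hcD⟩ := hDinf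
  obtain ⟨M₁, hM₁, hgD, hD1, hD2⟩ := exists_taylor_bounds hDsmooth hDbd
  obtain ⟨M₂, hM₂, hgL, -, hL2⟩ := exists_taylor_bounds hLsmooth hLbd
  set L : EuclideanSpace ℝ (Fin d) → ℝ := fun x => Real.log (ρeq x)
  have hDpos : ∀ x, 0 < D x := fun x => hc.trans_le (hcD x)
  have hDc : Continuous D := hDsmooth.continuous
  have hLc : Continuous L := hLsmooth.continuous
  set M := M₁ + M₂
  have hM : 0 ≤ M := add_nonneg hM₁ hM₂
  have hmono₁ : M₁ ≤ M := le_add_of_nonneg_right hM₂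
  have hmono₂ : M₂ ≤ M := le_add_of_nonneg_left hM₁
  set C : ℝ := d * (M ^ 2 / c ^ 2 + M / c) + (M ^ 2 / c ^ 3 + M / c ^ 2) + M with hCdef
  have hC : 0 ≤ C := by positivity
  set J : ℝ := ∫ w : EuclideanSpace ℝ (Fin d), rexp (-‖w‖ ^ 2) * (1 + ‖w‖) ^ 9
  have hJ0 : 0 ≤ J := integral_nonneg fun w => by positivity
  set Z : ℝ := π ^ ((d : ℝ) / 2)
  have hZ : 0 < Z := by positivity
  have hZint : ∫ w : EuclideanSpace ℝ (Fin d), rexp (-‖w‖ ^ 2) = Z := by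
    rw [integral_exp_neg_sq_norm, finrank_euclideanSpace_fin]
  set G : ℝ := 2 * J / Z * (1000 * C ^ 2 + 20 * C) with hGdef
  have hG : 0 ≤ G := by positivity
  refine ⟨fun x => G * (1 + D x) ^ 5, G * ((1 + D 0 + M) ^ 5 * 2 ^ 4), 5, fun x => ?_,
    fun x h hh => ?_⟩
  · have hx := hDpos x
    have h0 := hDpos 0
    have hlin : 1 + D x ≤ (1 + D 0 + M) * (1 + ‖x‖) := by
      have h1 := (le_abs_self _).trans (hD1 0 x)
      rw [sub_zero] at h1
      have := norm_nonneg x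
      nlinarith [mul_nonneg hM₂ this, mul_nonneg h0.le this]
    rw [abs_of_nonneg (by positivity)]
    calc G * (1 + D x) ^ 5 ≤ G * ((1 + D 0 + M) * (1 + ‖x‖)) ^ 5 := by gcongr
      _ ≤ G * ((1 + D 0 + M) ^ 5 * (2 ^ 4 * (1 ^ 5 + ‖x‖ ^ 5))) := by
          rw [mul_pow]
          gcongr
          exact add_pow_le zero_le_one (norm_nonneg x) 5
      _ = _ := by rw [one_pow, mul_assoc G, mul_assoc ((1 + D 0 + M) ^ 5)]
  obtain ⟨hh0, hh1⟩ := hh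
  have hx := hDpos x
  set σ : ℝ := √(4 * h * D x)
  have hσ : 0 < σ := by positivity
  have hσ2 : σ ^ 2 = 4 * h * D x := Real.sq_sqrt (by positivity)
  have hσle : σ ≤ 2 * √h * (1 + D x) := by
    refine Real.sqrt_le_iff.2 ⟨by positivity, ?_⟩
    rw [mul_pow, mul_pow, Real.sq_sqrt hh0.le]
    rw [show (2 : ℝ) ^ 2 = 4 by norm_num]
    gcongr
    nlinarith
  have key := norm_integral_exp_neg_sq_norm_smul_sub_le
    (σ • (gradient L x - ((d : ℝ) / 2 / D x) • gradient D x))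
    ((σ ^ 3 / (4 * h * D x ^ 2)) • gradient D x)
    ((continuous_alphah hDpos hρeqpos hh0 hDc hLc x).comp
      (by fun_prop : Continuous fun w : EuclideanSpace ℝ (Fin d) => x + σ • w))
    (abs_alphah_sub_le hρeqpos hc hcD hM hh0 hh1 ((hgD x).trans hmono₁) ((hgL x).trans hmono₂)
      (fun y => (hD1 x y).trans (by gcongr)) (fun y => (hD2 x y).trans (by gcongr))
      (fun y => (hL2 x y).trans (by gcongr)) hσ hσ2 hCdef)
  rw [hZint, finrank_euclideanSpace_fin] at key
  rw [integral_mul_qh_smul_sub x (alphah D ρeq h x) hσ hσ2, ha,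
    ← smul_drift_eq (δ := d) hh0 hx hZ hσ2, ← smul_sub, norm_smul,
    Real.norm_of_nonneg (div_nonneg hσ.le hZ.le)]
  have hpow : h ^ ((3 : ℝ) / 2) = h * √h := by
    rw [Real.sqrt_eq_rpow, show (3 : ℝ) / 2 = 1 + 1 / 2 by norm_num, Real.rpow_add hh0,
      Real.rpow_one]
  calc _ ≤ σ / Z * (h * (1000 * C ^ 2 + 20 * C) * (1 + D x) ^ 4 * J) :=
        mul_le_mul_of_nonneg_left key (div_nonneg hσ.le hZ.le)
    _ ≤ 2 * √h * (1 + D x) / Z * (h * (1000 * C ^ 2 + 20 * C) * (1 + D x) ^ 4 * J) := by gcongr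
    _ = G * (1 + D x) ^ 5 * h ^ ((3 : ℝ) / 2) := by rw [hpow, hGdef]; ring
end

section
/- Let d ≥ 1 and suppose D : ℝ^d → ℝ and ln ρ_eq : ℝ^d → ℝ have bounded derivatives up to order 4, ρ_eq > 0, and inf_x D(x) > 0. Then there exists a function K : ℝ^d → ℝ of polynomial growth such that for all x ∈ ℝ^d and all h ∈ (0,1], the d×d matrix ∫_{ℝ^d} (y − x)(y − x)^T α_h(x,y) q_h(x,y) dy satisfies ‖ ∫_{ℝ^d} (y − x)(y − x)^T α_h(x,y) q_h(x,y) dy − 2D(x) h I_d ‖ ≤ K(x) h^{3/2}, where I_d is the d×d identity matrix. -/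
open Real MeasureTheory

lemma abs_min_one_exp_sub_one_le (t : ℝ) : |min 1 (exp t) - 1| ≤ |t| := by
  rcases le_total 0 t with h | h
  · rw [min_eq_left (Real.one_le_exp h)]; simp
  · rw [min_eq_right (Real.exp_le_one_iff.2 h), abs_of_nonpos (by simpa using h), abs_of_nonpos h]
    linarith [Real.add_one_le_exp t]

lemma abs_sub_le_of_norm_iteratedFDeriv_one_le {E : Type*} [NormedAddCommGroup E] [NormedSpace ℝ E]
    {f : E → ℝ} {C : ℝ} (hf : Differentiable ℝ f) (hC : ∀ x, ‖iteratedFDeriv ℝ 1 f x‖ ≤ C)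
    (x y : E) : |f y - f x| ≤ C * ‖y - x‖ := by
  refine Convex.norm_image_sub_le_of_norm_fderiv_le (𝕜 := ℝ) (fun z _ => hf z) (fun z _ => ?_)
    convex_univ (Set.mem_univ x) (Set.mem_univ y)
  rw [← norm_iteratedFDeriv_one]
  exact hC z

lemma abs_log_sub_log_le {c a b : ℝ} (hc : 0 < c) (ha : c ≤ a) (hb : c ≤ b) :
    |log a - log b| ≤ |a - b| / c := by
  have key : ∀ u v : ℝ, c ≤ u → c ≤ v → log u - log v ≤ |u - v| / c := by
    intro u v hu hv
    have hu0 := hc.trans_le hu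
    have hv0 := hc.trans_le hv
    rw [← Real.log_div hu0.ne' hv0.ne']
    calc log (u / v) ≤ u / v - 1 := Real.log_le_sub_one_of_pos (by positivity)
      _ = (u - v) / v := by field_simp
      _ ≤ |u - v| / v := by gcongr; exact le_abs_self _
      _ ≤ |u - v| / c := by gcongr
  refine abs_le.2 ⟨?_, key a b ha hb⟩
  have := key b a hb ha
  rw [abs_sub_comm] at this
  linarith

lemma abs_inv_sub_inv_le {c a b : ℝ} (hc : 0 < c) (ha : c ≤ a) (hb : c ≤ b) :
    |a⁻¹ - b⁻¹| ≤ |a - b| / c ^ 2 := by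
  have ha0 := hc.trans_le ha
  have hb0 := hc.trans_le hb
  rw [inv_sub_inv ha0.ne' hb0.ne', abs_div, abs_sub_comm, abs_of_pos (mul_pos ha0 hb0)]
  gcongr
  nlinarith

lemma integral_mul_exp_neg_sq : ∫ t : ℝ, t * exp (-t ^ 2) = 0 := by
  have h := integral_neg_eq_self (fun t : ℝ => t * exp (-t ^ 2)) volume
  simp only [neg_sq, neg_mul, integral_neg] at h
  linarith

lemma integral_exp_neg_sq : ∫ t : ℝ, exp (-t ^ 2) = √π := by
  simpa using integral_gaussian 1

lemma integral_sq_mul_exp_neg_sq : ∫ t : ℝ, t ^ 2 * exp (-t ^ 2) = √π / 2 := by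
  have h := integral_comp_abs (f := fun t : ℝ => t ^ 2 * exp (-t ^ 2))
  simp only [sq_abs] at h
  have h' := integral_rpow_mul_exp_neg_mul_rpow (p := 2) (q := 2) (b := 1)
    (by norm_num) (by norm_num) (by norm_num)
  simp only [Real.rpow_two, neg_mul, one_mul, Real.one_rpow] at h'
  rw [h, h', show ((2 : ℝ) + 1) / 2 = 1 / 2 + 1 by norm_num, Real.Gamma_add_one (by norm_num),
    Real.Gamma_one_half_eq]
  ring

/-- Second moments of the weight `exp (-‖w‖ ^ 2)`. -/
lemma integral_coord_mul_coord_mul_exp_neg_norm_sq {d : ℕ} (i j : Fin d) :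
    ∫ w : EuclideanSpace ℝ (Fin d), w i * w j * exp (-‖w‖ ^ 2) =
      if i = j then √π ^ d / 2 else 0 := by
  rw [← (PiLp.volume_preserving_toLp (Fin d)).integral_comp
    (MeasurableEquiv.toLp 2 _).measurableEmbedding]
  have hfac : ∀ v : Fin d → ℝ,
      (WithLp.toLp 2 v) i * (WithLp.toLp 2 v) j * exp (-‖WithLp.toLp 2 v‖ ^ 2) =
      ∏ k, ((if k = i then v k else 1) * (if k = j then v k else 1) * exp (-v k ^ 2)) := by
    intro v
    rw [Finset.prod_mul_distrib, Finset.prod_mul_distrib, ← Real.exp_sum,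
      EuclideanSpace.norm_sq_eq]
    simp
  simp_rw [hfac]
  rw [integral_fintype_prod_volume_eq_prod (fun (k : Fin d) (t : ℝ) =>
    (if k = i then t else 1) * (if k = j then t else 1) * exp (-t ^ 2))]
  split_ifs with hij
  · subst hij
    have hk : ∀ k : Fin d,
        ∫ t : ℝ, (if k = i then t else 1) * (if k = i then t else 1) * exp (-t ^ 2) =
        √π * (if k = i then 1 / 2 else 1) := by
      intro k
      split_ifs
      · simp_rw [← sq, integral_sq_mul_exp_neg_sq]
        ring
      · simp [integral_exp_neg_sq]
    simp_rw [hk, Finset.prod_mul_distrib]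
    simp [div_eq_mul_inv]
  · refine Finset.prod_eq_zero (Finset.mem_univ i) ?_
    simp [hij, integral_mul_exp_neg_sq]

lemma integrable_norm_pow_mul_exp_neg_norm_sq {V : Type*} [NormedAddCommGroup V]
    [InnerProductSpace ℝ V] [FiniteDimensional ℝ V] [MeasurableSpace V] [BorelSpace V] (n : ℕ) :
    Integrable (fun w : V => ‖w‖ ^ n * exp (-‖w‖ ^ 2)) := by
  have hexp : Integrable (fun w : V => exp (-(1 / 2) * ‖w‖ ^ 2)) := by
    have h := (GaussianFourier.integrable_cexp_neg_mul_sq_norm_add (b := ((1 / 2 : ℝ) : ℂ))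
      (by simp) 0 (0 : V)).norm
    refine h.congr (Filter.Eventually.of_forall fun w => ?_)
    simp only [Complex.norm_exp]
    congr 1
    simp [← Complex.ofReal_pow]
  refine (hexp.const_mul (n.factorial * exp (1 / 2))).mono' (by fun_prop)
    (Filter.Eventually.of_forall fun w => ?_)
  have hpow : ‖w‖ ^ n ≤ n.factorial * exp ‖w‖ := by
    have := Real.pow_div_factorial_le_exp ‖w‖ (norm_nonneg w) n
    rwa [div_le_iff₀ (by positivity), mul_comm] at this
  rw [Real.norm_of_nonneg (by positivity)]
  calc ‖w‖ ^ n * exp (-‖w‖ ^ 2) ≤ n.factorial * exp ‖w‖ * exp (-‖w‖ ^ 2) := by gcongr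
    _ = n.factorial * exp (‖w‖ - ‖w‖ ^ 2) := by rw [mul_assoc, ← Real.exp_add]; ring_nf
    _ ≤ n.factorial * exp (1 / 2 + -(1 / 2) * ‖w‖ ^ 2) := by
        gcongr
        nlinarith [sq_nonneg (‖w‖ - 1)]
    _ = _ := by rw [Real.exp_add]; ring

lemma integral_eq_pow_mul_integral_add_smul {d : ℕ} (F : EuclideanSpace ℝ (Fin d) → ℝ)
    (x : EuclideanSpace ℝ (Fin d)) {s : ℝ} (hs : 0 < s) :
    ∫ y, F y = s ^ d * ∫ w, F (x + s • w) := by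
  rw [Measure.integral_comp_smul volume (fun z => F (x + z)) s, integral_add_left_eq_self,
    finrank_euclideanSpace_fin, abs_of_pos (by positivity), smul_eq_mul]
  field_simp

lemma qh_add_smul {d : ℕ} (D : EuclideanSpace ℝ (Fin d) → ℝ) {h s : ℝ}
    (x w : EuclideanSpace ℝ (Fin d)) (hs : 0 < s) (hsq : s ^ 2 = 4 * h * D x) :
    qh D h x (x + s • w) = (√π ^ d)⁻¹ * (s ^ d)⁻¹ * exp (-‖w‖ ^ 2) := by
  have hpi : 4 * π * h * D x = (√π * s) ^ (2 : ℝ) := by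
    rw [Real.rpow_two, mul_pow, Real.sq_sqrt pi_pos.le, hsq]; ring
  rw [qh, hpi, ← hsq, ← Real.rpow_mul (by positivity),
    show (2 : ℝ) * (-(d : ℝ) / 2) = -(d : ℝ) by ring, Real.rpow_neg (by positivity),
    Real.rpow_natCast, mul_pow, mul_inv, add_sub_cancel_left, norm_smul, Real.norm_of_nonneg hs.le]
  congr 2
  field_simp

lemma alphah_eq_min_exp {d : ℕ} {D ρeq : EuclideanSpace ℝ (Fin d) → ℝ} (hD : ∀ x, 0 < D x)
    (hρ : ∀ x, 0 < ρeq x) {h : ℝ} (hh : 0 < h) (x y : EuclideanSpace ℝ (Fin d)) :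
    alphah D ρeq h x y = min 1 (exp ((d : ℝ) / 2 * (log (D x) - log (D y)) +
      ‖y - x‖ ^ 2 / (4 * h) * ((D x)⁻¹ - (D y)⁻¹) + (log (ρeq y) - log (ρeq x)))) := by
  have hq : ∀ u v, qh D h u v =
      exp ((log (4 * π * h) + log (D u)) * (-(d : ℝ) / 2) - ‖v - u‖ ^ 2 / (4 * h) * (D u)⁻¹) := by
    intro u v
    have hu := hD u
    rw [qh, Real.rpow_def_of_pos (by positivity), ← Real.exp_add,
      Real.log_mul (by positivity) hu.ne']
    congr 1
    field_simp
    ring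
  rw [alphah, hq, hq, norm_sub_rev x y]
  nth_rewrite 1 [← Real.exp_log (hρ y)]
  nth_rewrite 1 [← Real.exp_log (hρ x)]
  rw [← Real.exp_add, ← Real.exp_add, ← Real.exp_sub]
  congr 2
  ring

lemma abs_alphah_sub_one_le {d : ℕ} {D ρeq : EuclideanSpace ℝ (Fin d) → ℝ} {c A B : ℝ}
    (hc : 0 < c) (hD : ∀ x, c ≤ D x) (hρ : ∀ x, 0 < ρeq x)
    (hA : ∀ x y, |D y - D x| ≤ A * ‖y - x‖)
    (hB : ∀ x y, |log (ρeq y) - log (ρeq x)| ≤ B * ‖y - x‖)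
    {h : ℝ} (hh : 0 < h) (x y : EuclideanSpace ℝ (Fin d)) :
    |alphah D ρeq h x y - 1| ≤
      (d / 2 * (A / c) + B) * ‖y - x‖ + A / (4 * c ^ 2) / h * ‖y - x‖ ^ 3 := by
  rw [alphah_eq_min_exp (fun x => hc.trans_le (hD x)) hρ hh]
  refine (abs_min_one_exp_sub_one_le _).trans ((abs_add_three _ _ _).trans ?_)
  have hA' : |D x - D y| ≤ A * ‖y - x‖ := by rw [abs_sub_comm]; exact hA x y
  have h1 : |(d : ℝ) / 2 * (log (D x) - log (D y))| ≤ d / 2 * (A * ‖y - x‖ / c) := by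
    rw [abs_mul, abs_of_nonneg (by positivity)]
    gcongr
    exact (abs_log_sub_log_le hc (hD x) (hD y)).trans (by gcongr)
  have h2 : |‖y - x‖ ^ 2 / (4 * h) * ((D x)⁻¹ - (D y)⁻¹)| ≤
      ‖y - x‖ ^ 2 / (4 * h) * (A * ‖y - x‖ / c ^ 2) := by
    rw [abs_mul, abs_of_nonneg (by positivity)]
    gcongr
    exact (abs_inv_sub_inv_le hc (hD x) (hD y)).trans (by gcongr)
  refine (add_le_add_three h1 h2 (hB x y)).trans (le_of_eq ?_)
  field_simp
  ring

lemma abs_integral_weighted_coord_mul_coord_sub_le {d : ℕ} {a : EuclideanSpace ℝ (Fin d) → ℝ}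
    {P Q : ℝ} (ha : Measurable a) (hle : ∀ w, |a w - 1| ≤ P * ‖w‖ + Q * ‖w‖ ^ 3) (i j : Fin d) :
    |(∫ w, a w * (w i * w j * exp (-‖w‖ ^ 2))) - ∫ w : EuclideanSpace ℝ (Fin d),
        w i * w j * exp (-‖w‖ ^ 2)| ≤
      P * (∫ w : EuclideanSpace ℝ (Fin d), ‖w‖ ^ 3 * exp (-‖w‖ ^ 2)) +
        Q * ∫ w : EuclideanSpace ℝ (Fin d), ‖w‖ ^ 5 * exp (-‖w‖ ^ 2) := by
  have hcoord : ∀ w : EuclideanSpace ℝ (Fin d),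
      |w i * w j * exp (-‖w‖ ^ 2)| ≤ ‖w‖ ^ 2 * exp (-‖w‖ ^ 2) := by
    intro w
    rw [abs_mul, abs_mul, Real.abs_exp, sq]
    gcongr
    · exact PiLp.norm_apply_le w i
    · exact PiLp.norm_apply_le w j
  have hg : Integrable (fun w : EuclideanSpace ℝ (Fin d) => w i * w j * exp (-‖w‖ ^ 2)) :=
    (integrable_norm_pow_mul_exp_neg_norm_sq 2).mono' (by fun_prop)
      (Filter.Eventually.of_forall hcoord)
  have hbound : Integrable (fun w : EuclideanSpace ℝ (Fin d) =>
      P * (‖w‖ ^ 3 * exp (-‖w‖ ^ 2)) + Q * (‖w‖ ^ 5 * exp (-‖w‖ ^ 2))) :=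
    ((integrable_norm_pow_mul_exp_neg_norm_sq 3).const_mul P).add
      ((integrable_norm_pow_mul_exp_neg_norm_sq 5).const_mul Q)
  have hdom : ∀ w : EuclideanSpace ℝ (Fin d), ‖(a w - 1) * (w i * w j * exp (-‖w‖ ^ 2))‖ ≤
      P * (‖w‖ ^ 3 * exp (-‖w‖ ^ 2)) + Q * (‖w‖ ^ 5 * exp (-‖w‖ ^ 2)) := by
    intro w
    rw [norm_mul, Real.norm_eq_abs, Real.norm_eq_abs]
    refine (mul_le_mul (hle w) (hcoord w) (abs_nonneg _)
      ((abs_nonneg _).trans (hle w))).trans (le_of_eq ?_)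
    ring
  have hdiff : Integrable (fun w : EuclideanSpace ℝ (Fin d) =>
      (a w - 1) * (w i * w j * exp (-‖w‖ ^ 2))) :=
    hbound.mono' (by fun_prop) (Filter.Eventually.of_forall hdom)
  have hag : Integrable (fun w : EuclideanSpace ℝ (Fin d) =>
      a w * (w i * w j * exp (-‖w‖ ^ 2))) :=
    (hdiff.add hg).congr (Filter.Eventually.of_forall fun w => by simp only [Pi.add_apply]; ring)
  rw [← integral_sub hag hg, ← integral_const_mul, ← integral_const_mul, ← integral_add
    ((integrable_norm_pow_mul_exp_neg_norm_sq 3).const_mul P)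
    ((integrable_norm_pow_mul_exp_neg_norm_sq 5).const_mul Q), ← Real.norm_eq_abs]
  refine norm_integral_le_of_norm_le hbound (Filter.Eventually.of_forall fun w => ?_)
  rw [← sub_one_mul]
  exact hdom w

lemma measurable_alphah {d : ℕ} {D ρeq : EuclideanSpace ℝ (Fin d) → ℝ} (hD : Measurable D)
    (hρ : Measurable ρeq) (h : ℝ) (x : EuclideanSpace ℝ (Fin d)) :
    Measurable (alphah D ρeq h x) := by
  unfold alphah qh
  fun_prop

lemma integral_alphah_mul_qh_mul_increment {d : ℕ} (D ρeq : EuclideanSpace ℝ (Fin d) → ℝ)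
    {h s : ℝ} (x : EuclideanSpace ℝ (Fin d)) (hs : 0 < s) (hsq : s ^ 2 = 4 * h * D x)
    (i j : Fin d) :
    ∫ y, alphah D ρeq h x y * qh D h x y * ((y i - x i) * (y j - x j)) =
      (√π ^ d)⁻¹ * s ^ 2 *
        ∫ w, alphah D ρeq h x (x + s • w) * (w i * w j * exp (-‖w‖ ^ 2)) := by
  rw [integral_eq_pow_mul_integral_add_smul _ x hs, ← integral_const_mul, ← integral_const_mul]
  refine integral_congr_ae (Filter.Eventually.of_forall fun w => ?_)
  simp only [qh_add_smul D x w hs hsq, PiLp.add_apply, PiLp.smul_apply, add_sub_cancel_left,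
    smul_eq_mul]
  field_simp

lemma sqrt_pow_three_mul_add_le {p q t G : ℝ} (hp : 0 ≤ p) (hq : 0 ≤ q) (hG : 1 ≤ G)
    (ht : 0 ≤ t) (htG : t ≤ G) : √t ^ 3 * (p + 4 * q * t) ≤ (p + 4 * q) * G ^ 3 := by
  have hsG : √t ^ 3 ≤ G ^ 2 := by
    calc √t ^ 3 ≤ √G ^ 3 := by gcongr
      _ ≤ √G ^ 4 := pow_le_pow_right₀ (Real.one_le_sqrt.2 hG) (by norm_num)
      _ = (√G ^ 2) ^ 2 := by ring
      _ = G ^ 2 := by rw [Real.sq_sqrt (by linarith)]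
  calc √t ^ 3 * (p + 4 * q * t) ≤ G ^ 2 * (p * G + 4 * q * G) := by
        gcongr
        exact le_mul_of_one_le_right hp hG
    _ = _ := by ring

lemma abs_integral_increment_sub_le {d : ℕ} {D ρeq : EuclideanSpace ℝ (Fin d) → ℝ} {h P Q : ℝ}
    {x : EuclideanSpace ℝ (Fin d)} (hh : 0 < h) (hDx : 0 < D x)
    (hmeas : Measurable (alphah D ρeq h x))
    (hα : ∀ y, |alphah D ρeq h x y - 1| ≤ P * ‖y - x‖ + Q / h * ‖y - x‖ ^ 3) (i j : Fin d) :
    |(∫ y, alphah D ρeq h x y * qh D h x y * ((y i - x i) * (y j - x j)))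
        - (if i = j then 2 * D x * h else 0)| ≤
      (√π ^ d)⁻¹ * 8 * √h ^ 3 * (√(D x) ^ 3 *
        (P * (∫ w : EuclideanSpace ℝ (Fin d), ‖w‖ ^ 3 * exp (-‖w‖ ^ 2)) +
          4 * (Q * ∫ w : EuclideanSpace ℝ (Fin d), ‖w‖ ^ 5 * exp (-‖w‖ ^ 2)) * D x)) := by
  obtain ⟨s, hs⟩ : ∃ s, s = 2 * √h * √(D x) := ⟨_, rfl⟩
  have hs0 : 0 < s := by rw [hs]; positivity
  have hsq : s ^ 2 = 4 * h * D x := by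
    rw [hs, mul_pow, mul_pow, Real.sq_sqrt hh.le, Real.sq_sqrt hDx.le]
    ring
  have hmain : (if i = j then 2 * D x * h else 0) = (√π ^ d)⁻¹ * s ^ 2 *
      ∫ w : EuclideanSpace ℝ (Fin d), w i * w j * exp (-‖w‖ ^ 2) := by
    rw [integral_coord_mul_coord_mul_exp_neg_norm_sq, hsq]
    split_ifs
    · field_simp
      ring
    · simp
  have hscaled : ∀ w, |alphah D ρeq h x (x + s • w) - 1| ≤
      P * s * ‖w‖ + 4 * Q * D x * s * ‖w‖ ^ 3 := by
    intro w
    refine (hα (x + s • w)).trans (le_of_eq ?_)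
    rw [add_sub_cancel_left, norm_smul, Real.norm_of_nonneg hs0.le,
      show Q / h * (s * ‖w‖) ^ 3 = Q / h * s ^ 2 * s * ‖w‖ ^ 3 by ring, hsq]
    field_simp
  have hint := abs_integral_weighted_coord_mul_coord_sub_le
    (hmeas.comp (by fun_prop : Measurable fun w => x + s • w)) hscaled i j
  rw [integral_alphah_mul_qh_mul_increment D ρeq x hs0 hsq, hmain, ← mul_sub, abs_mul,
    abs_of_pos (by positivity)]
  refine (mul_le_mul_of_nonneg_left hint (by positivity)).trans (le_of_eq ?_)
  rw [hs]
  ring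

lemma one_add_pow_three_le {r : ℝ} (hr : 0 ≤ r) : (1 + r) ^ 3 ≤ 4 * (1 + r ^ 3) := by
  nlinarith [mul_nonneg (add_nonneg zero_le_one hr) (sq_nonneg (1 - r))]

/-- the expected outer product of the one-step increment of the
Metropolized scheme matches `2D(x) h I_d` to order `h^{3/2}` (entrywise, i.e.
in the max-entry matrix norm), with a constant of polynomial growth in `x`. -/
theorem expected_increment_diffusion {d : ℕ} (hd : 1 ≤ d)
    (D ρeq : EuclideanSpace ℝ (Fin d) → ℝ)
    (hρeqpos : ∀ x, 0 < ρeq x)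
    (hDsmooth : ContDiff ℝ 4 D)
    (hLsmooth : ContDiff ℝ 4 (fun x => Real.log (ρeq x)))
    (hDbd : ∀ i : ℕ, 1 ≤ i → i ≤ 4 → ∃ C : ℝ, ∀ x, ‖iteratedFDeriv ℝ i D x‖ ≤ C)
    (hLbd : ∀ i : ℕ, 1 ≤ i → i ≤ 4 →
      ∃ C : ℝ, ∀ x, ‖iteratedFDeriv ℝ i (fun y => Real.log (ρeq y)) x‖ ≤ C)
    (hDinf : ∃ c : ℝ, 0 < c ∧ ∀ x, c ≤ D x) :
    ∃ (K : EuclideanSpace ℝ (Fin d) → ℝ) (C : ℝ) (m : ℕ),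
      (∀ x, |K x| ≤ C * (1 + ‖x‖ ^ m)) ∧
      ∀ x, ∀ h ∈ Set.Ioc (0 : ℝ) 1, ∀ i j : Fin d,
        |(∫ y, alphah D ρeq h x y * qh D h x y * ((y i - x i) * (y j - x j)))
            - (if i = j then 2 * D x * h else 0)|
          ≤ K x * h ^ ((3 : ℝ) / 2) := by
  obtain ⟨c, hc, hDc⟩ := hDinf
  obtain ⟨A, hA⟩ := hDbd 1 le_rfl (by norm_num)
  obtain ⟨B, hB⟩ := hLbd 1 le_rfl (by norm_num)
  have hA0 : 0 ≤ A := (norm_nonneg _).trans (hA 0)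
  have hB0 : 0 ≤ B := (norm_nonneg _).trans (hB 0)
  have hDlip := abs_sub_le_of_norm_iteratedFDeriv_one_le (hDsmooth.differentiable (by norm_num)) hA
  have hLlip := abs_sub_le_of_norm_iteratedFDeriv_one_le (hLsmooth.differentiable (by norm_num)) hB
  have hρmeas : Measurable ρeq := by
    have : ρeq = fun x => exp (log (ρeq x)) := funext fun x => (Real.exp_log (hρeqpos x)).symm
    rw [this]
    exact Real.measurable_exp.comp hLsmooth.continuous.measurable
  obtain ⟨p, hp⟩ : ∃ p, p = (d / 2 * (A / c) + B) *
    ∫ w : EuclideanSpace ℝ (Fin d), ‖w‖ ^ 3 * exp (-‖w‖ ^ 2) := ⟨_, rfl⟩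
  obtain ⟨q, hq⟩ : ∃ q, q = A / (4 * c ^ 2) *
    ∫ w : EuclideanSpace ℝ (Fin d), ‖w‖ ^ 5 * exp (-‖w‖ ^ 2) := ⟨_, rfl⟩
  have hp0 : 0 ≤ p := hp ▸ mul_nonneg (by positivity) (integral_nonneg fun w => by positivity)
  have hq0 : 0 ≤ q := hq ▸ mul_nonneg (by positivity) (integral_nonneg fun w => by positivity)
  obtain ⟨E, hE⟩ : ∃ E, E = 1 + D 0 + A := ⟨_, rfl⟩
  have hD0 := hc.trans_le (hDc 0)
  have hE1 : 1 ≤ E := by linarith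
  have hDle : ∀ x, D x ≤ E * (1 + ‖x‖) := by
    intro x
    have h1 := (le_abs_self _).trans (hDlip 0 x)
    rw [sub_zero] at h1
    nlinarith [norm_nonneg x]
  obtain ⟨R, hR⟩ : ∃ R, R = (√π ^ d)⁻¹ * 8 * (p + 4 * q) * E ^ 3 := ⟨_, rfl⟩
  have hR0 : 0 ≤ R := by rw [hR]; positivity
  refine ⟨fun x => R * (1 + ‖x‖) ^ 3, 4 * R, 3, fun x => ?_, fun x h hh i j => ?_⟩
  · rw [abs_of_nonneg (by positivity)]
    calc R * (1 + ‖x‖) ^ 3 ≤ R * (4 * (1 + ‖x‖ ^ 3)) :=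
          mul_le_mul_of_nonneg_left (one_add_pow_three_le (norm_nonneg x)) hR0
      _ = 4 * R * (1 + ‖x‖ ^ 3) := by ring
  have hh0 : 0 < h := hh.1
  have hDx : 0 < D x := hc.trans_le (hDc x)
  have hhpow : h ^ ((3 : ℝ) / 2) = √h ^ 3 := by
    rw [Real.sqrt_eq_rpow, ← Real.rpow_natCast, ← Real.rpow_mul hh0.le]
    norm_num
  have hroot := sqrt_pow_three_mul_add_le hp0 hq0
    (one_le_mul_of_one_le_of_one_le hE1 (le_add_of_nonneg_right (norm_nonneg x))) hDx.le (hDle x)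
  have hint := abs_integral_increment_sub_le hh0 hDx
    (measurable_alphah hDsmooth.continuous.measurable hρmeas h x)
    (abs_alphah_sub_one_le hc hDc hρeqpos hDlip hLlip hh0 x) i j
  rw [← hp, ← hq] at hint
  rw [hhpow]
  refine hint.trans ((mul_le_mul_of_nonneg_left hroot (by positivity)).trans (le_of_eq ?_))
  rw [hR]
  ring
end

section
/- Let d ≥ 1 and suppose D : ℝ^d → ℝ and ln ρ_eq : ℝ^d → ℝ have bounded derivatives up to order 4, ρ_eq > 0, and inf_x D(x) > 0. Let g : ℝ^d → ℝ be a polynomial. Then there exists a function K : ℝ^d → ℝ of polynomial growth such that for all x ∈ ℝ^d and all ε ∈ (0,1], | ∫_{ℝ^d} g(z) ( α(x,z,ε) − β(x,z,ε) ) q(x,z) dz | ≤ K(x) ε². -/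
open Real MeasureTheory
open scoped RealInnerProductSpace

/-- Rescaled trial density `q(x,z) = (4πD(x))^{-d/2} exp(−|z|²/(4D(x)))`. -/
noncomputable def qscaled {d : ℕ} (D : EuclideanSpace ℝ (Fin d) → ℝ)
    (x z : EuclideanSpace ℝ (Fin d)) : ℝ :=
  (4 * π * D x) ^ (-(d : ℝ) / 2) * Real.exp (-‖z‖ ^ 2 / (4 * D x))

/-- Rescaled Metropolis–Hastings acceptance probability
`α(x,z,ε) = min(1, q(x+εz,z)ρ_eq(x+εz)/(q(x,z)ρ_eq(x)))`. -/
noncomputable def alphaScaled {d : ℕ} (D ρeq : EuclideanSpace ℝ (Fin d) → ℝ)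
    (x z : EuclideanSpace ℝ (Fin d)) (ε : ℝ) : ℝ :=
  min 1 (qscaled D (x + ε • z) z * ρeq (x + ε • z) / (qscaled D x z * ρeq x))

/-- First-order approximation
`β(x,z,ε) = min(1, exp(ε ∇_x q(x,z)·z/q(x,z) + ε ∇ρ_eq(x)·z/ρ_eq(x)))`. -/
noncomputable def betaScaled {d : ℕ} (D ρeq : EuclideanSpace ℝ (Fin d) → ℝ)
    (x z : EuclideanSpace ℝ (Fin d)) (ε : ℝ) : ℝ :=
  min 1 (Real.exp (ε * (⟪gradient (fun w => qscaled D w z) x, z⟫ / qscaled D x z)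
    + ε * (⟪gradient ρeq x, z⟫ / ρeq x)))

theorem abs_min_one_exp_sub_le_s9 (a b : ℝ) :
    |min 1 (Real.exp a) - min 1 (Real.exp b)| ≤ |a - b| := by
  wlog hab : a ≤ b generalizing a b
  · rw [abs_sub_comm, abs_sub_comm a b]
    exact this b a (le_of_not_ge hab)
  have hmono : min 1 (Real.exp a) ≤ min 1 (Real.exp b) :=
    min_le_min le_rfl (Real.exp_le_exp.2 hab)
  rw [abs_sub_comm, abs_sub_comm a b, abs_of_nonneg (sub_nonneg.2 hmono),
    abs_of_nonneg (sub_nonneg.2 hab)]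
  rcases le_total 0 a with ha | ha
  · have h1 : min 1 (Real.exp a) = 1 := min_eq_left (Real.one_le_exp ha)
    have h2 : min 1 (Real.exp b) ≤ 1 := min_le_left _ _
    linarith
  · have h1 : min 1 (Real.exp a) = Real.exp a := min_eq_right (Real.exp_le_one_iff.2 ha)
    rw [h1]
    have h2 : Real.exp a = Real.exp (a - b) * Real.exp b := by
      rw [← Real.exp_add, sub_add_cancel]
    have h3 : a - b + 1 ≤ Real.exp (a - b) := Real.add_one_le_exp _
    have h4 : Real.exp (a - b) ≤ 1 := Real.exp_le_one_iff.2 (by linarith)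
    set m := min 1 (Real.exp b)
    have hm1 : m ≤ 1 := min_le_left _ _
    have hm2 : m ≤ Real.exp b := min_le_right _ _
    have hm0 : 0 ≤ m := le_min zero_le_one (Real.exp_pos b).le
    have h5 : Real.exp (a - b) * m ≤ Real.exp a := by
      rw [h2]; exact mul_le_mul_of_nonneg_left hm2 (Real.exp_pos _).le
    nlinarith

theorem abs_taylor_one_remainder_le {f f' f'' : ℝ → ℝ} {M : ℝ}
    (hf : ∀ t, HasDerivAt f (f' t) t) (hf' : ∀ t, HasDerivAt f' (f'' t) t)
    (hM : ∀ t, |f'' t| ≤ M) {ε : ℝ} (hε : 0 ≤ ε) :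
    |f ε - f 0 - ε * f' 0| ≤ M * ε ^ 2 := by
  have hM0 : 0 ≤ M := (abs_nonneg _).trans (hM 0)
  have h1 : ∀ t ∈ Set.Icc 0 ε, ‖f' t - f' 0‖ ≤ M * ε := fun t ht => by
    refine ((convex_univ.norm_image_sub_le_of_norm_hasDerivWithin_le
      (fun s _ => (hf' s).hasDerivWithinAt) (fun s _ => hM s) (Set.mem_univ 0)
      (Set.mem_univ t))).trans ?_
    rw [sub_zero, Real.norm_of_nonneg ht.1]
    exact mul_le_mul_of_nonneg_left ht.2 hM0
  have h2 := (convex_Icc 0 ε).norm_image_sub_le_of_norm_hasDerivWithin_le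
    (f := fun t => f t - t * f' 0) (f' := fun t => f' t - f' 0)
    (fun t _ => by
      simpa using ((hf t).fun_sub ((hasDerivAt_id t).mul_const (f' 0))).hasDerivWithinAt)
    h1 (Set.left_mem_Icc.2 hε) (Set.right_mem_Icc.2 hε)
  rw [sub_zero, Real.norm_of_nonneg hε, Real.norm_eq_abs] at h2
  calc |f ε - f 0 - ε * f' 0| = |f ε - ε * f' 0 - (f 0 - 0 * f' 0)| := by congr 1; ring
    _ ≤ M * ε * ε := h2
    _ = M * ε ^ 2 := by ring

theorem exists_abs_eval_le_one_add_norm_pow {d : ℕ} (g : MvPolynomial (Fin d) ℝ) :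
    ∃ (C : ℝ) (m : ℕ), 0 ≤ C ∧ ∀ z : EuclideanSpace ℝ (Fin d),
      |MvPolynomial.eval (fun i => z i) g| ≤ C * (1 + ‖z‖) ^ m := by
  induction g using MvPolynomial.induction_on with
  | C a => exact ⟨|a|, 0, abs_nonneg a, fun z => by simp⟩
  | add p q hp hq =>
    obtain ⟨C₁, m₁, hC₁, h₁⟩ := hp
    obtain ⟨C₂, m₂, hC₂, h₂⟩ := hq
    refine ⟨C₁ + C₂, m₁ + m₂, by positivity, fun z => ?_⟩
    have hz : 1 ≤ 1 + ‖z‖ := by linarith [norm_nonneg z]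
    rw [map_add, add_mul]
    refine (abs_add_le _ _).trans (add_le_add ((h₁ z).trans ?_) ((h₂ z).trans ?_))
    · exact mul_le_mul_of_nonneg_left (pow_le_pow_right₀ hz (by omega)) hC₁
    · exact mul_le_mul_of_nonneg_left (pow_le_pow_right₀ hz (by omega)) hC₂
  | mul_X p i hp =>
    obtain ⟨C, m, hC, h⟩ := hp
    refine ⟨C, m + 1, hC, fun z => ?_⟩
    have hi : |z i| ≤ 1 + ‖z‖ := by
      have := PiLp.norm_apply_le z i
      rw [Real.norm_eq_abs] at this
      linarith
    rw [map_mul, MvPolynomial.eval_X, abs_mul, pow_succ, ← mul_assoc]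
    exact mul_le_mul (h z) hi (abs_nonneg _) (by positivity)

section Line

variable {E : Type*} [NormedAddCommGroup E] [NormedSpace ℝ E]

theorem hasDerivAt_comp_add_smul {F : Type*} [NormedAddCommGroup F] [NormedSpace ℝ F]
    {f : E → F} {x z : E} {t : ℝ} (hf : DifferentiableAt ℝ f (x + t • z)) :
    HasDerivAt (fun s : ℝ => f (x + s • z)) (fderiv ℝ f (x + t • z) z) t := by
  have h : HasDerivAt (fun s : ℝ => x + s • z) z t := by
    simpa using ((hasDerivAt_id t).smul_const z).const_add x
  exact hf.hasFDerivAt.comp_hasDerivAt t h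

theorem hasDerivAt_fderiv_comp_add_smul {f : E → ℝ} (hf : ContDiff ℝ 2 f) (x z : E) (t : ℝ) :
    HasDerivAt (fun s : ℝ => fderiv ℝ f (x + s • z) z)
      (fderiv ℝ (fderiv ℝ f) (x + t • z) z z) t := by
  have h : DifferentiableAt ℝ (fderiv ℝ f) (x + t • z) :=
    (hf.fderiv_right (m := 1) (by norm_num)).differentiable (by norm_num) _
  simpa using (hasDerivAt_comp_add_smul h).clm_apply (hasDerivAt_const t z)

theorem abs_fderiv_apply_le {f : E → ℝ} {C : ℝ} {x : E}
    (h : ‖iteratedFDeriv ℝ 1 f x‖ ≤ C) (z : E) : |fderiv ℝ f x z| ≤ C * ‖z‖ := by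
  rw [norm_iteratedFDeriv_one] at h
  exact (fderiv ℝ f x).le_of_opNorm_le h z

theorem abs_fderiv_fderiv_apply_le {f : E → ℝ} {C : ℝ} {x : E}
    (h : ‖iteratedFDeriv ℝ 2 f x‖ ≤ C) (z : E) :
    |fderiv ℝ (fderiv ℝ f) x z z| ≤ C * ‖z‖ ^ 2 := by
  rw [← norm_iteratedFDeriv_fderiv (n := 1), norm_iteratedFDeriv_one] at h
  calc |fderiv ℝ (fderiv ℝ f) x z z| ≤ ‖fderiv ℝ (fderiv ℝ f) x‖ * ‖z‖ * ‖z‖ :=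
        (fderiv ℝ (fderiv ℝ f) x).le_opNorm₂ z z
    _ ≤ C * ‖z‖ * ‖z‖ := by gcongr
    _ = C * ‖z‖ ^ 2 := by ring

end Line

section Scaled

variable {d : ℕ} {D ρeq : EuclideanSpace ℝ (Fin d) → ℝ}

theorem qscaled_pos {x : EuclideanSpace ℝ (Fin d)} (hD : 0 < D x)
    (z : EuclideanSpace ℝ (Fin d)) : 0 < qscaled D x z :=
  mul_pos (Real.rpow_pos_of_pos (by positivity) _) (Real.exp_pos _)

theorem log_qscaled {x : EuclideanSpace ℝ (Fin d)} (hD : 0 < D x)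
    (z : EuclideanSpace ℝ (Fin d)) :
    Real.log (qscaled D x z)
      = -(d : ℝ) / 2 * (Real.log (4 * π) + Real.log (D x)) - ‖z‖ ^ 2 / 4 * (D x)⁻¹ := by
  have h4 : (0 : ℝ) < 4 * π := by positivity
  rw [qscaled, Real.log_mul (Real.rpow_pos_of_pos (by positivity) _).ne' (Real.exp_pos _).ne',
    Real.log_rpow (by positivity), Real.log_exp, Real.log_mul h4.ne' hD.ne']
  field_simp
  ring

theorem alphaScaled_eq (hD : ∀ x, 0 < D x) (hρ : ∀ x, 0 < ρeq x)
    (x z : EuclideanSpace ℝ (Fin d)) (ε : ℝ) :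
    alphaScaled D ρeq x z ε = min 1 (Real.exp
      ((Real.log (qscaled D (x + ε • z) z) + Real.log (ρeq (x + ε • z)))
        - (Real.log (qscaled D x z) + Real.log (ρeq x)))) := by
  rw [alphaScaled, Real.exp_sub, Real.exp_add, Real.exp_add,
    Real.exp_log (qscaled_pos (hD _) z), Real.exp_log (qscaled_pos (hD _) z),
    Real.exp_log (hρ _), Real.exp_log (hρ _)]

theorem differentiable_qscaled (hD : ∀ x, 0 < D x) (hDd : Differentiable ℝ D)
    (z : EuclideanSpace ℝ (Fin d)) : Differentiable ℝ (fun w => qscaled D w z) := by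
  intro w
  have h1 : 4 * π * D w ≠ 0 := by have := hD w; positivity
  have h2 : 4 * D w ≠ 0 := by have := hD w; positivity
  unfold qscaled
  have h3 : DifferentiableAt ℝ (fun w => -‖z‖ ^ 2 / (4 * D w)) w := by
    simpa only [div_eq_mul_inv] using (((hDd w).const_mul 4).fun_inv h2).const_mul (-‖z‖ ^ 2)
  exact (((hDd w).const_mul (4 * π)).rpow_const (Or.inl h1)).mul h3.exp

theorem betaScaled_eq (hD : ∀ x, 0 < D x) (hρ : ∀ x, 0 < ρeq x) (hDd : Differentiable ℝ D)
    (hL : Differentiable ℝ (fun x => Real.log (ρeq x)))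
    (x z : EuclideanSpace ℝ (Fin d)) (ε : ℝ) :
    betaScaled D ρeq x z ε = min 1 (Real.exp
      (ε * (fderiv ℝ (fun w => Real.log (qscaled D w z)) x z
        + fderiv ℝ (fun w => Real.log (ρeq w)) x z))) := by
  have hρd : DifferentiableAt ℝ ρeq x := by
    have : ρeq = fun y => Real.exp (Real.log (ρeq y)) :=
      funext fun y => (Real.exp_log (hρ y)).symm
    rw [this]
    exact (hL x).exp
  rw [betaScaled, inner_gradient_left, inner_gradient_left,
    fderiv.log (differentiable_qscaled hD hDd z x) (qscaled_pos (hD x) z).ne',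
    fderiv.log hρd (hρ x).ne']
  simp only [smul_apply, smul_eq_mul]
  congr 2
  ring

theorem abs_log_inv_second_deriv_le {u u' u'' c A B r k : ℝ} (hc : 0 < c) (hu : c ≤ u)
    (hk : 0 ≤ k) (hB0 : 0 ≤ B) (hr : 0 ≤ r) (hA : |u'| ≤ A * r) (hB : |u''| ≤ B * r ^ 2) :
    |-k * (u'' / u - u' ^ 2 / u ^ 2) + r ^ 2 / 4 * (u'' / u ^ 2 - 2 * u' ^ 2 / u ^ 3)|
      ≤ (k * (B / c + A ^ 2 / c ^ 2) + 1 / 4 * (B / c ^ 2 + 2 * A ^ 2 / c ^ 3))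
        * (1 + r) ^ 4 := by
  have hu0 : 0 < u := hc.trans_le hu
  have hA2 : u' ^ 2 ≤ A ^ 2 * r ^ 2 := by
    rw [← sq_abs, ← mul_pow]; gcongr
  have hr2 : r ^ 2 ≤ (1 + r) ^ 4 := by nlinarith [sq_nonneg r, pow_nonneg hr 3, pow_nonneg hr 4]
  have hr4 : r ^ 4 ≤ (1 + r) ^ 4 := by gcongr; linarith
  have e1 : |u'' / u| ≤ B * r ^ 2 / c := by
    rw [abs_div, abs_of_pos hu0]; exact div_le_div₀ (by positivity) hB hc hu
  have e2 : |u' ^ 2 / u ^ 2| ≤ A ^ 2 * r ^ 2 / c ^ 2 := by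
    rw [abs_of_nonneg (by positivity)]
    exact div_le_div₀ (by positivity) hA2 (by positivity) (by gcongr)
  have e3 : |u'' / u ^ 2| ≤ B * r ^ 2 / c ^ 2 := by
    rw [abs_div, abs_of_pos (pow_pos hu0 2)]
    exact div_le_div₀ (by positivity) hB (by positivity) (by gcongr)
  have e4 : |2 * u' ^ 2 / u ^ 3| ≤ 2 * (A ^ 2 * r ^ 2) / c ^ 3 := by
    rw [abs_of_nonneg (by positivity)]
    exact div_le_div₀ (by positivity) (by linarith) (by positivity) (by gcongr)
  have f1 : |u'' / u - u' ^ 2 / u ^ 2| ≤ (B / c + A ^ 2 / c ^ 2) * r ^ 2 :=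
    ((abs_sub _ _).trans (add_le_add e1 e2)).trans_eq (by ring)
  have f2 : |u'' / u ^ 2 - 2 * u' ^ 2 / u ^ 3| ≤ (B / c ^ 2 + 2 * A ^ 2 / c ^ 3) * r ^ 2 :=
    ((abs_sub _ _).trans (add_le_add e3 e4)).trans_eq (by ring)
  calc _ ≤ k * |u'' / u - u' ^ 2 / u ^ 2|
        + r ^ 2 / 4 * |u'' / u ^ 2 - 2 * u' ^ 2 / u ^ 3| := by
        refine (abs_add_le _ _).trans_eq ?_
        rw [abs_mul, abs_mul, abs_neg, abs_of_nonneg hk,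
          abs_of_nonneg (by positivity : 0 ≤ r ^ 2 / 4)]
    _ ≤ k * ((B / c + A ^ 2 / c ^ 2) * r ^ 2)
        + r ^ 2 / 4 * ((B / c ^ 2 + 2 * A ^ 2 / c ^ 3) * r ^ 2) := by gcongr
    _ = k * (B / c + A ^ 2 / c ^ 2) * r ^ 2
        + 1 / 4 * (B / c ^ 2 + 2 * A ^ 2 / c ^ 3) * r ^ 4 := by ring
    _ ≤ k * (B / c + A ^ 2 / c ^ 2) * (1 + r) ^ 4
        + 1 / 4 * (B / c ^ 2 + 2 * A ^ 2 / c ^ 3) * (1 + r) ^ 4 := by gcongr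
    _ = _ := by ring

theorem exists_abs_alphaScaled_sub_betaScaled_le {c A B M : ℝ} (hc : 0 < c)
    (hDc : ∀ x, c ≤ D x) (hρ : ∀ x, 0 < ρeq x) (hD : ContDiff ℝ 2 D)
    (hL : ContDiff ℝ 2 (fun x => Real.log (ρeq x)))
    (hA : ∀ x, ‖iteratedFDeriv ℝ 1 D x‖ ≤ A) (hB : ∀ x, ‖iteratedFDeriv ℝ 2 D x‖ ≤ B)
    (hM : ∀ x, ‖iteratedFDeriv ℝ 2 (fun y => Real.log (ρeq y)) x‖ ≤ M) :
    ∃ C : ℝ, 0 ≤ C ∧ ∀ x z : EuclideanSpace ℝ (Fin d), ∀ ε : ℝ, 0 ≤ ε →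
      |alphaScaled D ρeq x z ε - betaScaled D ρeq x z ε| ≤ C * (1 + ‖z‖) ^ 4 * ε ^ 2 := by
  have hDpos : ∀ x, 0 < D x := fun x => hc.trans_le (hDc x)
  have hDd : Differentiable ℝ D := hD.differentiable (by norm_num)
  have hLd : Differentiable ℝ (fun x => Real.log (ρeq x)) := hL.differentiable (by norm_num)
  have hB0 : 0 ≤ B := (norm_nonneg _).trans (hB 0)
  have hM0 : 0 ≤ M := (norm_nonneg _).trans (hM 0)
  refine ⟨(d / 2 : ℝ) * (B / c + A ^ 2 / c ^ 2) + 1 / 4 * (B / c ^ 2 + 2 * A ^ 2 / c ^ 3) + M,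
    by positivity, fun x z ε hε => ?_⟩
  rw [alphaScaled_eq hDpos hρ, betaScaled_eq hDpos hρ hDd hLd]
  refine (abs_min_one_exp_sub_le_s9 _ _).trans ?_
  set u : ℝ → ℝ := fun t => D (x + t • z)
  set u' : ℝ → ℝ := fun t => fderiv ℝ D (x + t • z) z
  set u'' : ℝ → ℝ := fun t => fderiv ℝ (fderiv ℝ D) (x + t • z) z z
  have du : ∀ t, HasDerivAt u (u' t) t := fun t => hasDerivAt_comp_add_smul (hDd _)
  have du' : ∀ t, HasDerivAt u' (u'' t) t := hasDerivAt_fderiv_comp_add_smul hD x z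
  have hu0 : ∀ t, u t ≠ 0 := fun t => (hDpos _).ne'
  have hq : ∀ t, HasDerivAt (fun s : ℝ => Real.log (qscaled D (x + s • z) z))
      (-(d / 2 : ℝ) * (u' t / u t) + ‖z‖ ^ 2 / 4 * (u' t / u t ^ 2)) t := by
    intro t
    have h := ((((du t).log (hu0 t)).const_add (Real.log (4 * π))).const_mul
      (-(d : ℝ) / 2)).fun_sub (((du t).fun_inv (hu0 t)).const_mul (‖z‖ ^ 2 / 4))
    refine (h.congr_of_eventuallyEq (.of_forall fun s => ?_)).congr_deriv (by ring)
    exact log_qscaled (hDpos _) z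
  have hq' : ∀ t, HasDerivAt
      (fun t => -(d / 2 : ℝ) * (u' t / u t) + ‖z‖ ^ 2 / 4 * (u' t / u t ^ 2))
      (-(d / 2 : ℝ) * (u'' t / u t - u' t ^ 2 / u t ^ 2)
        + ‖z‖ ^ 2 / 4 * (u'' t / u t ^ 2 - 2 * u' t ^ 2 / u t ^ 3)) t := by
    intro t
    have hut := hu0 t
    have h := (((du' t).fun_div (du t) hut).const_mul (-(d / 2 : ℝ))).fun_add
      (((du' t).fun_div ((du t).fun_pow 2) (pow_ne_zero 2 hut)).const_mul (‖z‖ ^ 2 / 4))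
    refine h.congr_deriv ?_
    field_simp
    push_cast
    ring
  have hlog : fderiv ℝ (fun w => Real.log (qscaled D w z)) x z
      = -(d / 2 : ℝ) * (u' 0 / u 0) + ‖z‖ ^ 2 / 4 * (u' 0 / u 0 ^ 2) := by
    have h := hasDerivAt_comp_add_smul (f := fun w => Real.log (qscaled D w z)) (x := x) (z := z)
      (t := 0) ((differentiable_qscaled hDpos hDd z _).log (qscaled_pos (hDpos _) z).ne')
    have h2 := h.unique (hq 0)
    rwa [zero_smul, add_zero] at h2
  have key := abs_taylor_one_remainder_le
    (fun t => (hq t).fun_add (hasDerivAt_comp_add_smul (hLd (x + t • z))))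
    (fun t => (hq' t).fun_add (hasDerivAt_fderiv_comp_add_smul hL x z t))
    (M := ((d / 2 : ℝ) * (B / c + A ^ 2 / c ^ 2) + 1 / 4 * (B / c ^ 2 + 2 * A ^ 2 / c ^ 3) + M)
      * (1 + ‖z‖) ^ 4) (fun t => ?_) hε
  · simpa only [zero_smul, add_zero, hlog] using key
  · refine (abs_add_le _ _).trans ?_
    rw [add_mul]
    refine add_le_add (abs_log_inv_second_deriv_le hc (hDc _) (by positivity) hB0 (norm_nonneg z)
      (abs_fderiv_apply_le (hA _) z) (abs_fderiv_fderiv_apply_le (hB _) z)) ?_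
    refine (abs_fderiv_fderiv_apply_le (hM _) z).trans (mul_le_mul_of_nonneg_left ?_ hM0)
    have hr := norm_nonneg z
    nlinarith [sq_nonneg ‖z‖, pow_nonneg hr 3, pow_nonneg hr 4]

theorem one_add_pow_mul_exp_neg_sq_le {r s : ℝ} (hr : 0 ≤ r) (hs : 0 < s) (N : ℕ) :
    (1 + r) ^ N * Real.exp (-r ^ 2 / (4 * s))
      ≤ N.factorial * Real.exp 3 * (2 + s) ^ N * Real.exp (-(1 / (8 * s)) * r ^ 2) := by
  set w := √s
  have hw0 : 0 < w := Real.sqrt_pos.2 hs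
  have hws : w ^ 2 = s := Real.sq_sqrt hs.le
  have h1 : 1 + r ≤ (2 + s) * (1 + r / w) := by
    have : r = w * (r / w) := by field_simp
    have hrw : 0 ≤ r / w := by positivity
    have : w ≤ 2 + s := by nlinarith [sq_nonneg (w - 1)]
    nlinarith
  have h2 : (1 + r / w) ^ N ≤ N.factorial * Real.exp (1 + r / w) := by
    have := Real.pow_div_factorial_le_exp (1 + r / w) (by positivity) N
    rwa [div_le_iff₀' (by positivity)] at this
  have h3 : 1 + r / w ≤ 3 + 1 / (8 * s) * r ^ 2 := by
    have : 1 / (8 * s) * r ^ 2 = (r / w) ^ 2 / 8 := by rw [← hws]; field_simp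
    rw [this]
    nlinarith [sq_nonneg (r / w - 4)]
  calc (1 + r) ^ N * Real.exp (-r ^ 2 / (4 * s))
      ≤ ((2 + s) * (1 + r / w)) ^ N * Real.exp (-r ^ 2 / (4 * s)) := by gcongr
    _ = (2 + s) ^ N * (1 + r / w) ^ N * Real.exp (-r ^ 2 / (4 * s)) := by rw [mul_pow]
    _ ≤ (2 + s) ^ N * (N.factorial * Real.exp (3 + 1 / (8 * s) * r ^ 2))
        * Real.exp (-r ^ 2 / (4 * s)) := by
      gcongr
      exact h2.trans (by gcongr)
    _ = N.factorial * (2 + s) ^ N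
        * (Real.exp (3 + 1 / (8 * s) * r ^ 2) * Real.exp (-r ^ 2 / (4 * s))) := by ring
    _ = N.factorial * (2 + s) ^ N * (Real.exp 3 * Real.exp (-(1 / (8 * s)) * r ^ 2)) := by
      rw [← Real.exp_add, ← Real.exp_add]
      congr 2
      field_simp
      ring
    _ = _ := by ring

theorem integrable_exp_neg_mul_sq_norm {b : ℝ} (hb : 0 < b) :
    Integrable (fun z : EuclideanSpace ℝ (Fin d) => Real.exp (-b * ‖z‖ ^ 2)) := by
  refine Integrable.of_integral_ne_zero ?_
  rw [GaussianFourier.integral_rexp_neg_mul_sq_norm hb]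
  exact (Real.rpow_pos_of_pos (by positivity) _).ne'

theorem rpow_mul_integral_exp_neg_sq_norm {s : ℝ} (hs : 0 < s) :
    (4 * π * s) ^ (-(d : ℝ) / 2)
      * ∫ z : EuclideanSpace ℝ (Fin d), Real.exp (-(1 / (8 * s)) * ‖z‖ ^ 2)
      = 2 ^ ((d : ℝ) / 2) := by
  rw [GaussianFourier.integral_rexp_neg_mul_sq_norm (by positivity), finrank_euclideanSpace_fin,
    neg_div, Real.rpow_neg (by positivity), ← div_eq_inv_mul,
    ← Real.div_rpow (by positivity) (by positivity)]
  congr 1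
  field_simp
  ring

theorem le_mul_one_add_norm {A : ℝ} (hDd : Differentiable ℝ D)
    (hA : ∀ x, ‖iteratedFDeriv ℝ 1 D x‖ ≤ A) (x : EuclideanSpace ℝ (Fin d)) :
    2 + D x ≤ (2 + |D 0| + A) * (1 + ‖x‖) := by
  have hA0 : 0 ≤ A := (norm_nonneg _).trans (hA 0)
  have h := convex_univ.norm_image_sub_le_of_norm_fderiv_le (𝕜 := ℝ) (fun y _ => hDd y)
    (fun y _ => (norm_iteratedFDeriv_one D).symm.trans_le (hA y)) (Set.mem_univ 0)
    (Set.mem_univ x)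
  rw [sub_zero, Real.norm_eq_abs] at h
  nlinarith [le_abs_self (D x - D 0), le_abs_self (D 0), abs_nonneg (D 0), norm_nonneg x,
    mul_nonneg (abs_nonneg (D 0)) (norm_nonneg x)]

end Scaled

/-- for any polynomial `g`, the `q`-weighted integral of
`g(z)(α(x,z,ε) − β(x,z,ε))` is of order `ε²`, with a constant of polynomial
growth in `x`. -/
theorem alpha_beta_integral_estimate {d : ℕ} (hd : 1 ≤ d)
    (D ρeq : EuclideanSpace ℝ (Fin d) → ℝ)
    (hρeqpos : ∀ x, 0 < ρeq x)
    (hDsmooth : ContDiff ℝ 4 D)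
    (hLsmooth : ContDiff ℝ 4 (fun x => Real.log (ρeq x)))
    (hDbd : ∀ i : ℕ, 1 ≤ i → i ≤ 4 → ∃ C : ℝ, ∀ x, ‖iteratedFDeriv ℝ i D x‖ ≤ C)
    (hLbd : ∀ i : ℕ, 1 ≤ i → i ≤ 4 →
      ∃ C : ℝ, ∀ x, ‖iteratedFDeriv ℝ i (fun y => Real.log (ρeq y)) x‖ ≤ C)
    (hDinf : ∃ c : ℝ, 0 < c ∧ ∀ x, c ≤ D x)
    (g : MvPolynomial (Fin d) ℝ) :
    ∃ (K : EuclideanSpace ℝ (Fin d) → ℝ) (C : ℝ) (m : ℕ),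
      (∀ x, |K x| ≤ C * (1 + ‖x‖ ^ m)) ∧
      ∀ x, ∀ ε ∈ Set.Ioc (0 : ℝ) 1,
        |∫ z, MvPolynomial.eval (fun i => z i) g
            * (alphaScaled D ρeq x z ε - betaScaled D ρeq x z ε) * qscaled D x z|
          ≤ K x * ε ^ 2 := by
  obtain ⟨c, hc, hDc⟩ := hDinf
  obtain ⟨A, hA⟩ := hDbd 1 (by norm_num) (by norm_num)
  obtain ⟨B, hB⟩ := hDbd 2 (by norm_num) (by norm_num)
  obtain ⟨M, hM⟩ := hLbd 2 (by norm_num) (by norm_num)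
  have hDpos : ∀ x, 0 < D x := fun x => hc.trans_le (hDc x)
  have hA0 : 0 ≤ A := (norm_nonneg _).trans (hA 0)
  obtain ⟨C₁, hC₁, hαβ⟩ := exists_abs_alphaScaled_sub_betaScaled_le hc hDc hρeqpos
    (hDsmooth.of_le (by norm_num)) (hLsmooth.of_le (by norm_num)) hA hB hM
  obtain ⟨C₂, m, hC₂, hg⟩ := exists_abs_eval_le_one_add_norm_pow g
  set N := m + 4 with hN
  set a := 2 + |D 0| + A
  have ha0 : 0 ≤ a := by positivity
  set G := C₂ * C₁ * (N.factorial * Real.exp 3) * 2 ^ ((d : ℝ) / 2)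
  have hG0 : 0 ≤ G := by positivity
  set C := G * a ^ N * 2 ^ (N - 1) with hC
  refine ⟨fun x => C * (1 + ‖x‖ ^ N), C, N, fun x => ?_, fun x ε hε => ?_⟩
  · exact (abs_of_nonneg (by positivity)).le
  have hDx := hDpos x
  set P := (4 * π * D x) ^ (-(d : ℝ) / 2)
  have hP0 : 0 ≤ P := (Real.rpow_pos_of_pos (by positivity) _).le
  set F := C₂ * C₁ * (N.factorial * Real.exp 3) * (2 + D x) ^ N * ε ^ 2 with hF
  have hpt : ∀ z, ‖MvPolynomial.eval (fun i => z i) g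
      * (alphaScaled D ρeq x z ε - betaScaled D ρeq x z ε) * qscaled D x z‖
      ≤ F * P * Real.exp (-(1 / (8 * D x)) * ‖z‖ ^ 2) := by
    intro z
    rw [norm_mul, norm_mul, Real.norm_eq_abs, Real.norm_eq_abs,
      Real.norm_of_nonneg (qscaled_pos hDx z).le]
    calc _ ≤ C₂ * (1 + ‖z‖) ^ m * (C₁ * (1 + ‖z‖) ^ 4 * ε ^ 2) * qscaled D x z := by
          gcongr
          · exact (qscaled_pos hDx z).le
          · exact hg z
          · exact hαβ x z ε hε.1.le
      _ = C₂ * C₁ * ε ^ 2 * P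
          * ((1 + ‖z‖) ^ N * Real.exp (-‖z‖ ^ 2 / (4 * D x))) := by
          rw [qscaled, hN, pow_add]; ring
      _ ≤ C₂ * C₁ * ε ^ 2 * P * (N.factorial * Real.exp 3 * (2 + D x) ^ N
          * Real.exp (-(1 / (8 * D x)) * ‖z‖ ^ 2)) := by
          exact mul_le_mul_of_nonneg_left
            (one_add_pow_mul_exp_neg_sq_le (norm_nonneg z) hDx N) (by positivity)
      _ = _ := by rw [hF]; ring
  calc _ ≤ ∫ z : EuclideanSpace ℝ (Fin d), F * P * Real.exp (-(1 / (8 * D x)) * ‖z‖ ^ 2) :=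
        norm_integral_le_of_norm_le
          ((integrable_exp_neg_mul_sq_norm (by positivity)).const_mul _) (.of_forall hpt)
    _ = G * (2 + D x) ^ N * ε ^ 2 := by
        rw [integral_const_mul, mul_assoc, rpow_mul_integral_exp_neg_sq_norm hDx]
        ring
    _ ≤ G * (a * (1 + ‖x‖)) ^ N * ε ^ 2 := by
        gcongr
        exact le_mul_one_add_norm (hDsmooth.differentiable (by norm_num)) hA x
    _ ≤ G * (a ^ N * (2 ^ (N - 1) * (1 ^ N + ‖x‖ ^ N))) * ε ^ 2 := by
        rw [mul_pow]
        gcongr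
        exact add_pow_le zero_le_one (norm_nonneg x) N
    _ = C * (1 + ‖x‖ ^ N) * ε ^ 2 := by rw [one_pow, hC]; ring
end

section
/- Let d ≥ 1 and suppose D : ℝ^d → ℝ and ln ρ_eq : ℝ^d → ℝ have bounded derivatives up to order 4, ρ_eq > 0, and inf_x D(x) > 0. Set a(x) = ∇D(x) + D(x)∇ln ρ_eq(x). Then there exists a function K : ℝ^d → ℝ of polynomial growth such that for all x ∈ ℝ^d and all ε ∈ (0,1], | ∫_{ℝ^d} z q(x,z) ( β(x,z,ε) − 1 ) dz − a(x) ε | ≤ K(x) ε², where the left-hand side is the Euclidean norm of a vector in ℝ^d. -/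
open Real MeasureTheory
open scoped RealInnerProductSpace

/-- The density of the centred Gaussian on `ℝ^d` with covariance `2 • 1`. -/
noncomputable def heatDensity {d : ℕ} (y : EuclideanSpace ℝ (Fin d)) : ℝ :=
  (4 * π) ^ (-(d : ℝ) / 2) * Real.exp (-(1 / 4) * ‖y‖ ^ 2)

section HeatDensity

variable {d : ℕ}

local notation "E" => EuclideanSpace ℝ (Fin d)

theorem heatDensity_nonneg (y : E) : 0 ≤ heatDensity y := by
  unfold heatDensity
  positivity

theorem heatDensity_neg (y : E) : heatDensity (-y) = heatDensity y := by
  simp [heatDensity]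

theorem continuous_heatDensity : Continuous (heatDensity : E → ℝ) := by
  unfold heatDensity
  fun_prop

theorem integral_heatDensity : ∫ y : E, heatDensity y = 1 := by
  unfold heatDensity
  rw [integral_const_mul, GaussianFourier.integral_rexp_neg_mul_sq_norm (by norm_num)]
  rw [finrank_euclideanSpace_fin, show π / (1 / 4) = 4 * π by ring, neg_div,
    Real.rpow_neg (by positivity)]
  exact inv_mul_cancel₀ (by positivity)

theorem integrable_heatDensity_smul {F : Type*} [NormedAddCommGroup F] [NormedSpace ℝ F]
    {f : E → F} (hf : Continuous f) (A : ℝ) (k : ℕ)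
    (hA : ∀ y, ‖f y‖ ≤ A * (1 + ‖y‖) ^ k) :
    Integrable (fun y => heatDensity y • f y) := by
  have hint : Integrable (fun y : E => Real.exp (-(1 / 8) * ‖y‖ ^ 2)) := by
    by_contra h
    have h1 := GaussianFourier.integral_rexp_neg_mul_sq_norm (V := E) (b := 1 / 8) (by norm_num)
    rw [integral_undef h] at h1
    exact absurd h1 (by positivity)
  have hA0 : 0 ≤ A := by
    have := (norm_nonneg _).trans (hA 0)
    simpa using this
  refine (hint.const_mul ((4 * π) ^ (-(d : ℝ) / 2) * (A * (k.factorial * Real.exp 3)))).mono'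
    (continuous_heatDensity.smul hf).aestronglyMeasurable (.of_forall fun y => ?_)
  rw [norm_smul, Real.norm_of_nonneg (heatDensity_nonneg y)]
  have hpow : (1 + ‖y‖) ^ k ≤ k.factorial * (Real.exp 3 * Real.exp (1 / 8 * ‖y‖ ^ 2)) := by
    have h1 := Real.pow_div_factorial_le_exp (1 + ‖y‖) (by positivity) k
    rw [div_le_iff₀ (by positivity)] at h1
    have h2 : Real.exp (1 + ‖y‖) ≤ Real.exp 3 * Real.exp (1 / 8 * ‖y‖ ^ 2) := by
      rw [← Real.exp_add]
      exact Real.exp_le_exp.2 (by nlinarith [sq_nonneg (‖y‖ - 4)])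
    calc (1 + ‖y‖) ^ k ≤ Real.exp (1 + ‖y‖) * k.factorial := h1
      _ = k.factorial * Real.exp (1 + ‖y‖) := mul_comm _ _
      _ ≤ _ := by gcongr
  have hexp : Real.exp (-(1 / 8) * ‖y‖ ^ 2)
      = Real.exp (-(1 / 4) * ‖y‖ ^ 2) * Real.exp (1 / 8 * ‖y‖ ^ 2) := by
    rw [← Real.exp_add]
    ring_nf
  calc heatDensity y * ‖f y‖
      ≤ heatDensity y * (A * (k.factorial * (Real.exp 3 * Real.exp (1 / 8 * ‖y‖ ^ 2)))) := by
        refine mul_le_mul_of_nonneg_left ((hA y).trans ?_) (heatDensity_nonneg y)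
        gcongr
    _ = _ := by
        rw [hexp, heatDensity]
        ring

theorem hasFDerivAt_heatDensity (y : E) :
    HasFDerivAt heatDensity (-(heatDensity y / 2) • innerSL ℝ y) y := by
  have h := (((hasStrictFDerivAt_norm_sq y).hasFDerivAt.const_mul (-(1 / 4))).exp).const_mul
    ((4 * π) ^ (-(d : ℝ) / 2))
  refine h.congr_fderiv ?_
  ext v
  simp [heatDensity]
  ring

/-- Gaussian integration by parts. -/
theorem integral_heatDensity_mul_inner {f : E → ℝ} {f' : E → E →L[ℝ] ℝ}
    (hf : ∀ y, HasFDerivAt f (f' y) y) (v : E) (hf'c : Continuous fun y => f' y v) (A : ℝ) (k : ℕ)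
    (hA : ∀ y, |f y| ≤ A * (1 + ‖y‖) ^ k) (hA' : ∀ y, |f' y v| ≤ A * (1 + ‖y‖) ^ k) :
    ∫ y, heatDensity y * (f y * ⟪y, v⟫) = 2 * ∫ y, heatDensity y * f' y v := by
  have hfc : Continuous f := continuous_iff_continuousAt.2 fun y => (hf y).continuousAt
  have h1 := integrable_heatDensity_smul (f := f) hfc A k hA
  have h2 := integrable_heatDensity_smul hf'c A k hA'
  have h3 : Integrable fun y : E => heatDensity y • (f y * ⟪y, v⟫) := by
    refine integrable_heatDensity_smul (by fun_prop) (A * ‖v‖) (k + 1) fun y => ?_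
    have hfy := hA y
    have hA0 : 0 ≤ A * (1 + ‖y‖) ^ k := (abs_nonneg _).trans hfy
    rw [Real.norm_eq_abs, abs_mul]
    calc |f y| * |⟪y, v⟫| ≤ (A * (1 + ‖y‖) ^ k) * ((1 + ‖y‖) * ‖v‖) := by
          gcongr
          refine (abs_real_inner_le_norm y v).trans ?_
          gcongr
          linarith
      _ = _ := by ring
  simp only [smul_eq_mul] at h1 h2 h3
  have hg : ∀ y : E, fderiv ℝ heatDensity y v = -(1 / 2) * (heatDensity y * ⟪y, v⟫) := fun y => by
    rw [(hasFDerivAt_heatDensity y).fderiv]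
    simp
    ring
  have key := integral_mul_fderiv_eq_neg_fderiv_mul_of_integrable (μ := volume)
    (f := f) (g := (heatDensity : E → ℝ)) (v := v)
    (by
      refine h2.congr (.of_forall fun y => ?_)
      simp only [(hf y).fderiv]
      ring)
    (by
      refine (h3.const_mul (-(1 / 2))).congr (.of_forall fun y => ?_)
      simp only [hg]
      ring)
    (h1.congr (.of_forall fun y => mul_comm _ _))
    (fun y _ => (hf y).differentiableAt)
    (fun y _ => (hasFDerivAt_heatDensity y).differentiableAt)
  have e1 : ∫ y, f y * fderiv ℝ heatDensity y v
      = -(1 / 2) * ∫ y, heatDensity y * (f y * ⟪y, v⟫) := by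
    rw [← integral_const_mul]
    congr 1 with y
    rw [hg]
    ring
  have e2 : ∫ y, fderiv ℝ f y v * heatDensity y = ∫ y, heatDensity y * f' y v := by
    congr 1 with y
    rw [(hf y).fderiv, mul_comm]
  rw [e1, e2] at key
  linarith

theorem integral_heatDensity_inner_mul_inner (w v : E) :
    ∫ y, heatDensity y * (⟪w, y⟫ * ⟪y, v⟫) = 2 * ⟪w, v⟫ := by
  have h := integral_heatDensity_mul_inner (f := fun y => ⟪w, y⟫) (f' := fun _ => innerSL ℝ w)
    (fun y => (innerSL ℝ w).hasFDerivAt) v continuous_const (‖w‖ + ‖w‖ * ‖v‖) 1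
    (fun y => by
      have h1 := abs_real_inner_le_norm w y
      have h2 : 0 ≤ ‖w‖ * ‖v‖ * (1 + ‖y‖) := by positivity
      nlinarith [norm_nonneg w])
    (fun y => by
      have h1 := abs_real_inner_le_norm w v
      have h2 : 0 ≤ ‖w‖ * ‖v‖ * ‖y‖ := by positivity
      have h3 : 0 ≤ ‖w‖ * (1 + ‖y‖) := by positivity
      simp only [innerSL_apply_apply]
      nlinarith)
  rw [h]
  simp only [innerSL_apply_apply]
  rw [integral_mul_const, integral_heatDensity, one_mul]

theorem integral_heatDensity_mul_norm_sq :
    ∫ y : E, heatDensity y * ‖y‖ ^ 2 = 2 * d := by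
  have h : ∀ y : E, heatDensity y * ‖y‖ ^ 2 = ∑ i : Fin d, heatDensity y *
      (⟪EuclideanSpace.single i (1 : ℝ), y⟫ * ⟪y, EuclideanSpace.single i (1 : ℝ)⟫) := fun y => by
    rw [EuclideanSpace.norm_sq_eq, Finset.mul_sum]
    refine Finset.sum_congr rfl fun i _ => ?_
    simp [EuclideanSpace.inner_single_left, EuclideanSpace.inner_single_right, sq]
  simp_rw [h]
  rw [integral_finsetSum]
  · simp_rw [integral_heatDensity_inner_mul_inner]
    simp
    ring
  · intro i _
    refine integrable_heatDensity_smul (by fun_prop) 1 2 fun y => ?_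
    rw [norm_mul, one_mul, sq]
    gcongr <;>
    · refine (norm_inner_le_norm _ _).trans ?_
      simp

theorem integral_heatDensity_inner_mul_norm_sq_mul_inner (w v : E) :
    ∫ y, heatDensity y * (⟪w, y⟫ * ‖y‖ ^ 2 * ⟪y, v⟫) = 4 * (d + 2) * ⟪w, v⟫ := by
  have h := integral_heatDensity_mul_inner (f := fun y => ⟪w, y⟫ * ‖y‖ ^ 2)
    (f' := fun y => ⟪w, y⟫ • (2 • innerSL ℝ y) + ‖y‖ ^ 2 • innerSL ℝ w)
    (fun y => (innerSL ℝ w).hasFDerivAt.mul (hasStrictFDerivAt_norm_sq y).hasFDerivAt) v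
    (by simp; fun_prop)
    (‖w‖ + 3 * (‖w‖ * ‖v‖)) 3
    (fun y => by
      rw [abs_mul, abs_of_nonneg (sq_nonneg ‖y‖)]
      calc |⟪w, y⟫| * ‖y‖ ^ 2 ≤ (‖w‖ * (1 + ‖y‖)) * (1 + ‖y‖) ^ 2 := by
            gcongr
            · refine (abs_real_inner_le_norm w y).trans ?_
              gcongr
              linarith
            · linarith
        _ = ‖w‖ * (1 + ‖y‖) ^ 3 := by ring
        _ ≤ _ := by
            gcongr
            exact le_add_of_nonneg_right (by positivity))
    (fun y => by
      have h1 := abs_real_inner_le_norm w y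
      have h2 := abs_real_inner_le_norm y v
      have h3 := abs_real_inner_le_norm w v
      have e : (⟪w, y⟫ • (2 • innerSL ℝ y) + ‖y‖ ^ 2 • innerSL ℝ w) v
          = 2 * (⟪w, y⟫ * ⟪y, v⟫) + ‖y‖ ^ 2 * ⟪w, v⟫ := by
        simp
        ring
      rw [e]
      calc |2 * (⟪w, y⟫ * ⟪y, v⟫) + ‖y‖ ^ 2 * ⟪w, v⟫|
          ≤ |2 * (⟪w, y⟫ * ⟪y, v⟫)| + |‖y‖ ^ 2 * ⟪w, v⟫| := abs_add_le _ _
        _ = 2 * (|⟪w, y⟫| * |⟪y, v⟫|) + ‖y‖ ^ 2 * |⟪w, v⟫| := by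
            rw [abs_mul, abs_mul, abs_mul, abs_of_nonneg (sq_nonneg ‖y‖), abs_two]
        _ ≤ 2 * ((‖w‖ * ‖y‖) * (‖y‖ * ‖v‖)) + ‖y‖ ^ 2 * (‖w‖ * ‖v‖) := by gcongr
        _ = (3 * (‖w‖ * ‖v‖)) * ‖y‖ ^ 2 := by ring
        _ ≤ (‖w‖ + 3 * (‖w‖ * ‖v‖)) * (1 + ‖y‖) ^ 3 := by
            gcongr
            · exact le_add_of_nonneg_left (norm_nonneg w)
            · nlinarith [norm_nonneg y, pow_nonneg (norm_nonneg y) 3])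
  rw [h]
  have e : ∀ y : E, heatDensity y * (⟪w, y⟫ • (2 • innerSL ℝ y) + ‖y‖ ^ 2 • innerSL ℝ w) v
      = 2 * (heatDensity y * (⟪w, y⟫ * ⟪y, v⟫)) + ⟪w, v⟫ * (heatDensity y * ‖y‖ ^ 2) := fun y => by
    simp
    ring
  simp_rw [e]
  rw [integral_add, integral_const_mul, integral_const_mul, integral_heatDensity_inner_mul_inner,
    integral_heatDensity_mul_norm_sq]
  · ring
  · refine Integrable.const_mul ?_ _
    refine integrable_heatDensity_smul (by fun_prop) (‖w‖ * ‖v‖) 2 fun y => ?_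
    rw [norm_mul]
    calc ‖⟪w, y⟫‖ * ‖⟪y, v⟫‖ ≤ (‖w‖ * (1 + ‖y‖)) * ((1 + ‖y‖) * ‖v‖) := by
          gcongr
          · refine (norm_inner_le_norm _ _).trans ?_
            gcongr
            linarith
          · refine (norm_inner_le_norm _ _).trans ?_
            gcongr
            linarith
      _ = _ := by ring
  · refine Integrable.const_mul ?_ _
    refine integrable_heatDensity_smul (by fun_prop) 1 2 fun y => ?_
    rw [norm_pow, norm_norm, one_mul]
    gcongr
    linarith

end HeatDensity

section Scaling

variable {d : ℕ}

local notation "E" => EuclideanSpace ℝ (Fin d)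

theorem qscaled_sqrt_smul {D : E → ℝ} {x : E} (hD : 0 < D x) (y : E) :
    qscaled D x (√(D x) • y) = (√(D x) ^ d)⁻¹ * heatDensity y := by
  have hpow : (D x) ^ (-(d : ℝ) / 2) = (√(D x) ^ d)⁻¹ := by
    rw [Real.sqrt_eq_rpow, ← Real.rpow_natCast, ← Real.rpow_mul hD.le, ← Real.rpow_neg hD.le]
    ring_nf
  have hexp : -‖√(D x) • y‖ ^ 2 / (4 * D x) = -(1 / 4) * ‖y‖ ^ 2 := by
    rw [norm_smul, mul_pow, Real.norm_eq_abs, sq_abs, Real.sq_sqrt hD.le]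
    field_simp
  rw [qscaled, hexp, Real.mul_rpow (by positivity) hD.le, hpow, heatDensity]
  ring

theorem integral_qscaled_mul_smul {D : E → ℝ} {x : E} (hD : 0 < D x) (φ : E → ℝ) :
    ∫ z, (qscaled D x z * φ z) • z
      = √(D x) • ∫ y, (heatDensity y * φ (√(D x) • y)) • y := by
  have hs : 0 < √(D x) := Real.sqrt_pos.2 hD
  have h := Measure.integral_comp_smul (μ := (volume : Measure E))
    (fun z => (qscaled D x z * φ z) • z) (√(D x))
  rw [finrank_euclideanSpace_fin, abs_of_pos (by positivity)] at h
  rw [← inv_smul_eq_iff₀ hs.ne']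
  rw [← smul_right_inj (inv_ne_zero (pow_pos hs d).ne'), smul_comm, ← h,
    inv_smul_eq_iff₀ hs.ne', ← integral_smul, ← integral_smul]
  congr 1 with y : 1
  rw [qscaled_sqrt_smul hD]
  simp only [smul_smul]
  congr 1
  ring

theorem inner_gradient_qscaled_div {D : E → ℝ} {x : E} (hD : 0 < D x)
    (hdiff : DifferentiableAt ℝ D x) (z : E) :
    ⟪gradient (fun w => qscaled D w z) x, z⟫ / qscaled D x z
      = (‖z‖ ^ 2 / (4 * D x ^ 2) - d / (2 * D x)) * ⟪gradient D x, z⟫ := by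
  have hD' := hdiff.hasFDerivAt
  have h1 : HasDerivAt (fun t : ℝ => (4 * π * t) ^ (-(d : ℝ) / 2) * Real.exp (-‖z‖ ^ 2 / (4 * t)))
      ((‖z‖ ^ 2 / (4 * D x ^ 2) - d / (2 * D x)) * qscaled D x z) (D x) := by
    have hb : HasDerivAt (fun t : ℝ => 4 * π * t) (4 * π) (D x) := by
      simpa using (hasDerivAt_id (D x)).const_mul (4 * π)
    have hc : HasDerivAt (fun t : ℝ => 4 * t) 4 (D x) := by
      simpa using (hasDerivAt_id (D x)).const_mul 4
    have hp : 0 < 4 * π * D x := by positivity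
    have h2 := (hb.rpow_const (p := -(d : ℝ) / 2) (Or.inl hp.ne')).mul
      (((hasDerivAt_const (D x) (-‖z‖ ^ 2)).fun_div hc (by positivity)).exp)
    refine h2.congr_deriv ?_
    rw [Real.rpow_sub_one hp.ne', qscaled]
    field_simp
    ring
  have h2 := h1.comp_hasFDerivAt x hD'
  have hq : 0 < qscaled D x z := by
    unfold qscaled
    positivity
  rw [inner_gradient_left, inner_gradient_left]
  have h3 : fderiv ℝ (fun w => qscaled D w z) x = _ := h2.fderiv
  rw [h3]
  simp
  field_simp

theorem inner_gradient_div {ρ : E → ℝ} {x : E} (hρ : ∀ y, 0 < ρ y)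
    (hdiff : DifferentiableAt ℝ (fun y => Real.log (ρ y)) x) (z : E) :
    ⟪gradient ρ x, z⟫ / ρ x = ⟪gradient (fun y => Real.log (ρ y)) x, z⟫ := by
  have h : DifferentiableAt ℝ ρ x := by
    have h1 := hdiff.exp
    simp only [Real.exp_log (hρ _)] at h1
    exact h1
  rw [inner_gradient_left, inner_gradient_left, fderiv.log h (hρ x).ne']
  simp
  ring

end Scaling

theorem abs_min_one_exp_sub_one_sub_min_le (u : ℝ) :
    |min 1 (Real.exp u) - 1 - min u 0| ≤ u ^ 2 := by
  rcases le_total 0 u with hu | hu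
  · rw [min_eq_left (Real.one_le_exp hu), min_eq_right hu]
    simpa using sq_nonneg u
  · rw [min_eq_right (Real.exp_le_one_iff.2 hu), min_eq_left hu]
    have h1 := Real.add_one_le_exp u
    have h2 := Real.add_one_le_exp (-u)
    have h3 : Real.exp u * Real.exp (-u) = 1 := by rw [← Real.exp_add]; simp
    have h4 := Real.exp_pos u
    rw [abs_of_nonneg (by linarith)]
    have h5 : Real.exp u * (1 - u) ≤ 1 := by nlinarith
    by_contra! h6
    nlinarith

section FirstMoment

variable {d : ℕ}

local notation "E" => EuclideanSpace ℝ (Fin d)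

/-- Against an even density, the negative part of an odd function has half its first moment. -/
theorem integral_heatDensity_mul_min_zero_smul {g : E → ℝ} (hodd : ∀ y, g (-y) = -g y)
    (hg : Integrable fun y => (heatDensity y * g y) • y)
    (hm : Integrable fun y => (heatDensity y * min (g y) 0) • y) :
    ∫ y, (heatDensity y * min (g y) 0) • y
      = (1 / 2 : ℝ) • ∫ y, (heatDensity y * g y) • y := by
  have h1 : ∫ y, (heatDensity y * min (g y) 0) • y
      = (∫ y, (heatDensity y * g y) • y) - ∫ y, (heatDensity y * min (g y) 0) • y := by
    rw [← integral_sub hg hm]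
    conv_lhs => rw [← integral_neg_eq_self (fun y => (heatDensity y * min (g y) 0) • y)]
    congr 1 with y : 1
    rw [heatDensity_neg, hodd, smul_neg, ← neg_smul, ← sub_smul]
    congr 1
    rcases le_total 0 (g y) with h | h
    · rw [min_eq_left (by linarith), min_eq_right h]
      ring
    · rw [min_eq_right (by linarith), min_eq_left h]
      ring
  rw [eq_sub_iff_add_eq, ← two_smul ℝ] at h1
  rw [← h1, smul_smul]
  norm_num

theorem integrable_heatDensity_mul_smul {g : E → ℝ} (hgc : Continuous g) {A : ℝ} (hA0 : 0 ≤ A)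
    (hA : ∀ y, |g y| ≤ A * (‖y‖ + ‖y‖ ^ 3)) :
    Integrable fun y => (heatDensity y * g y) • y := by
  simp_rw [mul_smul]
  refine integrable_heatDensity_smul (by fun_prop) A 4 fun y => ?_
  rw [norm_smul, Real.norm_eq_abs]
  have hy := norm_nonneg y
  calc |g y| * ‖y‖ ≤ A * (1 + ‖y‖) ^ 3 * (1 + ‖y‖) := by
        gcongr
        · refine (hA y).trans ?_
          gcongr
          nlinarith
        · linarith
    _ = _ := by ring

theorem norm_integral_min_one_exp_sub_le {g : E → ℝ} (hgc : Continuous g)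
    (hodd : ∀ y, g (-y) = -g y) {A : ℝ} (hA0 : 0 ≤ A)
    (hA : ∀ y, |g y| ≤ A * (‖y‖ + ‖y‖ ^ 3)) {ε : ℝ} (hε : 0 < ε) :
    ‖(∫ y, (heatDensity y * (min 1 (Real.exp (ε * g y)) - 1)) • y)
        - (ε / 2) • ∫ y, (heatDensity y * g y) • y‖
      ≤ ε ^ 2 * A ^ 2 * ∫ y : E, heatDensity y * ((‖y‖ + ‖y‖ ^ 3) ^ 2 * ‖y‖) := by
  have hβ : Integrable fun y => (heatDensity y * (min 1 (Real.exp (ε * g y)) - 1)) • y := by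
    simp_rw [mul_smul]
    refine integrable_heatDensity_smul (by fun_prop) 1 1 fun y => ?_
    rw [norm_smul, Real.norm_eq_abs, pow_one]
    gcongr
    · have h1 : min 1 (Real.exp (ε * g y)) ≤ 1 := min_le_left _ _
      have h2 : 0 ≤ min 1 (Real.exp (ε * g y)) := le_min zero_le_one (Real.exp_pos _).le
      rw [abs_le]
      constructor <;> linarith
    · linarith
  have hg := integrable_heatDensity_mul_smul hgc hA0 hA
  have hm : Integrable fun y => (heatDensity y * min (g y) 0) • y := by
    refine integrable_heatDensity_mul_smul (by fun_prop) hA0 fun y => le_trans ?_ (hA y)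
    rcases le_total (g y) 0 with h | h
    · rw [min_eq_left h]
    · rw [min_eq_right h]
      simp
  have hY : Integrable fun y : E => heatDensity y * ((‖y‖ + ‖y‖ ^ 3) ^ 2 * ‖y‖) := by
    refine integrable_heatDensity_smul (by fun_prop) 1 7 fun y => ?_
    have hy := norm_nonneg y
    rw [Real.norm_of_nonneg (by positivity), one_mul]
    calc (‖y‖ + ‖y‖ ^ 3) ^ 2 * ‖y‖ ≤ ((1 + ‖y‖) ^ 3) ^ 2 * (1 + ‖y‖) := by
          gcongr
          · nlinarith
          · linarith
      _ = _ := by ring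
  rw [show ε / 2 = ε * (1 / 2) by ring, mul_smul,
    ← integral_heatDensity_mul_min_zero_smul hodd hg hm, ← integral_smul,
    ← integral_sub hβ (hm.fun_smul ε), ← integral_const_mul]
  refine norm_integral_le_of_norm_le (hY.const_mul _) (.of_forall fun y => ?_)
  have hsplit : ε * min (g y) 0 = min (ε * g y) 0 := by
    rw [mul_min_of_nonneg _ _ hε.le, mul_zero]
  have h1 : (heatDensity y * (min 1 (Real.exp (ε * g y)) - 1)) • y
      - ε • (heatDensity y * min (g y) 0) • y
      = (heatDensity y * (min 1 (Real.exp (ε * g y)) - 1 - min (ε * g y) 0)) • y := by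
    rw [← hsplit, smul_smul, ← sub_smul]
    congr 1
    ring
  rw [h1, norm_smul, norm_mul, Real.norm_of_nonneg (heatDensity_nonneg y), Real.norm_eq_abs]
  have h2 : |min 1 (Real.exp (ε * g y)) - 1 - min (ε * g y) 0|
      ≤ ε ^ 2 * (A * (‖y‖ + ‖y‖ ^ 3)) ^ 2 := by
    refine (abs_min_one_exp_sub_one_sub_min_le _).trans ?_
    rw [mul_pow, ← sq_abs (g y)]
    gcongr
    exact hA y
  calc heatDensity y * |min 1 (Real.exp (ε * g y)) - 1 - min (ε * g y) 0| * ‖y‖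
      ≤ heatDensity y * (ε ^ 2 * (A * (‖y‖ + ‖y‖ ^ 3)) ^ 2) * ‖y‖ := by
        have := heatDensity_nonneg y
        gcongr
    _ = _ := by ring

theorem abs_inner_mul_add_inner_le (u v y : E) :
    |⟪u, y⟫ * (‖y‖ ^ 2 / 2 - d) + ⟪v, y⟫| ≤ ((d + 1) * ‖u‖ + ‖v‖) * (‖y‖ + ‖y‖ ^ 3) := by
  have hd : |‖y‖ ^ 2 / 2 - (d : ℝ)| ≤ (d + 1) * (1 + ‖y‖ ^ 2) := by
    have h0 : (0 : ℝ) ≤ d := d.cast_nonneg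
    have h1 : 0 ≤ (d : ℝ) * ‖y‖ ^ 2 := by positivity
    rw [abs_le]
    constructor <;> nlinarith [sq_nonneg ‖y‖]
  calc |⟪u, y⟫ * (‖y‖ ^ 2 / 2 - d) + ⟪v, y⟫|
      ≤ |⟪u, y⟫ * (‖y‖ ^ 2 / 2 - d)| + |⟪v, y⟫| := abs_add_le _ _
    _ ≤ (‖u‖ * ‖y‖) * ((d + 1) * (1 + ‖y‖ ^ 2)) + ‖v‖ * ‖y‖ := by
        rw [abs_mul]
        gcongr
        · exact abs_real_inner_le_norm u y
        · exact abs_real_inner_le_norm v y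
    _ ≤ (‖u‖ * ‖y‖) * ((d + 1) * (1 + ‖y‖ ^ 2)) + ‖v‖ * (‖y‖ + ‖y‖ ^ 3) := by
        gcongr
        exact le_add_of_nonneg_right (by positivity)
    _ = _ := by ring

theorem integral_heatDensity_cubic_smul (u v : E) :
    ∫ y, (heatDensity y * (⟪u, y⟫ * (‖y‖ ^ 2 / 2 - d) + ⟪v, y⟫)) • y
      = (4 : ℝ) • u + (2 : ℝ) • v := by
  have hint : ∀ u v : E, Integrable
      fun y => (heatDensity y * (⟪u, y⟫ * (‖y‖ ^ 2 / 2 - d) + ⟪v, y⟫)) • y := fun u v =>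
    integrable_heatDensity_mul_smul (by fun_prop) (by positivity) (abs_inner_mul_add_inner_le u v)
  have hquad : ∀ v w : E, Integrable fun y => heatDensity y * (⟪v, y⟫ * ⟪y, w⟫) := fun v w => by
    refine ((hint 0 v).const_inner w).congr (.of_forall fun y => ?_)
    simp [inner_smul_right, real_inner_comm]
    ring
  have hquart : ∀ w : E,
      Integrable fun y => heatDensity y * (⟪u, y⟫ * ‖y‖ ^ 2 * ⟪y, w⟫) := fun w => by
    refine ((((hint u 0).const_inner w).const_mul 2).add ((hquad u w).const_mul (2 * d))).congr
      (.of_forall fun y => ?_)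
    simp [inner_smul_right, real_inner_comm]
    ring
  refine ext_inner_left ℝ fun w => ?_
  rw [← integral_inner (hint u v)]
  have e : ∀ y : E, ⟪w, (heatDensity y * (⟪u, y⟫ * (‖y‖ ^ 2 / 2 - d) + ⟪v, y⟫)) • y⟫
      = 1 / 2 * (heatDensity y * (⟪u, y⟫ * ‖y‖ ^ 2 * ⟪y, w⟫))
        - d * (heatDensity y * (⟪u, y⟫ * ⟪y, w⟫)) + heatDensity y * (⟪v, y⟫ * ⟪y, w⟫) := fun y => by
    rw [inner_smul_right, real_inner_comm y w]
    ring
  simp_rw [e]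
  have hsub : Integrable fun y => 1 / 2 * (heatDensity y * (⟪u, y⟫ * ‖y‖ ^ 2 * ⟪y, w⟫))
      - d * (heatDensity y * (⟪u, y⟫ * ⟪y, w⟫)) :=
    ((hquart w).const_mul _).sub ((hquad u w).const_mul _)
  rw [integral_add hsub (hquad v w),
    integral_sub ((hquart w).const_mul _) ((hquad u w).const_mul _), integral_const_mul,
    integral_const_mul, integral_heatDensity_inner_mul_norm_sq_mul_inner,
    integral_heatDensity_inner_mul_inner, integral_heatDensity_inner_mul_inner,
    inner_add_right, inner_smul_right, inner_smul_right, real_inner_comm u w,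
    real_inner_comm v w]
  ring

end FirstMoment

theorem norm_gradient {d : ℕ} (f : EuclideanSpace ℝ (Fin d) → ℝ) (x : EuclideanSpace ℝ (Fin d)) :
    ‖gradient f x‖ = ‖iteratedFDeriv ℝ 1 f x‖ := by
  rw [norm_iteratedFDeriv_one, gradient, LinearIsometryEquiv.norm_map]

/-- The first moment of `β - 1` at a single point, with an explicit remainder. -/
theorem norm_integral_betaScaled_sub_le {d : ℕ} {D ρeq : EuclideanSpace ℝ (Fin d) → ℝ}
    {x : EuclideanSpace ℝ (Fin d)} (hD : 0 < D x) (hDdiff : DifferentiableAt ℝ D x)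
    (hρ : ∀ y, 0 < ρeq y) (hLdiff : DifferentiableAt ℝ (fun y => Real.log (ρeq y)) x)
    {ε : ℝ} (hε : 0 < ε) :
    ‖(∫ z, (qscaled D x z * (betaScaled D ρeq x z ε - 1)) • z)
        - ε • (gradient D x + D x • gradient (fun y => Real.log (ρeq y)) x)‖
      ≤ √(D x) * (ε ^ 2 * ((d + 1) * (‖gradient D x‖ / (2 * √(D x)))
          + √(D x) * ‖gradient (fun y => Real.log (ρeq y)) x‖) ^ 2
        * ∫ y : EuclideanSpace ℝ (Fin d), heatDensity y * ((‖y‖ + ‖y‖ ^ 3) ^ 2 * ‖y‖)) := by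
  have hs : 0 < √(D x) := Real.sqrt_pos.2 hD
  have hsq : √(D x) ^ 2 = D x := Real.sq_sqrt hD.le
  set s := √(D x) with hsdef
  set b := gradient (fun y => Real.log (ρeq y)) x with hb
  set u := (1 / (2 * s)) • gradient D x with hu
  set v := s • b with hv
  have hβ : ∀ y, betaScaled D ρeq x (s • y) ε
      = min 1 (Real.exp (ε * (⟪u, y⟫ * (‖y‖ ^ 2 / 2 - d) + ⟪v, y⟫))) := fun y => by
    rw [betaScaled, inner_gradient_qscaled_div hD hDdiff, inner_gradient_div hρ hLdiff, ← hb, hu,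
      hv, inner_smul_left, inner_smul_left, inner_smul_right, inner_smul_right, norm_smul,
      Real.norm_of_nonneg hs.le, ← hsq]
    congr 2
    simp
    field_simp
    ring
  have hunorm : ‖u‖ = ‖gradient D x‖ / (2 * s) := by
    rw [hu, norm_smul, Real.norm_of_nonneg (by positivity)]
    ring
  have hvnorm : ‖v‖ = s * ‖b‖ := by
    rw [hv, norm_smul, Real.norm_of_nonneg hs.le]
  have key := norm_integral_min_one_exp_sub_le
    (g := fun y => ⟪u, y⟫ * (‖y‖ ^ 2 / 2 - d) + ⟪v, y⟫) (by fun_prop)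
    (fun y => by simp only [inner_neg_right, norm_neg]; ring) (by positivity)
    (abs_inner_mul_add_inner_le u v) hε
  have hdrift : ε • (gradient D x + D x • b) = s • (ε / 2) • ((4 : ℝ) • u + (2 : ℝ) • v) := by
    rw [hu, hv, ← hsq]
    simp only [smul_add, smul_smul]
    congr 2
    · field_simp
      ring
    · ring
  rw [integral_heatDensity_cubic_smul, hunorm, hvnorm] at key
  rw [integral_qscaled_mul_smul hD, ← hsdef, hdrift, ← smul_sub, norm_smul,
    Real.norm_of_nonneg hs.le]
  simp_rw [hβ]
  gcongr

/-- the first moment of `β − 1` against `q(x,·)` reproduces the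
drift `a(x) = ∇D(x) + D(x)∇ln ρ_eq(x)` to first order in `ε`, with remainder
of order `ε²` and a constant of polynomial growth in `x`. -/
theorem beta_first_moment_drift {d : ℕ} (hd : 1 ≤ d)
    (D ρeq : EuclideanSpace ℝ (Fin d) → ℝ)
    (hρeqpos : ∀ x, 0 < ρeq x)
    (hDsmooth : ContDiff ℝ 4 D)
    (hLsmooth : ContDiff ℝ 4 (fun x => Real.log (ρeq x)))
    (hDbd : ∀ i : ℕ, 1 ≤ i → i ≤ 4 → ∃ C : ℝ, ∀ x, ‖iteratedFDeriv ℝ i D x‖ ≤ C)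
    (hLbd : ∀ i : ℕ, 1 ≤ i → i ≤ 4 →
      ∃ C : ℝ, ∀ x, ‖iteratedFDeriv ℝ i (fun y => Real.log (ρeq y)) x‖ ≤ C)
    (hDinf : ∃ c : ℝ, 0 < c ∧ ∀ x, c ≤ D x)
    (a : EuclideanSpace ℝ (Fin d) → EuclideanSpace ℝ (Fin d))
    (ha : ∀ x, a x = gradient D x + D x • gradient (fun y => Real.log (ρeq y)) x) :
    ∃ (K : EuclideanSpace ℝ (Fin d) → ℝ) (C : ℝ) (m : ℕ),
      (∀ x, |K x| ≤ C * (1 + ‖x‖ ^ m)) ∧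
      ∀ x, ∀ ε ∈ Set.Ioc (0 : ℝ) 1,
        ‖(∫ z, (qscaled D x z * (betaScaled D ρeq x z ε - 1)) • z) - ε • a x‖
          ≤ K x * ε ^ 2 := by
  obtain ⟨c, hc, hcD⟩ := hDinf
  obtain ⟨C₁, hC₁⟩ := hDbd 1 le_rfl (by norm_num)
  obtain ⟨C₂, hC₂⟩ := hLbd 1 le_rfl (by norm_num)
  simp_rw [← norm_gradient] at hC₁ hC₂
  have hC₁0 : 0 ≤ C₁ := (norm_nonneg _).trans (hC₁ 0)
  have hC₂0 : 0 ≤ C₂ := (norm_nonneg _).trans (hC₂ 0)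
  have hDpos : ∀ x, 0 < D x := fun x => hc.trans_le (hcD x)
  have hDdiff : Differentiable ℝ D := hDsmooth.differentiable (by norm_num)
  have hLdiff : Differentiable ℝ fun x => Real.log (ρeq x) :=
    hLsmooth.differentiable (by norm_num)
  set B := 1 + D 0 + C₁ with hB
  have hB1 : 1 ≤ B := by linarith [hDpos 0]
  have hDgrowth : ∀ x, D x ≤ B * (1 + ‖x‖) := fun x => by
    have h := Convex.norm_image_sub_le_of_norm_fderiv_le (𝕜 := ℝ) (s := Set.univ) (f := D) (C := C₁)
      (fun y _ => hDdiff y)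
      (fun y _ => by simpa [gradient] using hC₁ y) convex_univ (Set.mem_univ 0) (Set.mem_univ x)
    rw [sub_zero, Real.norm_eq_abs] at h
    have h1 := (abs_le.1 h).2
    nlinarith [norm_nonneg x, hDpos 0]
  have hsgrowth : ∀ x, √(D x) ≤ B * (1 + ‖x‖) := fun x => by
    have h1 : 1 ≤ B * (1 + ‖x‖) := by nlinarith [norm_nonneg x]
    rw [Real.sqrt_le_left (by linarith)]
    nlinarith [hDgrowth x]
  set M := ∫ y : EuclideanSpace ℝ (Fin d), heatDensity y * ((‖y‖ + ‖y‖ ^ 3) ^ 2 * ‖y‖) with hM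
  have hM0 : 0 ≤ M := integral_nonneg fun y => mul_nonneg (heatDensity_nonneg y) (by positivity)
  set P := (d + 1) * (C₁ / (2 * √c)) with hP
  have hP0 : 0 ≤ P := by positivity
  set κ := B * (P + B * C₂) ^ 2 * M with hκ
  have hκ0 : 0 ≤ κ := by positivity
  refine ⟨fun x => 4 * κ * (1 + ‖x‖ ^ 3), 4 * κ, 3, fun x => ?_, fun x ε hε => ?_⟩
  · exact (abs_of_nonneg (by positivity)).le
  rw [ha]
  refine (norm_integral_betaScaled_sub_le (hDpos x) (hDdiff x) hρeqpos (hLdiff x) hε.1).trans ?_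
  have hx := norm_nonneg x
  have hA : (d + 1) * (‖gradient D x‖ / (2 * √(D x)))
      + √(D x) * ‖gradient (fun y => Real.log (ρeq y)) x‖ ≤ (P + B * C₂) * (1 + ‖x‖) := by
    calc _ ≤ P + B * (1 + ‖x‖) * C₂ := by
          have hsc : √c ≤ √(D x) := Real.sqrt_le_sqrt (hcD x)
          have hsc0 : 0 < √c := Real.sqrt_pos.2 hc
          gcongr
          · rw [hP]
            gcongr
            exact hC₁ x
          · exact hsgrowth x
          · exact hC₂ x
      _ ≤ _ := by nlinarith
  have hcube : (1 + ‖x‖) ^ 3 ≤ 4 * (1 + ‖x‖ ^ 3) := by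
    nlinarith [mul_nonneg (by linarith : 0 ≤ 1 + ‖x‖) (sq_nonneg (1 - ‖x‖))]
  calc _ ≤ (B * (1 + ‖x‖)) * (ε ^ 2 * ((P + B * C₂) * (1 + ‖x‖)) ^ 2 * M) := by
        gcongr
        exact hsgrowth x
    _ = κ * (1 + ‖x‖) ^ 3 * ε ^ 2 := by ring
    _ ≤ κ * (4 * (1 + ‖x‖ ^ 3)) * ε ^ 2 := by gcongr
    _ = _ := by ring
end
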